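/- Let d, n ≥ 2, V(x) = |x|², and β_n > 0 with β_n/n → ∞. Let X_n ~ P_n be the associated Coulomb gas and let μ_* be the uniform probability measure on the closed unit ball of ℝ^d. Then, for every p ≥ 1 and every ε > 0, the series Σ_n P(d_{W_p}((1/n)Σ_{i=1}^n δ_{X_{n,i}}, μ_*) ≥ ε) converges; consequently, almost surely and for all p ≥ 1, d_{W_p}((1/n)Σ_{i=1}^n δ_{X_{n,i}}, μ_*) → 0 as n → ∞, regardless of the way the random variables X_n are defined on the same probability space. -/

import Mathlib

open MeasureTheory Filter Metric
open scoped ENNReal NNReal RealInnerProductSpace BigOperators Topology ProbabilityTheory Classical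

noncomputable section

/-- `ℝ^d` as a Euclidean space. -/
abbrev Euc (d : ℕ) : Type := EuclideanSpace ℝ (Fin d)

/-- The Coulomb kernel `g`, valued in `ℝ ∪ {+∞}` (`= ⊤` at the origin). -/
noncomputable def coulombK (d : ℕ) (x : Euc d) : EReal :=
  if x = 0 then ⊤
  else if d = 2 then ((Real.log (1 / ‖x‖) : ℝ) : EReal)
  else ((1 / (((d : ℝ) - 2) * ‖x‖ ^ ((d : ℕ) - 2)) : ℝ) : EReal)

/-- Positive part of an extended real, as an extended nonnegative real. -/
noncomputable def posP (x : EReal) : ℝ≥0∞ := if x = ⊤ then ⊤ else ENNReal.ofReal x.toReal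

/-- The electrostatic energy `E(μ) = ∬ (g(x-y) + (V x + V y)/2) dμ dμ`, valued in `EReal`,
defined as the difference of the integrals of the positive and negative parts of the
integrand. -/
noncomputable def energy (d : ℕ) (V : Euc d → ℝ) (μ : Measure (Euc d)) : EReal :=
  ((∫⁻ q : Euc d × Euc d,
      posP (coulombK d (q.1 - q.2) + (((V q.1 + V q.2) / 2 : ℝ) : EReal)) ∂(μ.prod μ) : ℝ≥0∞) : EReal)
  - ((∫⁻ q : Euc d × Euc d,
      posP (-(coulombK d (q.1 - q.2) + (((V q.1 + V q.2) / 2 : ℝ) : EReal))) ∂(μ.prod μ) : ℝ≥0∞) : EReal)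

/-- Finiteness of the `p`-th moment of a measure on `ℝ^d`. -/
def FiniteMoment (d : ℕ) (p : ℝ) (μ : Measure (Euc d)) : Prop :=
  ∫⁻ x, ENNReal.ofReal (‖x‖ ^ p) ∂μ ≠ ⊤

/-- Couplings of two measures. -/
def Couplings (d : ℕ) (μ ν : Measure (Euc d)) : Set (Measure (Euc d × Euc d)) :=
  {π | π.map Prod.fst = μ ∧ π.map Prod.snd = ν}

/-- The `p`-Wasserstein distance (valued in `ℝ≥0∞`). -/
noncomputable def wassDist (d : ℕ) (p : ℝ) (μ ν : Measure (Euc d)) : ℝ≥0∞ :=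
  (⨅ π ∈ Couplings d μ ν, ∫⁻ q : Euc d × Euc d, ENNReal.ofReal (‖q.1 - q.2‖ ^ p) ∂π) ^ (1 / p)

/-- Real-valued Coulomb kernel (junk value at the origin; only used in densities with
respect to Lebesgue measure, for which the diagonal is negligible). -/
noncomputable def coulombKR (d : ℕ) (x : Euc d) : ℝ :=
  if d = 2 then Real.log (1 / ‖x‖) else 1 / (((d : ℝ) - 2) * ‖x‖ ^ ((d : ℕ) - 2))

/-- The Coulomb gas Hamiltonian `H_n`. -/
noncomputable def hamiltonian (d n : ℕ) (V : Euc d → ℝ) (x : Fin n → Euc d) : ℝ :=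
  (1 / (n : ℝ)) * ∑ i, V (x i)
    + (1 / (n : ℝ) ^ 2) *
        ∑ q ∈ Finset.univ.filter (fun q : Fin n × Fin n => q.1 ≠ q.2), coulombKR d (x q.1 - x q.2)

/-- The Gibbs measure `P_n` with density proportional to `exp(-β H_n)`. -/
noncomputable def gibbs (d n : ℕ) (β : ℝ) (V : Euc d → ℝ) : Measure (Fin n → Euc d) :=
  ((∫⁻ x, ENNReal.ofReal (Real.exp (-β * hamiltonian d n V x)) ∂(Measure.pi fun _ => volume))⁻¹) •
    (Measure.pi fun _ => (volume : Measure (Euc d))).withDensity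
      (fun x => ENNReal.ofReal (Real.exp (-β * hamiltonian d n V x)))

/-- Empirical measure of a configuration. -/
noncomputable def empMeas (d n : ℕ) (x : Fin n → Euc d) : Measure (Euc d) :=
  ((n : ℝ≥0∞))⁻¹ • ∑ i, Measure.dirac (x i)

/-- Uniform probability measure on the closed ball of radius 1 centered at `c`. -/
noncomputable def uniformBall (d : ℕ) (c : Euc d) : Measure (Euc d) :=
  (volume (Metric.closedBall c 1))⁻¹ • volume.restrict (Metric.closedBall c 1)

/-- Support of a measure. -/
def measSupport (d : ℕ) (μ : Measure (Euc d)) : Set (Euc d) :=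
  {x | ∀ U : Set (Euc d), IsOpen U → x ∈ U → μ U ≠ 0}

/-- The Coulomb interaction energy `J(μ) = ∬ g(x-y) dμ dμ` (the energy with `V = 0`). -/
noncomputable def interactionJ (d : ℕ) (μ : Measure (Euc d)) : EReal :=
  energy d (fun _ => 0) μ

/-- A set has null capacity if it contains no compact set carrying a probability measure
of finite Coulomb interaction energy. -/
def NullCapacity (d : ℕ) (A : Set (Euc d)) : Prop :=
  ∀ K : Set (Euc d), K ⊆ A → IsCompact K →
    ∀ μ : Measure (Euc d), IsProbabilityMeasure μ → μ Kᶜ = 0 → interactionJ d μ = ⊤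

/-- A property holds quasi-everywhere if it holds outside a Borel set of null capacity. -/
def QuasiEverywhere (d : ℕ) (P : Euc d → Prop) : Prop :=
  ∃ N : Set (Euc d), MeasurableSet N ∧ NullCapacity d N ∧ ∀ x ∉ N, P x

/-- The Coulomb potential `(g * μ)(x) = ∫ g(x - y) μ(dy)`, valued in `EReal`. -/
noncomputable def coulombPot (d : ℕ) (μ : Measure (Euc d)) (x : Euc d) : EReal :=
  ((∫⁻ y, posP (coulombK d (x - y)) ∂μ : ℝ≥0∞) : EReal)
  - ((∫⁻ y, posP (-(coulombK d (x - y))) ∂μ : ℝ≥0∞) : EReal)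

/-- The set `P_p(ℝ^d)` of probability measures with finite `p`-th moment. -/
def Ppd (d : ℕ) (p : ℝ) : Set (Measure (Euc d)) :=
  {μ | IsProbabilityMeasure μ ∧ FiniteMoment d p μ}

/-- `B` is closed in the `p`-Wasserstein topology (within `P_p(ℝ^d)`). -/
def WClosedIn (d : ℕ) (p : ℝ) (B : Set (Measure (Euc d))) : Prop :=
  ∀ μ ∈ Ppd d p, (∀ ε : ℝ, 0 < ε → ∃ ν ∈ B, wassDist d p μ ν < ENNReal.ofReal ε) → μ ∈ B

/-- Interior of `B` in the `p`-Wasserstein topology (within `P_p(ℝ^d)`). -/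
def wInterior (d : ℕ) (p : ℝ) (B : Set (Measure (Euc d))) : Set (Measure (Euc d)) :=
  {μ | μ ∈ B ∧ ∃ ε : ℝ, 0 < ε ∧ ∀ ν ∈ Ppd d p, wassDist d p μ ν < ENNReal.ofReal ε → ν ∈ B}

/-- The growth condition `V(x) ≥ a |x|^q - R`. -/
def GrowthCond (d : ℕ) (V : Euc d → ℝ) (a q R : ℝ) : Prop :=
  ∀ x : Euc d, a * ‖x‖ ^ q - R ≤ V x


lemma coupling_exists {E : Type*} [MeasurableSpace E] (ν μ l : Measure E)
    [IsProbabilityMeasure ν] [IsProbabilityMeasure μ] [SFinite l]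
    (k : E → E → ℝ≥0∞) (hk : Measurable (Function.uncurry k))
    (hk1 : ∀ x, ∫⁻ z, k x z ∂l = 1)
    (hP0 : ∀ z, ∫⁻ x, k x z ∂ν ≠ 0) (hPt : ∀ z, ∫⁻ x, k x z ∂ν ≠ ⊤)
    (hQ0 : ∀ z, ∫⁻ x, k x z ∂μ ≠ 0) (hQt : ∀ z, ∫⁻ x, k x z ∂μ ≠ ⊤) :
    ∃ A A' : E → ℝ≥0∞, (∀ x, A x ≤ 1) ∧ (∀ x, A' x ≤ 1) ∧ Measurable A ∧ Measurable A' ∧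
      ∫⁻ x, (1 - A x) ∂ν = ∫⁻ z, (∫⁻ x, k x z ∂μ) - (∫⁻ x, k x z ∂ν) ∂l ∧
      ∫⁻ x, (1 - A' x) ∂μ = ∫⁻ z, (∫⁻ x, k x z ∂μ) - (∫⁻ x, k x z ∂ν) ∂l ∧
      ∃ π : Measure (E × E), π.map Prod.fst = ν ∧ π.map Prod.snd = μ ∧
        ∀ (c : E × E → ℝ≥0∞) (a b : E → E → ℝ≥0∞) (f h : E → ℝ≥0∞), Measurable c →
          Measurable (Function.uncurry a) → Measurable (Function.uncurry b) →
          Measurable f → Measurable h →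
          (∀ x y z, c (x, y) ≤ a x z + b y z) → (∀ x y, c (x, y) ≤ f x + h y) →
          ∫⁻ q, c q ∂π ≤ ∫⁻ x, ∫⁻ z, k x z * a x z ∂l ∂ν + ∫⁻ y, ∫⁻ z, k y z * b y z ∂l ∂μ
            + ∫⁻ x, f x * (1 - A x) ∂ν + ∫⁻ y, h y * (1 - A' y) ∂μ := by
  set P : E → ℝ≥0∞ := fun z => ∫⁻ x, k x z ∂ν with hP
  set Q : E → ℝ≥0∞ := fun z => ∫⁻ x, k x z ∂μ with hQ
  have hPm : Measurable P := by
    have : Measurable (Function.uncurry fun z x => k x z) := hk.comp measurable_swap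
    exact this.lintegral_prod_right'
  have hQm : Measurable Q := by
    have : Measurable (Function.uncurry fun z x => k x z) := hk.comp measurable_swap
    exact this.lintegral_prod_right'
  set m : E → ℝ≥0∞ := fun z => min (P z) (Q z) with hm
  have hmm : Measurable m := hPm.min hQm
  set A : E → ℝ≥0∞ := fun x => ∫⁻ z, k x z * (m z / P z) ∂l with hA
  set A' : E → ℝ≥0∞ := fun x => ∫⁻ z, k x z * (m z / Q z) ∂l with hA'
  have hmP : ∀ z, m z / P z ≤ 1 := fun z => ENNReal.div_le_of_le_mul (by simp [m])
  have hmQ : ∀ z, m z / Q z ≤ 1 := fun z => ENNReal.div_le_of_le_mul (by simp [m])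
  have hA1 : ∀ x, A x ≤ 1 := fun x => by
    rw [← hk1 x]; exact lintegral_mono fun z => mul_le_of_le_one_right' (hmP z)
  have hA'1 : ∀ x, A' x ≤ 1 := fun x => by
    rw [← hk1 x]; exact lintegral_mono fun z => mul_le_of_le_one_right' (hmQ z)
  have hmPm : Measurable fun z => m z / P z := hmm.div hPm
  have hmQm : Measurable fun z => m z / Q z := hmm.div hQm
  have hAm : Measurable A := by
    have : Measurable (Function.uncurry fun x z => k x z * (m z / P z)) :=
      hk.mul (hmPm.comp measurable_snd)
    exact this.lintegral_prod_right'
  have hA'm : Measurable A' := by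
    have : Measurable (Function.uncurry fun x z => k x z * (m z / Q z)) :=
      hk.mul (hmQm.comp measurable_snd)
    exact this.lintegral_prod_right'
  have hkz : ∀ z, Measurable fun x => k x z := fun z => hk.comp measurable_prodMk_right
  have hkx : ∀ x, Measurable fun z => k x z := fun x => hk.comp measurable_prodMk_left
  have hIA : ∫⁻ x, A x ∂ν = ∫⁻ z, m z ∂l := by
    rw [hA, lintegral_lintegral_swap]
    · refine lintegral_congr fun z => ?_
      rw [lintegral_mul_const _ (hkz z)]
      exact ENNReal.mul_div_cancel (hP0 z) (hPt z)
    · exact (hk.mul (hmPm.comp measurable_snd)).aemeasurable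
  have hIA' : ∫⁻ x, A' x ∂μ = ∫⁻ z, m z ∂l := by
    rw [hA', lintegral_lintegral_swap]
    · refine lintegral_congr fun z => ?_
      rw [lintegral_mul_const _ (hkz z)]
      exact ENNReal.mul_div_cancel (hQ0 z) (hQt z)
    · exact (hk.mul (hmQm.comp measurable_snd)).aemeasurable
  have hIQ : ∫⁻ z, Q z ∂l = 1 := by
    rw [hQ, lintegral_lintegral_swap]
    · simp [hk1]
    · exact (hk.comp measurable_swap).aemeasurable
  have hmr : ∫⁻ z, m z ∂l + ∫⁻ z, (Q z - P z) ∂l = 1 := by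
    rw [← lintegral_add_left hmm, ← hIQ]
    refine lintegral_congr fun z => ?_
    simp only [m]
    rcases le_total (P z) (Q z) with h | h
    · rw [min_eq_left h, add_tsub_cancel_of_le h]
    · rw [min_eq_right h, tsub_eq_zero_of_le h, add_zero]
  have hmfin : ∫⁻ z, m z ∂l ≠ ⊤ := by
    refine ne_top_of_le_ne_top ENNReal.one_ne_top ?_
    rw [← hmr]; exact le_self_add
  set r : ℝ≥0∞ := ∫⁻ z, (Q z - P z) ∂l with hr
  have hr1 : 1 - ∫⁻ z, m z ∂l = r := by
    rw [← hmr]; exact ENNReal.add_sub_cancel_left hmfin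
  have hrt : r ≠ ⊤ := by
    refine ne_top_of_le_ne_top ENNReal.one_ne_top ?_
    rw [← hmr]; exact le_add_self
  have hR1 : ∫⁻ x, (1 - A x) ∂ν = r := by
    rw [lintegral_sub hAm (by rw [hIA]; exact hmfin) (ae_of_all _ hA1), hIA]
    simpa using hr1
  have hR2 : ∫⁻ x, (1 - A' x) ∂μ = r := by
    rw [lintegral_sub hA'm (by rw [hIA']; exact hmfin) (ae_of_all _ hA'1), hIA']
    simpa using hr1
  set D : E × E → ℝ≥0∞ := fun q => ∫⁻ z, k q.1 z * k q.2 z * (m z / P z / Q z) ∂l with hD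
  have hD3 : Measurable (fun w : (E × E) × E =>
      k w.1.1 w.2 * k w.1.2 w.2 * (m w.2 / P w.2 / Q w.2)) := by
    have h1 : Measurable fun w : (E × E) × E => k w.1.1 w.2 :=
      hk.comp (by fun_prop : Measurable fun w : (E × E) × E => (w.1.1, w.2))
    have h2 : Measurable fun w : (E × E) × E => k w.1.2 w.2 :=
      hk.comp (by fun_prop : Measurable fun w : (E × E) × E => (w.1.2, w.2))
    exact (h1.mul h2).mul ((hmPm.div hQm).comp measurable_snd)
  have hDm : Measurable D := hD3.lintegral_prod_right'
  set ν' := ν.withDensity (fun x => 1 - A x) with hν'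
  set μ' := μ.withDensity (fun x => 1 - A' x) with hμ'
  have hν'u : ν' Set.univ = r := by
    rw [hν', withDensity_apply _ MeasurableSet.univ]; simpa using hR1
  have hμ'u : μ' Set.univ = r := by
    rw [hμ', withDensity_apply _ MeasurableSet.univ]; simpa using hR2
  have : IsFiniteMeasure ν' := ⟨by rw [hν'u]; exact hrt.lt_top⟩
  have : IsFiniteMeasure μ' := ⟨by rw [hμ'u]; exact hrt.lt_top⟩
  have hDx : ∀ x, ∫⁻ y, D (x, y) ∂μ = A x := by
    intro x
    simp only [hD, hA]
    rw [lintegral_lintegral_swap]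
    · refine lintegral_congr fun z => ?_
      have : ∀ y, k x z * k y z * (m z / P z / Q z) = k y z * (k x z * (m z / P z / Q z)) :=
        fun y => by ring
      simp_rw [this]
      rw [lintegral_mul_const _ (hkz z)]
      change Q z * _ = _
      rw [mul_left_comm, ENNReal.mul_div_cancel (hQ0 z) (hQt z)]
    · exact (hD3.comp (by fun_prop :
        Measurable fun w : E × E => (((x, w.1) : E × E), w.2))).aemeasurable
  have hDy : ∀ y, ∫⁻ x, D (x, y) ∂ν = A' y := by
    intro y
    simp only [hD, hA']
    rw [lintegral_lintegral_swap]
    · refine lintegral_congr fun z => ?_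
      have : ∀ x, k x z * k y z * (m z / P z / Q z) = k x z * (k y z * (m z / Q z / P z)) :=
        fun x => by simp only [div_eq_mul_inv]; ring
      simp_rw [this]
      rw [lintegral_mul_const _ (hkz z)]
      change P z * _ = _
      rw [mul_left_comm, ENNReal.mul_div_cancel (hP0 z) (hPt z)]
    · exact (hD3.comp (by fun_prop :
        Measurable fun w : E × E => (((w.1, y) : E × E), w.2))).aemeasurable
  refine ⟨A, A', hA1, hA'1, hAm, hA'm, hR1, hR2,
    (ν.prod μ).withDensity D + r⁻¹ • ν'.prod μ', ?_, ?_, ?_⟩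
  · ext s hs
    rw [Measure.map_add _ _ measurable_fst, Measure.map_smul, Measure.add_apply,
      Measure.smul_apply, Measure.map_apply measurable_fst hs, Measure.map_apply measurable_fst hs,
      withDensity_apply _ (measurable_fst hs)]
    have e1 : ∫⁻ q in Prod.fst ⁻¹' s, D q ∂(ν.prod μ) = ∫⁻ x in s, A x ∂ν := by
      rw [← Set.prod_univ, ← Measure.prod_restrict, lintegral_prod _ hDm.aemeasurable]
      simp [hDx]
    have e2 : r⁻¹ • (ν'.prod μ') (Prod.fst ⁻¹' s) = ∫⁻ x in s, (1 - A x) ∂ν := by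
      rw [← Set.prod_univ, Measure.prod_prod, hμ'u, ← withDensity_apply _ hs, ← hν', smul_eq_mul]
      by_cases h0 : r = 0
      · have : ν' s = 0 := le_antisymm ((measure_mono (Set.subset_univ s)).trans
          (by rw [hν'u, h0])) (zero_le)
        simp [this]
      · rw [mul_left_comm, ENNReal.inv_mul_cancel h0 hrt, mul_one]
    rw [e1, e2, ← lintegral_add_left hAm]
    simp [add_tsub_cancel_of_le (hA1 _)]
  · ext s hs
    rw [Measure.map_add _ _ measurable_snd, Measure.map_smul, Measure.add_apply,
      Measure.smul_apply, Measure.map_apply measurable_snd hs, Measure.map_apply measurable_snd hs,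
      withDensity_apply _ (measurable_snd hs)]
    have e1 : ∫⁻ q in Prod.snd ⁻¹' s, D q ∂(ν.prod μ) = ∫⁻ x in s, A' x ∂μ := by
      rw [← Set.univ_prod, ← Measure.prod_restrict, lintegral_prod_symm _ hDm.aemeasurable]
      simp [hDy]
    have e2 : r⁻¹ • (ν'.prod μ') (Prod.snd ⁻¹' s) = ∫⁻ x in s, (1 - A' x) ∂μ := by
      rw [← Set.univ_prod, Measure.prod_prod, hν'u, ← withDensity_apply _ hs, ← hμ', smul_eq_mul]
      by_cases h0 : r = 0
      · have : μ' s = 0 := le_antisymm ((measure_mono (Set.subset_univ s)).trans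
          (by rw [hμ'u, h0])) (zero_le)
        simp [this]
      · rw [← mul_assoc, ENNReal.inv_mul_cancel h0 hrt, one_mul]
    rw [e1, e2, ← lintegral_add_left hA'm]
    simp [add_tsub_cancel_of_le (hA'1 _)]
  · intro c a b f h hc ha hb hf hh hcab hcfh
    rw [lintegral_add_measure, lintegral_smul_measure, add_assoc]
    refine add_le_add ?_ ?_
    · rw [lintegral_withDensity_eq_lintegral_mul _ hDm hc]
      have hm1 : Measurable (fun w : (E × E) × E =>
          k w.1.1 w.2 * k w.1.2 w.2 * (m w.2 / P w.2 / Q w.2) * a w.1.1 w.2) :=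
        hD3.mul (ha.comp (by fun_prop : Measurable fun w : (E × E) × E => (w.1.1, w.2)))
      have hm2 : Measurable (fun w : (E × E) × E =>
          k w.1.1 w.2 * k w.1.2 w.2 * (m w.2 / P w.2 / Q w.2) * b w.1.2 w.2) :=
        hD3.mul (hb.comp (by fun_prop : Measurable fun w : (E × E) × E => (w.1.2, w.2)))
      calc ∫⁻ q, (D * c) q ∂(ν.prod μ)
          = ∫⁻ q, ∫⁻ z, k q.1 z * k q.2 z * (m z / P z / Q z) * c q ∂l ∂(ν.prod μ) := by
            refine lintegral_congr fun q => ?_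
            rw [lintegral_mul_const]
            · rfl
            · exact hD3.comp measurable_prodMk_left
        _ ≤ ∫⁻ q, ∫⁻ z, (k q.1 z * k q.2 z * (m z / P z / Q z) * a q.1 z
              + k q.1 z * k q.2 z * (m z / P z / Q z) * b q.2 z) ∂l ∂(ν.prod μ) := by
            refine lintegral_mono fun q => lintegral_mono fun z => ?_
            rw [← mul_add]
            exact mul_le_mul_right (hcab q.1 q.2 z) _
        _ = ∫⁻ q, ∫⁻ z, k q.1 z * k q.2 z * (m z / P z / Q z) * a q.1 z ∂l ∂(ν.prod μ)
              + ∫⁻ q, ∫⁻ z, k q.1 z * k q.2 z * (m z / P z / Q z) * b q.2 z ∂l ∂(ν.prod μ) := by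
            rw [← lintegral_add_left hm1.lintegral_prod_right']
            refine lintegral_congr fun q => ?_
            exact lintegral_add_left (hm1.comp measurable_prodMk_left) _
        _ ≤ _ := by
            refine add_le_add ?_ ?_
            · rw [lintegral_prod _ hm1.lintegral_prod_right'.aemeasurable]
              refine lintegral_mono fun x => ?_
              dsimp only
              rw [lintegral_lintegral_swap]
              · refine lintegral_mono fun z => ?_
                have : ∀ y, k x z * k y z * (m z / P z / Q z) * a x z
                  = k y z * (k x z * (m z / P z / Q z) * a x z) := fun y => by ring
                simp_rw [this]
                rw [lintegral_mul_const _ (hkz z)]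
                change Q z * _ ≤ _
                have : Q z * (k x z * (m z / P z / Q z) * a x z)
                    = (k x z * a x z) * (Q z * (m z / P z / Q z)) := by ring
                rw [this, ENNReal.mul_div_cancel (hQ0 z) (hQt z)]
                exact mul_le_of_le_one_right' (hmP z)
              · exact (hm1.comp (by fun_prop :
                  Measurable fun w : E × E => (((x, w.1) : E × E), w.2))).aemeasurable
            · rw [lintegral_prod_symm _ hm2.lintegral_prod_right'.aemeasurable]
              refine lintegral_mono fun y => ?_
              dsimp only
              rw [lintegral_lintegral_swap]
              · refine lintegral_mono fun z => ?_
                have : ∀ x, k x z * k y z * (m z / P z / Q z) * b y z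
                  = k x z * (k y z * (m z / Q z / P z) * b y z) := fun x => by
                    simp only [div_eq_mul_inv]; ring
                simp_rw [this]
                rw [lintegral_mul_const _ (hkz z)]
                change P z * _ ≤ _
                have : P z * (k y z * (m z / Q z / P z) * b y z)
                    = (k y z * b y z) * (P z * (m z / Q z / P z)) := by ring
                rw [this, ENNReal.mul_div_cancel (hP0 z) (hPt z)]
                exact mul_le_of_le_one_right' (hmQ z)
              · exact (hm2.comp (by fun_prop :
                  Measurable fun w : E × E => (((w.1, y) : E × E), w.2))).aemeasurable
    · have hle : ∫⁻ q, c q ∂(ν'.prod μ') ≤ r * (∫⁻ x, f x ∂ν' + ∫⁻ y, h y ∂μ') := by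
        calc ∫⁻ q, c q ∂(ν'.prod μ') ≤ ∫⁻ q, (f q.1 + h q.2) ∂(ν'.prod μ') :=
              lintegral_mono fun q => hcfh q.1 q.2
          _ = ∫⁻ q, f q.1 ∂(ν'.prod μ') + ∫⁻ q, h q.2 ∂(ν'.prod μ') :=
              lintegral_add_left (hf.comp measurable_fst) _
          _ = _ := by
              rw [lintegral_prod (fun q : E × E => f q.1) (hf.comp measurable_fst).aemeasurable,
                lintegral_prod_symm (fun q : E × E => h q.2) (hh.comp measurable_snd).aemeasurable]
              simp only [lintegral_const, hν'u, hμ'u]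
              rw [lintegral_mul_const _ hf, lintegral_mul_const _ hh]
              ring
      have e1 : ∫⁻ x, f x ∂ν' = ∫⁻ x, f x * (1 - A x) ∂ν := by
        rw [hν', lintegral_withDensity_eq_lintegral_mul ν (f := fun x => 1 - A x) (measurable_const.sub hAm) hf]
        exact lintegral_congr fun x => mul_comm _ _
      have e2 : ∫⁻ x, h x ∂μ' = ∫⁻ x, h x * (1 - A' x) ∂μ := by
        rw [hμ', lintegral_withDensity_eq_lintegral_mul μ (f := fun x => 1 - A' x) (measurable_const.sub hA'm) hh]
        exact lintegral_congr fun x => mul_comm _ _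
      rw [← e1, ← e2, smul_eq_mul]
      refine (mul_le_mul_right hle _).trans ?_
      rw [← mul_assoc]
      exact mul_le_of_le_one_left' (ENNReal.inv_mul_le_one _)

/-- Gaussian probability density. -/
def gs (d : ℕ) (a : ℝ) (x : Euc d) : ℝ :=
  (a / Real.pi) ^ ((d : ℝ) / 2) * Real.exp (-a * ‖x‖ ^ 2)

lemma gs_pos (d : ℕ) {a : ℝ} (ha : 0 < a) (x : Euc d) : 0 < gs d a x := by
  unfold gs; have := Real.pi_pos; positivity

lemma gs_le (d : ℕ) {a : ℝ} (ha : 0 < a) (x : Euc d) : gs d a x ≤ (a / Real.pi) ^ ((d : ℝ) / 2) := by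
  unfold gs
  have := Real.pi_pos
  refine mul_le_of_le_one_right (by positivity) (Real.exp_le_one_iff.2 ?_)
  nlinarith [sq_nonneg ‖x‖]

lemma gs_cont (d : ℕ) (a : ℝ) : Continuous (gs d a) := by unfold gs; fun_prop

lemma gs_neg (d : ℕ) (a : ℝ) (x : Euc d) : gs d a (-x) = gs d a x := by simp [gs]

lemma gauss_integrable (d : ℕ) {a : ℝ} (ha : 0 < a) :
    Integrable (fun x : Euc d => Real.exp (-a * ‖x‖ ^ 2)) := by
  by_contra h
  have h1 := GaussianFourier.integral_rexp_neg_mul_sq_norm (V := Euc d) ha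
  rw [integral_undef h] at h1
  have : 0 < (Real.pi / a) ^ ((Module.finrank ℝ (Euc d) : ℝ) / 2) := by
    have := Real.pi_pos; positivity
  exact absurd h1 this.ne

lemma gauss_integral (d : ℕ) {a : ℝ} (ha : 0 < a) :
    ∫ x : Euc d, Real.exp (-a * ‖x‖ ^ 2) = (Real.pi / a) ^ ((d : ℝ) / 2) := by
  rw [GaussianFourier.integral_rexp_neg_mul_sq_norm (V := Euc d) ha]; simp

lemma gs_integrable (d : ℕ) {a : ℝ} (ha : 0 < a) : Integrable (gs d a) :=
  (gauss_integrable d ha).const_mul _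

lemma gs_integral (d : ℕ) {a : ℝ} (ha : 0 < a) : ∫ x, gs d a x = 1 := by
  unfold gs
  have := Real.pi_pos
  rw [integral_const_mul, gauss_integral d ha, ← Real.mul_rpow (by positivity) (by positivity)]
  have : a / Real.pi * (Real.pi / a) = 1 := by field_simp
  rw [this, Real.one_rpow]

lemma gs_lintegral (d : ℕ) {a : ℝ} (ha : 0 < a) : ∫⁻ x, ENNReal.ofReal (gs d a x) = 1 := by
  rw [← ofReal_integral_eq_lintegral_ofReal (gs_integrable d ha)
    (ae_of_all _ fun x => (gs_pos d ha x).le), gs_integral d ha, ENNReal.ofReal_one]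

lemma gauss_moment_integrable (d : ℕ) (hd : 2 ≤ d) {p : ℝ} (hp : 0 ≤ p) {a : ℝ} (ha : 0 < a) :
    Integrable (fun x : Euc d => ‖x‖ ^ p * Real.exp (-a * ‖x‖ ^ 2)) := by
  have : Nontrivial (Euc d) := by
    have : Nonempty (Fin d) := ⟨⟨0, by omega⟩⟩
    infer_instance
  rw [integrable_fun_norm_addHaar volume (f := fun r : ℝ => r ^ p * Real.exp (-a * r ^ 2))]
  have h := integrableOn_rpow_mul_exp_neg_mul_sq ha (s := ((d - 1 : ℕ) : ℝ) + p)
    (by have : (0:ℝ) ≤ ((d-1 : ℕ) : ℝ) := by positivity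
        linarith)
  refine h.congr_fun (fun y hy => ?_) measurableSet_Ioi
  have hy : (0:ℝ) < y := hy
  simp only [finrank_euclideanSpace, Fintype.card_fin, smul_eq_mul]
  rw [Real.rpow_add hy, Real.rpow_natCast]; ring

/-- `p`-th moment of the Gaussian. -/
def gsM (d : ℕ) (p a : ℝ) : ℝ≥0∞ :=
  ∫⁻ x : Euc d, ENNReal.ofReal (gs d a x) * ENNReal.ofReal (‖x‖ ^ p)

lemma gsM_one_ne_top (d : ℕ) (hd : 2 ≤ d) {p : ℝ} (hp : 0 ≤ p) : gsM d p 1 ≠ ⊤ := by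
  have h : Integrable (fun x : Euc d => gs d 1 x * ‖x‖ ^ p) := by
    refine ((gauss_moment_integrable d hd hp one_pos).const_mul
      ((1 / Real.pi) ^ ((d : ℝ) / 2))).congr (ae_of_all _ fun x => ?_)
    simp only [gs]; ring
  have h2 := h.lintegral_lt_top
  refine ne_of_lt (lt_of_le_of_lt (le_of_eq ?_) h2)
  unfold gsM
  refine lintegral_congr fun x => ?_
  rw [ENNReal.ofReal_mul (gs_pos d one_pos x).le]

lemma gsM_scale (d : ℕ) {p : ℝ} {a : ℝ} (ha : 0 < a) :
    gsM d p a = ENNReal.ofReal (a ^ (-(p / 2))) * gsM d p 1 := by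
  have hsa : 0 < Real.sqrt a := Real.sqrt_pos.2 ha
  set F : Euc d → ℝ≥0∞ := fun x => ENNReal.ofReal (gs d 1 x) * ENNReal.ofReal (‖x‖ ^ p) with hF
  have hFm : Measurable F := by
    refine (gs_cont d 1).measurable.ennreal_ofReal.mul ?_
    exact (measurable_norm.pow_const p).ennreal_ofReal
  have h1 : ∫⁻ x, F (Real.sqrt a • x) = ENNReal.ofReal (Real.sqrt a ^ d)⁻¹ * ∫⁻ x, F x := by
    rw [← lintegral_map hFm (measurable_const_smul _),
      Measure.map_addHaar_smul _ hsa.ne', lintegral_smul_measure]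
    simp only [finrank_euclideanSpace, Fintype.card_fin, smul_eq_mul]
    rw [abs_of_pos (by positivity)]
  have hdd : Real.sqrt a ^ d = a ^ ((d : ℝ) / 2) := by
    rw [Real.sqrt_eq_rpow, ← Real.rpow_natCast, ← Real.rpow_mul ha.le]; ring_nf
  have hpp : Real.sqrt a ^ p = a ^ (p / 2) := by
    rw [Real.sqrt_eq_rpow, ← Real.rpow_mul ha.le]; ring_nf
  have h2 : ∀ x : Euc d, ENNReal.ofReal (gs d a x) * ENNReal.ofReal (‖x‖ ^ p) =
      ENNReal.ofReal (a ^ ((d : ℝ) / 2) * a ^ (-(p / 2))) * F (Real.sqrt a • x) := by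
    intro x
    have hpi := Real.pi_pos
    rw [hF]; dsimp only
    rw [← ENNReal.ofReal_mul (gs_pos d ha x).le, ← ENNReal.ofReal_mul (gs_pos d one_pos _).le,
      ← ENNReal.ofReal_mul (by positivity)]
    congr 1
    have hn : ‖Real.sqrt a • x‖ = Real.sqrt a * ‖x‖ := by
      rw [norm_smul, Real.norm_of_nonneg hsa.le]
    simp only [gs, hn]
    rw [mul_pow, Real.sq_sqrt ha.le, Real.mul_rpow hsa.le (norm_nonneg _), hpp,
      Real.div_rpow ha.le hpi.le, Real.div_rpow zero_le_one hpi.le, Real.one_rpow,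
      Real.rpow_neg ha.le]
    have : a ^ (p / 2) ≠ 0 := by positivity
    field_simp
  unfold gsM
  simp_rw [h2]
  rw [lintegral_const_mul', h1, ← mul_assoc, ← ENNReal.ofReal_mul (by positivity), hdd]
  · congr 2
    have : a ^ ((d : ℝ) / 2) ≠ 0 := by positivity
    field_simp
  · exact ENNReal.ofReal_ne_top

lemma gsM_small (d : ℕ) (hd : 2 ≤ d) {p : ℝ} (hp : 1 ≤ p) {δ : ℝ≥0∞} (hδ : 0 < δ) :
    ∃ a0 : ℝ, 0 < a0 ∧ ∀ a, a0 ≤ a → gsM d p a ≤ δ := by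
  have h1 : Tendsto (fun a : ℝ => ENNReal.ofReal (a ^ (-(p / 2))) * gsM d p 1) atTop (𝓝 0) := by
    have h2 : Tendsto (fun a : ℝ => a ^ (-(p / 2))) atTop (𝓝 0) :=
      tendsto_rpow_neg_atTop (by linarith)
    have h3 := (ENNReal.tendsto_ofReal h2)
    have := ENNReal.Tendsto.mul_const h3 (Or.inr (gsM_one_ne_top d hd (p := p) (by linarith)))
    simpa using this
  obtain ⟨a0, ha0⟩ := eventually_atTop.1 (h1.eventually (eventually_le_nhds hδ))
  refine ⟨max a0 1, by positivity, fun a ha => ?_⟩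
  rw [gsM_scale d (lt_of_lt_of_le (by positivity) ha)]
  exact ha0 a ((le_max_left _ _).trans ha)

lemma uniformBall_prob (d : ℕ) : IsProbabilityMeasure (uniformBall d 0) := by
  constructor
  unfold uniformBall
  rw [Measure.smul_apply, Measure.restrict_apply_univ, smul_eq_mul]
  exact ENNReal.inv_mul_cancel (measure_closedBall_pos _ _ one_pos).ne'
    measure_closedBall_lt_top.ne

lemma uniformBall_ae (d : ℕ) : ∀ᵐ y ∂(uniformBall d 0), ‖y‖ ≤ 1 := by
  unfold uniformBall
  refine Measure.ae_smul_measure ?_ _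
  filter_upwards [ae_restrict_mem (μ := volume) (s := closedBall (0 : Euc d) 1) measurableSet_closedBall]
    with y hy
  simpa using hy

/-- Gaussian-smoothed density. -/
def pg (d : ℕ) (a : ℝ) (ν : Measure (Euc d)) (z : Euc d) : ℝ := ∫ x, gs d a (x - z) ∂ν

lemma gs_sub_integrable (d : ℕ) {a : ℝ} (ha : 0 < a) (ν : Measure (Euc d)) [IsFiniteMeasure ν]
    (z : Euc d) : Integrable (fun x => gs d a (x - z)) ν := by
  refine Integrable.of_bound (C := (a / Real.pi) ^ ((d : ℝ) / 2))
    ((gs_cont d a).comp (by fun_prop)).aestronglyMeasurable (ae_of_all _ fun x => ?_)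
  rw [Real.norm_of_nonneg (gs_pos d ha _).le]
  exact gs_le d ha _

lemma pg_ofReal (d : ℕ) {a : ℝ} (ha : 0 < a) (ν : Measure (Euc d)) [IsFiniteMeasure ν]
    (z : Euc d) : ∫⁻ x, ENNReal.ofReal (gs d a (x - z)) ∂ν = ENNReal.ofReal (pg d a ν z) := by
  unfold pg
  rw [← ofReal_integral_eq_lintegral_ofReal (gs_sub_integrable d ha ν z)
    (ae_of_all _ fun x => (gs_pos d ha _).le)]

lemma pg_pos (d : ℕ) {a : ℝ} (ha : 0 < a) (ν : Measure (Euc d)) [IsProbabilityMeasure ν]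
    (z : Euc d) : 0 < pg d a ν z := by
  unfold pg
  rw [integral_pos_iff_support_of_nonneg (fun x => (gs_pos d ha _).le) (gs_sub_integrable d ha ν z)]
  have : (Function.support fun x => gs d a (x - z)) = Set.univ := by
    ext x; simp [(gs_pos d ha _).ne']
  rw [this]; simp

lemma add_rpow_bound {p : ℝ} (hp : 1 ≤ p) {d : ℕ} (x y : Euc d) :
    ENNReal.ofReal (‖x - y‖ ^ p) ≤
      ENNReal.ofReal (2 ^ (p - 1)) * ENNReal.ofReal (‖x‖ ^ p)
        + ENNReal.ofReal (2 ^ (p - 1)) * ENNReal.ofReal (‖y‖ ^ p) := by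
  have h := ENNReal.rpow_add_le_mul_rpow_add_rpow (ENNReal.ofReal ‖x‖) (ENNReal.ofReal ‖y‖) hp
  have hp0 : 0 ≤ p := by linarith
  rw [← ENNReal.ofReal_rpow_of_nonneg (norm_nonneg _) hp0,
    ← ENNReal.ofReal_rpow_of_nonneg (norm_nonneg _) hp0,
    ← ENNReal.ofReal_rpow_of_nonneg (norm_nonneg _) hp0, ← mul_add]
  have h2 : ENNReal.ofReal (2 ^ (p - 1)) = (2 : ℝ≥0∞) ^ (p - 1) := by
    rw [← ENNReal.ofReal_rpow_of_nonneg (by norm_num) (by linarith)]; simp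
  rw [h2]
  refine le_trans (ENNReal.rpow_le_rpow ?_ hp0) h
  rw [← ENNReal.ofReal_add (norm_nonneg _) (norm_nonneg _)]
  exact ENNReal.ofReal_le_ofReal (norm_sub_le _ _)

lemma r_bound (d : ℕ) {p : ℝ} (hp : 1 ≤ p) {a s : ℝ} (ha : 0 < a) (hs : 0 < s)
    (ν : Measure (Euc d)) [IsProbabilityMeasure ν]
    (h : ∫⁻ z, ENNReal.ofReal ((pg d a ν z - pg d a (uniformBall d 0) z) ^ 2) ≤
      ENNReal.ofReal (s ^ 2)) :
    ∫⁻ z, (∫⁻ x, ENNReal.ofReal (gs d a (x - z)) ∂(uniformBall d 0))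
      - (∫⁻ x, ENNReal.ofReal (gs d a (x - z)) ∂ν) ≤
    ENNReal.ofReal s * volume (closedBall (0 : Euc d) 2) + ENNReal.ofReal s + gsM d p a := by
  have : IsProbabilityMeasure (uniformBall d 0) := uniformBall_prob d
  set μ := uniformBall d 0 with hμ
  have hkm : Measurable (Function.uncurry fun z x : Euc d => ENNReal.ofReal (gs d a (x - z))) := by
    refine Measurable.ennreal_ofReal ?_
    exact ((gs_cont d a).comp (continuous_snd.sub continuous_fst)).measurable
  rw [← lintegral_add_compl (μ := volume) (A := closedBall (0 : Euc d) 2) _ measurableSet_closedBall]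
  refine add_le_add ?_ ?_
  · have h1 : ∀ z : Euc d, (∫⁻ x, ENNReal.ofReal (gs d a (x - z)) ∂μ)
        - (∫⁻ x, ENNReal.ofReal (gs d a (x - z)) ∂ν) ≤
        ENNReal.ofReal s + ENNReal.ofReal (s⁻¹) * ENNReal.ofReal ((pg d a ν z - pg d a μ z) ^ 2) := by
      intro z
      rw [pg_ofReal d ha, pg_ofReal d ha, ← ENNReal.ofReal_sub _ (pg_pos d ha ν z).le,
        ← ENNReal.ofReal_mul (by positivity), ← ENNReal.ofReal_add hs.le (by positivity)]
      refine ENNReal.ofReal_le_ofReal ?_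
      set u := pg d a ν z - pg d a μ z
      have : pg d a μ z - pg d a ν z = -u := by simp [u]
      rw [this]
      have : s + s⁻¹ * u ^ 2 - (-u) = ((s + u / 2) ^ 2 + 3 / 4 * u ^ 2) / s := by field_simp; ring
      have h3 : 0 ≤ ((s + u / 2) ^ 2 + 3 / 4 * u ^ 2) / s := by positivity
      linarith
    refine (lintegral_mono h1).trans ?_
    rw [lintegral_add_left measurable_const, lintegral_const, Measure.restrict_apply_univ,
      lintegral_const_mul' _ _ ENNReal.ofReal_ne_top]
    refine add_le_add le_rfl ?_
    refine (mul_le_mul_right ((setLIntegral_le_lintegral _ _).trans h) _).trans ?_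
    rw [← ENNReal.ofReal_mul (by positivity)]
    refine ENNReal.ofReal_le_ofReal (le_of_eq ?_)
    field_simp
  · have h1 : ∀ z ∈ (closedBall (0 : Euc d) 2)ᶜ, (∫⁻ x, ENNReal.ofReal (gs d a (x - z)) ∂μ)
        - (∫⁻ x, ENNReal.ofReal (gs d a (x - z)) ∂ν) ≤
        ∫⁻ x, ENNReal.ofReal (gs d a (x - z)) * ENNReal.ofReal (‖x - z‖ ^ p) ∂μ := by
      intro z hz
      refine tsub_le_self.trans (lintegral_mono_ae ?_)
      filter_upwards [uniformBall_ae d] with y hy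
      have hz : 2 < ‖z‖ := by simpa using hz
      refine le_mul_of_one_le_right' ?_
      rw [← ENNReal.ofReal_one]
      refine ENNReal.ofReal_le_ofReal (Real.one_le_rpow ?_ (by linarith))
      have := norm_sub_norm_le z y
      rw [norm_sub_rev] at this
      linarith
    refine (setLIntegral_mono' measurableSet_closedBall.compl h1).trans ?_
    refine (setLIntegral_le_lintegral _ _).trans ?_
    rw [lintegral_lintegral_swap]
    · have h2 : ∀ x : Euc d, ∫⁻ z, ENNReal.ofReal (gs d a (x - z)) * ENNReal.ofReal (‖x - z‖ ^ p)
          = gsM d p a := fun x =>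
        lintegral_sub_left_eq_self (fun z => ENNReal.ofReal (gs d a z) * ENNReal.ofReal (‖z‖ ^ p)) x
      simp [h2]
    · refine Measurable.aemeasurable ?_
      refine Measurable.mul hkm ?_
      refine Measurable.ennreal_ofReal ?_
      exact (measurable_snd.sub measurable_fst).norm.pow_const p

lemma wass_of_smooth (d : ℕ) (hd : 2 ≤ d) {p : ℝ} (hp : 1 ≤ p) (R : ℝ) (hR : 0 ≤ R) {ε : ℝ}
    (hε : 0 < ε) : ∃ a0 > (0:ℝ), ∃ s > (0:ℝ), ∃ η > (0:ℝ), ∀ a ≥ a0, ∀ ν : Measure (Euc d),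
      IsProbabilityMeasure ν →
      ∫⁻ z, ENNReal.ofReal ((pg d a ν z - pg d a (uniformBall d 0) z) ^ 2) ≤ ENNReal.ofReal (s ^ 2) →
      ∫⁻ x in {x | R < ‖x‖}, ENNReal.ofReal (‖x‖ ^ p) ∂ν ≤ ENNReal.ofReal η →
      wassDist d p ν (uniformBall d 0) < ENNReal.ofReal ε := by
  have : IsProbabilityMeasure (uniformBall d 0) := uniformBall_prob d
  set μ := uniformBall d 0 with hμ
  set M : ℝ := 2 ^ (p - 1) * (3 + 2 * (R ^ p + 1)) with hM
  have hMpos : 0 < M := by positivity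
  set δ : ℝ := ε ^ p / (2 * M) with hδ
  have hδpos : 0 < δ := by positivity
  obtain ⟨a0, ha0, hG⟩ := gsM_small d hd hp (δ := ENNReal.ofReal δ) (by simpa using hδpos)
  set v : ℝ := (volume (closedBall (0 : Euc d) 2)).toReal with hv
  have hv0 : 0 ≤ v := ENNReal.toReal_nonneg
  have hvv : volume (closedBall (0 : Euc d) 2) = ENNReal.ofReal v := by
    rw [hv, ENNReal.ofReal_toReal measure_closedBall_lt_top.ne]
  refine ⟨a0, ha0, δ / (v + 1), by positivity, δ, hδpos, fun a ha ν hν h1 h2 => ?_⟩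
  have hapos : 0 < a := lt_of_lt_of_le ha0 ha
  have hp0 : 0 < p := by linarith
  have hr := r_bound d hp hapos (by positivity) ν h1
  have hr2 : ENNReal.ofReal (δ / (v + 1)) * volume (closedBall (0 : Euc d) 2)
      + ENNReal.ofReal (δ / (v + 1)) + gsM d p a ≤ ENNReal.ofReal (2 * δ) := by
    refine (add_le_add le_rfl (hG a ha)).trans ?_
    rw [hvv, ← ENNReal.ofReal_mul (by positivity), ← ENNReal.ofReal_add (by positivity) (by positivity),
      ← ENNReal.ofReal_add (by positivity) (by positivity)]
    refine ENNReal.ofReal_le_ofReal (le_of_eq ?_)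
    field_simp; ring
  have hr3 := hr.trans hr2
  obtain ⟨A, A', hA, hA', hAm, hAm', e1, e2, π, hπ1, hπ2, hc⟩ := coupling_exists ν μ volume
    (fun x z => ENNReal.ofReal (gs d a (x - z)))
    (Measurable.ennreal_ofReal ((gs_cont d a).comp (continuous_fst.sub continuous_snd)).measurable)
    (fun x => by
      rw [lintegral_sub_left_eq_self (fun z => ENNReal.ofReal (gs d a z)) x, gs_lintegral d hapos])
    (fun z => by rw [pg_ofReal d hapos]; simpa using pg_pos d hapos ν z)
    (fun z => by rw [pg_ofReal d hapos]; simp)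
    (fun z => by rw [pg_ofReal d hapos]; simpa using pg_pos d hapos μ z)
    (fun z => by rw [pg_ofReal d hapos]; simp)
  rw [← e1] at hr3
  have hr4 : ∫⁻ x, (1 - A' x) ∂μ ≤ ENNReal.ofReal (2 * δ) := by rw [e2, ← e1]; exact hr3
  set P2 : ℝ≥0∞ := ENNReal.ofReal (2 ^ (p - 1)) with hP2
  have hnm : Measurable fun x : Euc d => ENNReal.ofReal (‖x‖ ^ p) :=
    (measurable_norm.pow_const p).ennreal_ofReal
  have key := hc (fun q => ENNReal.ofReal (‖q.1 - q.2‖ ^ p))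
    (fun x z => P2 * ENNReal.ofReal (‖x - z‖ ^ p)) (fun x z => P2 * ENNReal.ofReal (‖x - z‖ ^ p))
    (fun x => P2 * ENNReal.ofReal (‖x‖ ^ p)) (fun x => P2 * ENNReal.ofReal (‖x‖ ^ p))
    (hnm.comp (measurable_fst.sub measurable_snd))
    ((hnm.comp (measurable_fst.sub measurable_snd)).const_mul _)
    ((hnm.comp (measurable_fst.sub measurable_snd)).const_mul _)
    (hnm.const_mul _) (hnm.const_mul _)
    (fun x y z => by
      have := add_rpow_bound hp (x - z) (y - z)
      simpa using this)
    (fun x y => add_rpow_bound hp x y)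
  have hI : ∀ x : Euc d, ∫⁻ z, ENNReal.ofReal (gs d a (x - z)) * (P2 * ENNReal.ofReal (‖x - z‖ ^ p))
      = P2 * gsM d p a := by
    intro x
    rw [lintegral_sub_left_eq_self
      (fun z => ENNReal.ofReal (gs d a z) * (P2 * ENNReal.ofReal (‖z‖ ^ p))) x]
    unfold gsM
    rw [← lintegral_const_mul' _ _ ENNReal.ofReal_ne_top]
    refine lintegral_congr fun z => by ring
  simp only [hI, lintegral_const, measure_univ, mul_one] at key
  have hf : ∫⁻ x, P2 * ENNReal.ofReal (‖x‖ ^ p) * (1 - A x) ∂ν ≤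
      P2 * (ENNReal.ofReal (R ^ p) * ENNReal.ofReal (2 * δ) + ENNReal.ofReal δ) := by
    simp_rw [mul_assoc]
    rw [lintegral_const_mul' _ _ ENNReal.ofReal_ne_top]
    refine mul_le_mul_right ?_ _
    have hset : MeasurableSet {x : Euc d | R < ‖x‖} := measurableSet_lt measurable_const measurable_norm
    rw [← lintegral_add_compl _ hset, add_comm]
    refine add_le_add ?_ ?_
    · refine (setLIntegral_mono' (g := fun x => ENNReal.ofReal (R ^ p) * (1 - A x)) hset.compl ?_).trans ?_
      · intro x hx
        have hx : ‖x‖ ≤ R := by simpa using hx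
        exact mul_le_mul_left (ENNReal.ofReal_le_ofReal
          (Real.rpow_le_rpow (norm_nonneg _) hx hp0.le)) _
      · refine (setLIntegral_le_lintegral _ _).trans ?_
        rw [lintegral_const_mul' _ _ ENNReal.ofReal_ne_top]
        exact mul_le_mul_right hr3 _
    · refine le_trans (lintegral_mono fun x => ?_) h2
      exact mul_le_of_le_one_right' tsub_le_self
  have hh : ∫⁻ x, P2 * ENNReal.ofReal (‖x‖ ^ p) * (1 - A' x) ∂μ ≤ P2 * ENNReal.ofReal (2 * δ) := by
    simp_rw [mul_assoc]
    rw [lintegral_const_mul' _ _ ENNReal.ofReal_ne_top]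
    refine mul_le_mul_right ?_ _
    refine le_trans (lintegral_mono_ae ?_) hr4
    filter_upwards [uniformBall_ae d] with y hy
    refine mul_le_of_le_one_left' ?_
    rw [← ENNReal.ofReal_one]
    exact ENNReal.ofReal_le_ofReal (Real.rpow_le_one (norm_nonneg _) hy hp0.le)
  have hfin : ∫⁻ q, ENNReal.ofReal (‖q.1 - q.2‖ ^ p) ∂π ≤ ENNReal.ofReal (M * δ) := by
    refine key.trans ?_
    refine (add_le_add (add_le_add (add_le_add (mul_le_mul_right (hG a ha) _)
      (mul_le_mul_right (hG a ha) _)) hf) hh).trans ?_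
    rw [hP2, ← ENNReal.ofReal_mul (by positivity), ← ENNReal.ofReal_mul (by positivity),
      ← ENNReal.ofReal_mul (by positivity), ← ENNReal.ofReal_add (by positivity) (by positivity),
      ← ENNReal.ofReal_add (by positivity) (by positivity),
      ← ENNReal.ofReal_mul (by positivity),
      ← ENNReal.ofReal_add (by positivity) (by positivity),
      ← ENNReal.ofReal_add (by positivity) (by positivity)]
    refine ENNReal.ofReal_le_ofReal (le_of_eq ?_)
    rw [hM]; ring
  unfold wassDist
  have hlt : (⨅ π ∈ Couplings d ν μ, ∫⁻ q : Euc d × Euc d, ENNReal.ofReal (‖q.1 - q.2‖ ^ p) ∂π) <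
      ENNReal.ofReal (ε ^ p) := by
    refine lt_of_le_of_lt (iInf₂_le π ⟨hπ1, hπ2⟩) (lt_of_le_of_lt hfin ?_)
    rw [ENNReal.ofReal_lt_ofReal_iff (by positivity), hδ]
    have : M * (ε ^ p / (2 * M)) = ε ^ p / 2 := by field_simp
    rw [this]
    have : 0 < ε ^ p := by positivity
    linarith
  have := ENNReal.rpow_lt_rpow hlt (z := 1 / p) (by positivity)
  rw [ENNReal.ofReal_rpow_of_nonneg (by positivity) (by positivity), ← Real.rpow_mul hε.le,
    mul_one_div_cancel hp0.ne', Real.rpow_one] at this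
  exact this

/-- time weight -/
def ww (d : ℕ) (t : ℝ) : ℝ := (2 * Real.Gamma ((d : ℝ) / 2))⁻¹ * t ^ ((d : ℝ) / 2 - 2)

lemma Gd_pos (d : ℕ) (hd : 2 ≤ d) : 0 < Real.Gamma ((d : ℝ) / 2) :=
  Real.Gamma_pos_of_pos (by have : (2:ℝ) ≤ d := by exact_mod_cast hd
                            linarith)

lemma ww_pos (d : ℕ) (hd : 2 ≤ d) {t : ℝ} (ht : 0 < t) : 0 < ww d t := by
  have := Gd_pos d hd
  unfold ww; positivity

lemma ww_meas (d : ℕ) : Measurable (ww d) := by unfold ww; fun_prop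

lemma ww_mul (d : ℕ) {t : ℝ} (ht : 0 < t) :
    ww d t * t = (2 * Real.Gamma ((d : ℝ) / 2))⁻¹ * t ^ ((d : ℝ) / 2 - 1) := by
  unfold ww
  have : t ^ ((d : ℝ) / 2 - 1) = t ^ ((d : ℝ) / 2 - 2) * t := by
    rw [← Real.rpow_add_one ht.ne']; congr 1; ring
  rw [this]; ring

def phi (t r : ℝ) : ℝ := Real.exp (-(t * r)) - Real.exp (-t)

lemma phi_abs {t r : ℝ} (ht : 0 ≤ t) (hr : 0 ≤ r) : |phi t r| ≤ t * (r + 1) := by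
  unfold phi
  have h1 : Real.exp (-(t * r)) ≤ 1 := Real.exp_le_one_iff.2 (by nlinarith)
  have h2 : Real.exp (-t) ≤ 1 := Real.exp_le_one_iff.2 (by linarith)
  have h3 := Real.add_one_le_exp (-(t * r))
  have h4 := Real.add_one_le_exp (-t)
  rw [abs_le]
  constructor <;> nlinarith

lemma wwt_integrable (d : ℕ) (hd : 2 ≤ d) (T : ℝ) (hT : 0 ≤ T) :
    IntegrableOn (fun t => ww d t * t) (Set.Ioc 0 T) := by
  have hd' : (2:ℝ) ≤ d := by exact_mod_cast hd
  have h : IntegrableOn (fun t : ℝ => t ^ ((d : ℝ) / 2 - 1)) (Set.Ioc 0 T) := by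
    rw [← intervalIntegrable_iff_integrableOn_Ioc_of_le hT]
    exact intervalIntegral.intervalIntegrable_rpow' (by linarith)
  refine IntegrableOn.congr_fun (h.const_mul _) (fun t ht => (ww_mul d ht.1).symm) measurableSet_Ioc

lemma wwphi_integrable (d : ℕ) (hd : 2 ≤ d) (T : ℝ) (hT : 0 ≤ T) {r : ℝ} (hr : 0 ≤ r) :
    IntegrableOn (fun t => ww d t * phi t r) (Set.Ioc 0 T) := by
  refine Integrable.mono' ((wwt_integrable d hd T hT).mul_const (r + 1)) ?_ ?_
  · refine Measurable.aestronglyMeasurable ((ww_meas d).mul ?_)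
    unfold phi; fun_prop
  · filter_upwards [ae_restrict_mem measurableSet_Ioc] with t ht
    rw [Real.norm_eq_abs, abs_mul, abs_of_pos (ww_pos d hd ht.1), mul_assoc]
    exact mul_le_mul_of_nonneg_left (phi_abs ht.1.le hr) (ww_pos d hd ht.1).le

lemma wwexp_integrable (d : ℕ) (hd : 2 ≤ d) {T : ℝ} (hT : 0 < T) {r : ℝ} (hr : 0 < r) :
    IntegrableOn (fun t => ww d t * Real.exp (-(t * r))) (Set.Ioi T) := by
  have hd' : (2:ℝ) ≤ d := by exact_mod_cast hd
  have hG := Gd_pos d hd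
  have h := integrableOn_rpow_mul_exp_neg_mul_rpow (s := (d : ℝ) / 2 - 1) (by linarith) one_pos hr
  have h' : IntegrableOn (fun t : ℝ => (2 * Real.Gamma ((d : ℝ) / 2))⁻¹ * T⁻¹ *
      (t ^ ((d : ℝ) / 2 - 1) * Real.exp (-r * t ^ (1:ℝ)))) (Set.Ioi T) :=
    (h.mono_set (Set.Ioi_subset_Ioi hT.le)).const_mul _
  refine Integrable.mono' h' ?_ ?_
  · refine Measurable.aestronglyMeasurable ((ww_meas d).mul ?_)
    fun_prop
  · filter_upwards [ae_restrict_mem measurableSet_Ioi] with t ht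
    have ht : T < t := ht
    have ht0 : 0 < t := hT.trans ht
    rw [Real.norm_of_nonneg (mul_nonneg (ww_pos d hd ht0).le (Real.exp_nonneg _)), Real.rpow_one]
    have e : (2 * Real.Gamma ((d : ℝ) / 2))⁻¹ * T⁻¹ *
      (t ^ ((d : ℝ) / 2 - 1) * Real.exp (-r * t)) = (t / T) * (ww d t * Real.exp (-(t * r))) := by
      have := ww_mul d ht0
      rw [show -r * t = -(t * r) by ring]
      calc _ = T⁻¹ * Real.exp (-(t*r)) * ((2 * Real.Gamma ((d : ℝ) / 2))⁻¹ * t ^ ((d : ℝ) / 2 - 1)) := by ring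
        _ = _ := by rw [← this]; ring
    rw [e]
    refine le_mul_of_one_le_left (mul_nonneg (ww_pos d hd ht0).le (Real.exp_nonneg _)) ?_
    rw [one_le_div hT]; exact ht.le

lemma wwphi_integrable_Ioi (d : ℕ) (hd : 2 ≤ d) {r : ℝ} (hr : 0 < r) :
    IntegrableOn (fun t => ww d t * phi t r) (Set.Ioi 0) := by
  rw [← Set.Ioc_union_Ioi_eq_Ioi (zero_le_one' ℝ)]
  refine (wwphi_integrable d hd 1 zero_le_one hr.le).union ?_
  have h1 := wwexp_integrable d hd one_pos hr
  have h2 := wwexp_integrable d hd one_pos one_pos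
  refine (h1.sub h2).congr (ae_of_all _ fun t => ?_)
  simp [phi]; ring

def g1 (d : ℕ) : ℝ := if d = 2 then 0 else 1 / ((d : ℝ) - 2)

lemma coulomb_repr (d : ℕ) (hd : 2 ≤ d) (z : Euc d) (hz : z ≠ 0) :
    coulombKR d z = g1 d + ∫ t in Set.Ioi (0:ℝ), ww d t * phi t (‖z‖ ^ 2) := by
  have hz0 : 0 < ‖z‖ := norm_pos_iff.2 hz
  have hr : 0 < ‖z‖ ^ 2 := by positivity
  have hint := wwphi_integrable_Ioi d hd hr
  unfold coulombKR g1
  split_ifs with h2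
  · subst h2
    have hw : ∀ t ∈ Set.Ioi (0:ℝ), ww 2 t * phi t (‖z‖ ^ 2) =
        2⁻¹ * (t⁻¹ • ((fun x => Real.exp (-x)) (‖z‖ ^ 2 * t) - (fun x => Real.exp (-x)) (1 * t))) := by
      intro t ht
      simp only [ww, phi, smul_eq_mul]
      norm_num
      rw [Real.rpow_neg_one, mul_comm t]; ring
    rw [setIntegral_congr_fun measurableSet_Ioi hw, integral_const_mul,
      Frullani.integral_Ioi_eq (f := fun x : ℝ => Real.exp (-x)) (L := (1:ℝ)) (R := (0:ℝ)) ?_ hr one_pos]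
    · rw [one_div, one_div, Real.log_inv, Real.log_inv, Real.log_pow]; norm_num; ring
    · have : Tendsto (fun x : ℝ => Real.exp (-x)) (𝓝 0) (𝓝 1) := by
        have : Continuous (fun x : ℝ => Real.exp (-x)) := by fun_prop
        simpa using this.tendsto 0
      exact this.mono_left nhdsWithin_le_nhds
    · exact Real.tendsto_exp_neg_atTop_nhds_zero
    · have h3 := (hint.congr_fun hw measurableSet_Ioi).const_mul 2
      refine h3.congr (ae_of_all _ fun t => ?_)
      simp
    · exact (Continuous.locallyIntegrable (by fun_prop)).locallyIntegrableOn _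
  · have hd3 : (3:ℝ) ≤ d := by
      have : 3 ≤ d := by omega
      exact_mod_cast this
    have hG := Gd_pos d hd
    set s : ℝ := (d : ℝ) / 2 - 1 with hs
    have hspos : 0 < s := by rw [hs]; linarith
    have hI : ∀ r : ℝ, 0 < r → IntegrableOn (fun t : ℝ => t ^ (s - 1) * Real.exp (-(r * t))) (Set.Ioi 0) := by
      intro r hr
      have h := integrableOn_rpow_mul_exp_neg_mul_rpow (s := s - 1) (by linarith) one_pos hr
      simpa using h
    have hw : ∀ t ∈ Set.Ioi (0:ℝ), ww d t * phi t (‖z‖ ^ 2) = (2 * Real.Gamma ((d : ℝ) / 2))⁻¹ *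
      (t ^ (s - 1) * Real.exp (-(‖z‖ ^ 2 * t)) - t ^ (s - 1) * Real.exp (-(1 * t))) := by
      intro t ht
      have : (d : ℝ) / 2 - 2 = s - 1 := by rw [hs]; ring
      simp only [ww, phi, this, mul_comm t, one_mul]; ring
    rw [setIntegral_congr_fun measurableSet_Ioi hw, integral_const_mul,
      integral_sub (hI _ hr) (hI _ one_pos), Real.integral_rpow_mul_exp_neg_mul_Ioi hspos hr,
      Real.integral_rpow_mul_exp_neg_mul_Ioi hspos one_pos]
    have hGs : Real.Gamma ((d : ℝ) / 2) = s * Real.Gamma s := by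
      rw [← Real.Gamma_add_one hspos.ne']; congr 1; rw [hs]; ring
    have hGs0 : 0 < Real.Gamma s := Real.Gamma_pos_of_pos hspos
    have hpow : (1 / ‖z‖ ^ 2) ^ s = 1 / ‖z‖ ^ (d - 2) := by
      rw [Real.div_rpow zero_le_one (by positivity), Real.one_rpow]
      congr 1
      rw [← Real.rpow_natCast, ← Real.rpow_natCast, ← Real.rpow_mul hz0.le]
      congr 1
      rw [Nat.cast_sub hd, hs]; push_cast; ring
    rw [hpow, hGs]
    have : (d : ℝ) - 2 = 2 * s := by rw [hs]; ring
    rw [this]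
    simp
    field_simp
    ring

/-- truncated kernel -/
def aT (d : ℕ) (T : ℝ) : ℝ := g1 d - ∫ t in Set.Ioi T, ww d t * Real.exp (-(t * 1))
def KT (d : ℕ) (T : ℝ) (z : Euc d) : ℝ :=
  aT d T + ∫ t in Set.Ioc 0 T, ww d t * phi t (‖z‖ ^ 2)
def qT (d : ℕ) (T : ℝ) (z : Euc d) : ℝ := ∫ t in Set.Ioi T, ww d t * Real.exp (-(t * ‖z‖ ^ 2))

lemma coulomb_split (d : ℕ) (hd : 2 ≤ d) {T : ℝ} (hT : 0 < T) (z : Euc d) (hz : z ≠ 0) :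
    coulombKR d z = KT d T z + qT d T z := by
  have hz0 : 0 < ‖z‖ := norm_pos_iff.2 hz
  have hr : 0 < ‖z‖ ^ 2 := by positivity
  have hint := wwphi_integrable_Ioi d hd hr
  rw [coulomb_repr d hd z hz, ← Set.Ioc_union_Ioi_eq_Ioi hT.le,
    setIntegral_union (t := Set.Ioi T) (Set.disjoint_left.2 fun t ht ht' => not_lt.2 ht.2 ht') measurableSet_Ioi
      (wwphi_integrable d hd T hT.le hr.le) (hint.mono_set (Set.Ioi_subset_Ioi hT.le))]
  unfold KT aT qT
  have : ∫ t in Set.Ioi T, ww d t * phi t (‖z‖ ^ 2) =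
      (∫ t in Set.Ioi T, ww d t * Real.exp (-(t * ‖z‖ ^ 2))) -
      ∫ t in Set.Ioi T, ww d t * Real.exp (-(t * 1)) := by
    rw [← integral_sub (wwexp_integrable d hd hT hr) (wwexp_integrable d hd hT one_pos)]
    refine integral_congr_ae (ae_of_all _ fun t => ?_)
    simp [phi]; ring
  rw [this]; ring

lemma qT_nonneg (d : ℕ) (hd : 2 ≤ d) {T : ℝ} (hT : 0 < T) (z : Euc d) : 0 ≤ qT d T z :=
  setIntegral_nonneg measurableSet_Ioi fun t ht =>
    mul_nonneg (ww_pos d hd (hT.trans ht)).le (Real.exp_nonneg _)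

/-- constant in the bound of the short range part -/
def cq (d : ℕ) : ℝ := (2 * Real.Gamma ((d : ℝ) / 2))⁻¹ * Real.pi ^ ((d : ℝ) / 2)

lemma cq_pos (d : ℕ) (hd : 2 ≤ d) : 0 < cq d := by
  have := Gd_pos d hd
  have := Real.pi_pos
  unfold cq; positivity

lemma qT_meas (d : ℕ) (T : ℝ) : StronglyMeasurable (qT d T) := by
  unfold qT
  refine StronglyMeasurable.integral_prod_right (f := fun (z : Euc d) (t : ℝ) =>
    ww d t * Real.exp (-(t * ‖z‖ ^ 2))) ?_
  refine Measurable.stronglyMeasurable ?_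
  refine ((ww_meas d).comp measurable_snd).mul ?_
  fun_prop

lemma qT_lintegral (d : ℕ) (hd : 2 ≤ d) {T : ℝ} (hT : 0 < T) :
    ∫⁻ z, ENNReal.ofReal (qT d T z) ≤ ENNReal.ofReal (cq d / T) := by
  have hG := Gd_pos d hd
  have hpi := Real.pi_pos
  have h1 : ∀ z, ENNReal.ofReal (qT d T z) ≤
      ∫⁻ t in Set.Ioi T, ENNReal.ofReal (ww d t * Real.exp (-(t * ‖z‖ ^ 2))) := by
    intro z
    have := ofReal_integral_norm_eq_lintegral_enorm (μ := volume.restrict (Set.Ioi T)) (f := fun t => ww d t * Real.exp (-(t * ‖z‖ ^ 2)))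
    unfold qT
    by_cases hi : IntegrableOn (fun t => ww d t * Real.exp (-(t * ‖z‖ ^ 2))) (Set.Ioi T)
    · rw [← ofReal_integral_eq_lintegral_ofReal hi]
      filter_upwards [ae_restrict_mem measurableSet_Ioi] with t ht
      exact mul_nonneg (ww_pos d hd (hT.trans ht)).le (Real.exp_nonneg _)
    · rw [integral_undef hi]; simp
  refine (lintegral_mono h1).trans ?_
  rw [lintegral_lintegral_swap]
  · have h2 : ∀ t ∈ Set.Ioi T, ∫⁻ z : Euc d, ENNReal.ofReal (ww d t * Real.exp (-(t * ‖z‖ ^ 2))) =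
        ENNReal.ofReal (cq d * t ^ (-2:ℝ)) := by
      intro t ht
      have ht0 : 0 < t := hT.trans ht
      have e : ∀ z : Euc d, -(t * ‖z‖ ^ 2) = -t * ‖z‖ ^ 2 := fun z => by ring
      simp only [e]
      rw [← ofReal_integral_eq_lintegral_ofReal ((gauss_integrable d ht0).const_mul _)
        (ae_of_all _ fun z => mul_nonneg (ww_pos d hd ht0).le (Real.exp_nonneg _)),
        integral_const_mul, gauss_integral d ht0]
      congr 1
      unfold ww cq
      rw [Real.div_rpow hpi.le ht0.le, Real.rpow_sub ht0, Real.rpow_neg ht0.le]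
      have : 0 < t ^ ((d:ℝ) / 2) := by positivity
      field_simp
    rw [setLIntegral_congr_fun measurableSet_Ioi h2]
    have hi := (integrableOn_Ioi_rpow_of_lt (a := -2) (by norm_num) hT).const_mul (cq d)
    rw [← ofReal_integral_eq_lintegral_ofReal hi, integral_const_mul,
      integral_Ioi_rpow_of_lt (by norm_num) hT]
    · refine ENNReal.ofReal_le_ofReal (le_of_eq ?_)
      norm_num
      rw [Real.rpow_neg_one]; ring
    · filter_upwards [ae_restrict_mem measurableSet_Ioi] with t ht
      have ht0 : 0 < t := hT.trans ht
      have := cq_pos d hd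
      positivity
  · refine Measurable.aemeasurable ?_
    refine Measurable.ennreal_ofReal ?_
    refine ((ww_meas d).comp measurable_snd).mul ?_
    fun_prop

/-- interaction of the truncated kernel -/
def IT (d : ℕ) (T : ℝ) (ν μ : Measure (Euc d)) : ℝ := ∫ q, KT d T (q.1 - q.2) ∂(ν.prod μ)
def Gt (d : ℕ) (t : ℝ) (ν μ : Measure (Euc d)) : ℝ :=
  ∫ q, Real.exp (-(t * ‖q.1 - q.2‖ ^ 2)) ∂(ν.prod μ)

lemma phi_int (d : ℕ) (hd : 2 ≤ d) {T : ℝ} (hT : 0 < T) (ν μ : Measure (Euc d))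
    [IsProbabilityMeasure ν] [IsProbabilityMeasure μ] (r : ℝ)
    (hν : ∀ᵐ x ∂ν, ‖x‖ ≤ r) (hμ : ∀ᵐ x ∂μ, ‖x‖ ≤ r) :
    Integrable (fun p : (Euc d × Euc d) × ℝ => ww d p.2 * phi p.2 (‖p.1.1 - p.1.2‖ ^ 2))
      ((ν.prod μ).prod (volume.restrict (Set.Ioc 0 T))) := by
  have h1 : Integrable (fun p : (Euc d × Euc d) × ℝ => ww d p.2 * p.2 * ((2 * r) ^ 2 + 1))
      ((ν.prod μ).prod (volume.restrict (Set.Ioc 0 T))) :=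
    Integrable.comp_snd (f := fun t : ℝ => ww d t * t * ((2 * r) ^ 2 + 1))
      ((wwt_integrable d hd T hT.le).mul_const ((2 * r) ^ 2 + 1)) (ν.prod μ)
  refine Integrable.mono' h1 ?_ ?_
  · refine Measurable.aestronglyMeasurable (((ww_meas d).comp measurable_snd).mul ?_)
    unfold phi; fun_prop
  · have a1 : ∀ᵐ q ∂(ν.prod μ), ‖q.1‖ ≤ r := Measure.quasiMeasurePreserving_fst.ae hν
    have a2 : ∀ᵐ q ∂(ν.prod μ), ‖q.2‖ ≤ r := Measure.quasiMeasurePreserving_snd.ae hμ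
    have b1 : ∀ᵐ p ∂((ν.prod μ).prod (volume.restrict (Set.Ioc 0 T))), ‖p.1.1‖ ≤ r ∧ ‖p.1.2‖ ≤ r :=
      Measure.quasiMeasurePreserving_fst.ae (a1.and a2)
    have b2 : ∀ᵐ p ∂((ν.prod μ).prod (volume.restrict (Set.Ioc 0 T))), p.2 ∈ Set.Ioc 0 T :=
      Measure.quasiMeasurePreserving_snd.ae (ae_restrict_mem measurableSet_Ioc)
    filter_upwards [b1, b2] with p hp ht
    rw [Real.norm_eq_abs, abs_mul, abs_of_pos (ww_pos d hd ht.1), mul_assoc]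
    refine mul_le_mul_of_nonneg_left ((phi_abs ht.1.le (by positivity)).trans ?_) (ww_pos d hd ht.1).le
    refine mul_le_mul_of_nonneg_left ?_ ht.1.le
    have h3 := norm_sub_le p.1.1 p.1.2
    have : ‖p.1.1 - p.1.2‖ ≤ 2 * r := by linarith [hp.1, hp.2]
    have := pow_le_pow_left₀ (norm_nonneg _) this 2
    linarith

lemma exp_int (d : ℕ) {t : ℝ} (ht : 0 ≤ t) (ν μ : Measure (Euc d))
    [IsProbabilityMeasure ν] [IsProbabilityMeasure μ] :
    Integrable (fun q : Euc d × Euc d => Real.exp (-(t * ‖q.1 - q.2‖ ^ 2))) (ν.prod μ) := by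
  refine Integrable.of_bound (C := 1) (by fun_prop) (ae_of_all _ fun q => ?_)
  rw [Real.norm_of_nonneg (Real.exp_nonneg _)]
  exact Real.exp_le_one_iff.2 (by have : 0 ≤ t * ‖q.1 - q.2‖ ^ 2 := by positivity
                                  linarith)

lemma KT_int (d : ℕ) (hd : 2 ≤ d) {T : ℝ} (hT : 0 < T) (ν μ : Measure (Euc d))
    [IsProbabilityMeasure ν] [IsProbabilityMeasure μ] (r : ℝ)
    (hν : ∀ᵐ x ∂ν, ‖x‖ ≤ r) (hμ : ∀ᵐ x ∂μ, ‖x‖ ≤ r) :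
    Integrable (fun q : Euc d × Euc d => KT d T (q.1 - q.2)) (ν.prod μ) :=
  (integrable_const _).add (phi_int d hd hT ν μ r hν hμ).integral_prod_left

lemma IT_eq (d : ℕ) (hd : 2 ≤ d) {T : ℝ} (hT : 0 < T) (ν μ : Measure (Euc d))
    [IsProbabilityMeasure ν] [IsProbabilityMeasure μ] (r : ℝ)
    (hν : ∀ᵐ x ∂ν, ‖x‖ ≤ r) (hμ : ∀ᵐ x ∂μ, ‖x‖ ≤ r) :
    IntegrableOn (fun t => ww d t * (Gt d t ν μ - Real.exp (-t))) (Set.Ioc 0 T) ∧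
    IT d T ν μ = aT d T + ∫ t in Set.Ioc 0 T, ww d t * (Gt d t ν μ - Real.exp (-t)) := by
  have h := phi_int d hd hT ν μ r hν hμ
  have e : ∀ t ∈ Set.Ioc 0 T, ∫ q, ww d t * phi t (‖q.1 - q.2‖ ^ 2) ∂(ν.prod μ) =
      ww d t * (Gt d t ν μ - Real.exp (-t)) := by
    intro t ht
    rw [integral_const_mul]
    unfold phi Gt
    rw [integral_sub (exp_int d ht.1.le ν μ) (integrable_const _)]
    simp
  constructor
  · exact IntegrableOn.congr_fun h.integral_prod_right e measurableSet_Ioc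
  · unfold IT KT
    have h2 := h.integral_prod_left
    simp only at h2
    rw [integral_add (integrable_const _) h2, ← setIntegral_congr_fun measurableSet_Ioc e,
      integral_integral_swap h]
    simp

lemma gs_mul (d : ℕ) {t : ℝ} (ht : 0 < t) (x y z : Euc d) :
    gs d (2 * t) (x - z) * gs d (2 * t) (y - z) =
      (2 * t / Real.pi) ^ (d : ℝ) * Real.exp (-(t * ‖x - y‖ ^ 2)) *
        Real.exp (-(4 * t) * ‖z - (1 / 2 : ℝ) • (x + y)‖ ^ 2) := by
  unfold gs
  have hpi := Real.pi_pos
  have e1 : (2 * t / Real.pi) ^ (d : ℝ) =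
      (2 * t / Real.pi) ^ ((d : ℝ) / 2) * (2 * t / Real.pi) ^ ((d : ℝ) / 2) := by
    rw [← Real.rpow_add (by positivity)]; congr 1; ring
  rw [e1]
  have e2 : ‖x - z‖ ^ 2 + ‖y - z‖ ^ 2 = 1 / 2 * ‖x - y‖ ^ 2 + 2 * ‖z - (1 / 2 : ℝ) • (x + y)‖ ^ 2 := by
    have h1 : x - y = (x - z) - (y - z) := by abel
    have h2 : z - (1 / 2 : ℝ) • (x + y) = -((1 / 2 : ℝ) • ((x - z) + (y - z))) := by
      module
    rw [h1, h2, norm_neg, norm_smul, mul_pow]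
    generalize x - z = u
    generalize y - z = v
    rw [@norm_sub_sq_real, @norm_add_sq_real]
    norm_num; ring
  have e3 : Real.exp (-(2 * t) * ‖x - z‖ ^ 2) * Real.exp (-(2 * t) * ‖y - z‖ ^ 2) =
      Real.exp (-(t * ‖x - y‖ ^ 2)) * Real.exp (-(4 * t) * ‖z - (1 / 2 : ℝ) • (x + y)‖ ^ 2) := by
    rw [← Real.exp_add, ← Real.exp_add]
    congr 1
    linear_combination (-(2 * t)) * e2
  linear_combination ((2 * t / Real.pi) ^ ((d : ℝ) / 2)) ^ 2 * e3

lemma gs_mul_integrable (d : ℕ) {t : ℝ} (ht : 0 < t) (x y : Euc d) :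
    Integrable (fun z => gs d (2 * t) (x - z) * gs d (2 * t) (y - z)) := by
  simp_rw [gs_mul d ht]
  exact (Integrable.comp_sub_right (gauss_integrable d (a := 4 * t) (by positivity)) _).const_mul _

lemma gs_conv (d : ℕ) {t : ℝ} (ht : 0 < t) (x y : Euc d) :
    Real.exp (-(t * ‖x - y‖ ^ 2)) = (Real.pi / t) ^ ((d : ℝ) / 2) *
      ∫ z, gs d (2 * t) (x - z) * gs d (2 * t) (y - z) := by
  have hpi := Real.pi_pos
  simp_rw [gs_mul d ht]
  rw [integral_const_mul,
    integral_sub_right_eq_self (fun z : Euc d => Real.exp (-(4 * t) * ‖z‖ ^ 2)),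
    gauss_integral d (by positivity)]
  have e1 : (2 * t / Real.pi) ^ (d : ℝ) = ((2 * t / Real.pi) ^ 2) ^ ((d : ℝ) / 2) := by
    rw [← Real.rpow_natCast, ← Real.rpow_mul (by positivity)]; congr 1; push_cast; ring
  have e2 : (Real.pi / t) ^ ((d : ℝ) / 2) * ((2 * t / Real.pi) ^ (d : ℝ)
      * (Real.pi / (4 * t)) ^ ((d : ℝ) / 2)) = 1 := by
    rw [e1, ← Real.mul_rpow (by positivity) (by positivity),
      ← Real.mul_rpow (by positivity) (by positivity)]
    have : Real.pi / t * ((2 * t / Real.pi) ^ 2 * (Real.pi / (4 * t))) = 1 := by field_simp; norm_num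
    rw [this, Real.one_rpow]
  linear_combination (-Real.exp (-(t * ‖x - y‖ ^ 2))) * e2

lemma Gt_eq (d : ℕ) {t : ℝ} (ht : 0 < t) (ν μ : Measure (Euc d))
    [IsProbabilityMeasure ν] [IsProbabilityMeasure μ] :
    Integrable (fun z => pg d (2 * t) ν z * pg d (2 * t) μ z) ∧
    Gt d t ν μ = (Real.pi / t) ^ ((d : ℝ) / 2) * ∫ z, pg d (2 * t) ν z * pg d (2 * t) μ z := by
  have hpi := Real.pi_pos
  have hI : Integrable (fun p : (Euc d × Euc d) × Euc d =>
      gs d (2 * t) (p.1.1 - p.2) * gs d (2 * t) (p.1.2 - p.2)) ((ν.prod μ).prod volume) := by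
    have hc := gs_cont d (2 * t)
    have hcc : Continuous (fun p : (Euc d × Euc d) × Euc d =>
      gs d (2 * t) (p.1.1 - p.2) * gs d (2 * t) (p.1.2 - p.2)) :=
      (hc.comp (continuous_fst.fst.sub continuous_snd)).mul
        (hc.comp (continuous_fst.snd.sub continuous_snd))
    rw [integrable_prod_iff hcc.aestronglyMeasurable]
    constructor
    · refine ae_of_all _ fun q => ?_
      exact gs_mul_integrable d ht q.1 q.2
    refine ((exp_int d ht.le ν μ).const_mul ((Real.pi / t) ^ ((d : ℝ) / 2))⁻¹).congr
      (ae_of_all _ fun q => ?_)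
    have h2 : ∀ z, ‖gs d (2 * t) (q.1 - z) * gs d (2 * t) (q.2 - z)‖ =
        gs d (2 * t) (q.1 - z) * gs d (2 * t) (q.2 - z) := fun z =>
      Real.norm_of_nonneg (mul_nonneg (gs_pos d (by positivity) _).le (gs_pos d (by positivity) _).le)
    simp only [h2]
    rw [gs_conv d ht, ← mul_assoc, inv_mul_cancel₀ (by positivity), one_mul]
  have e : ∀ z, ∫ q, gs d (2 * t) (q.1 - z) * gs d (2 * t) (q.2 - z) ∂(ν.prod μ) =
      pg d (2 * t) ν z * pg d (2 * t) μ z := fun z =>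
    integral_prod_mul (fun x => gs d (2 * t) (x - z)) (fun x => gs d (2 * t) (x - z))
  constructor
  · refine hI.integral_prod_right.congr (ae_of_all _ fun z => e z)
  · unfold Gt
    simp_rw [gs_conv d ht]
    rw [integral_const_mul]
    congr 1
    rw [integral_integral_swap hI]
    exact integral_congr_ae (ae_of_all _ e)

/-- energy distance for the truncated kernel -/
def DT (d : ℕ) (T : ℝ) (ν μ : Measure (Euc d)) : ℝ := IT d T ν ν - 2 * IT d T ν μ + IT d T μ μ

lemma DT_small (d : ℕ) (hd : 2 ≤ d) {T t0 s : ℝ} (ht0 : 0 < t0) (hT : 2 * t0 ≤ T)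
    (ν μ : Measure (Euc d)) [IsProbabilityMeasure ν] [IsProbabilityMeasure μ] (r : ℝ)
    (hν : ∀ᵐ x ∂ν, ‖x‖ ≤ r) (hμ : ∀ᵐ x ∂μ, ‖x‖ ≤ r)
    (hD : DT d T ν μ < s ^ 2 * (cq d / (2 * t0))) :
    ∃ t, t0 ≤ t ∧ ∫⁻ z, ENNReal.ofReal ((pg d (2 * t) ν z - pg d (2 * t) μ z) ^ 2) ≤
      ENNReal.ofReal (s ^ 2) := by
  have hTpos : 0 < T := by linarith
  have hpi := Real.pi_pos
  obtain ⟨i1, e1⟩ := IT_eq d hd hTpos ν ν r hν hν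
  obtain ⟨i2, e2⟩ := IT_eq d hd hTpos ν μ r hν hμ
  obtain ⟨i3, e3⟩ := IT_eq d hd hTpos μ μ r hμ hμ
  have hsq : ∀ t, 0 < t → Integrable (fun z => (pg d (2 * t) ν z - pg d (2 * t) μ z) ^ 2) ∧
      Gt d t ν ν - 2 * Gt d t ν μ + Gt d t μ μ = (Real.pi / t) ^ ((d : ℝ) / 2) *
        ∫ z, (pg d (2 * t) ν z - pg d (2 * t) μ z) ^ 2 := by
    intro t ht
    obtain ⟨j1, f1⟩ := Gt_eq d ht ν ν
    obtain ⟨j2, f2⟩ := Gt_eq d ht ν μ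
    obtain ⟨j3, f3⟩ := Gt_eq d ht μ μ
    have ee : ∀ z, (pg d (2 * t) ν z - pg d (2 * t) μ z) ^ 2 =
      pg d (2 * t) ν z * pg d (2 * t) ν z - 2 * (pg d (2 * t) ν z * pg d (2 * t) μ z) +
       pg d (2 * t) μ z * pg d (2 * t) μ z := fun z => by ring
    simp_rw [ee]
    refine ⟨(j1.sub (j2.const_mul 2)).add j3, ?_⟩
    rw [integral_add (f := fun z => pg d (2 * t) ν z * pg d (2 * t) ν z - 2 * (pg d (2 * t) ν z * pg d (2 * t) μ z))
        (j1.sub (j2.const_mul 2)) j3, integral_sub j1 (j2.const_mul 2), integral_const_mul,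
      f1, f2, f3]
    ring
  set F : ℝ → ℝ := fun t => ww d t * ((Real.pi / t) ^ ((d : ℝ) / 2) *
        ∫ z, (pg d (2 * t) ν z - pg d (2 * t) μ z) ^ 2) with hF
  have hFe : ∀ t ∈ Set.Ioc 0 T, ww d t * (Gt d t ν ν - Real.exp (-t)) -
      2 * (ww d t * (Gt d t ν μ - Real.exp (-t))) + ww d t * (Gt d t μ μ - Real.exp (-t)) = F t := by
    intro t ht
    rw [hF]
    simp only
    rw [← (hsq t ht.1).2]; ring
  have hFi : IntegrableOn F (Set.Ioc 0 T) :=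
    IntegrableOn.congr_fun ((i1.sub (i2.const_mul 2)).add i3) hFe measurableSet_Ioc
  have hDe : DT d T ν μ = ∫ t in Set.Ioc 0 T, F t := by
    rw [← setIntegral_congr_fun measurableSet_Ioc hFe]
    rw [integral_add (f := fun t => ww d t * (Gt d t ν ν - Real.exp (-t)) -
      2 * (ww d t * (Gt d t ν μ - Real.exp (-t)))) (i1.sub (i2.const_mul 2)) i3,
      integral_sub i1 (i2.const_mul 2), integral_const_mul]
    unfold DT
    rw [e1, e2, e3]; ring
  by_contra hcon
  push Not at hcon
  have hlow : ∀ t ∈ Set.Ioc t0 (2 * t0), s ^ 2 * cq d * t ^ (-2 : ℝ) ≤ F t := by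
    intro t ht
    have ht' : 0 < t := ht0.trans ht.1
    have h1 := hcon t ht.1.le
    rw [← ofReal_integral_eq_lintegral_ofReal (hsq t ht').1 (ae_of_all _ fun z => sq_nonneg _)] at h1
    have h2 := (ENNReal.ofReal_lt_ofReal_iff_of_nonneg (sq_nonneg _)).1 h1
    have h3 : cq d * t ^ (-2:ℝ) = ww d t * (Real.pi / t) ^ ((d : ℝ) / 2) := by
      unfold ww cq
      rw [Real.div_rpow hpi.le ht'.le, Real.rpow_sub ht', Real.rpow_neg ht'.le]
      have : 0 < t ^ ((d:ℝ) / 2) := by positivity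
      have := Gd_pos d hd
      field_simp
    rw [hF]
    simp only
    rw [mul_assoc, h3, mul_comm, ← mul_assoc]
    refine mul_le_mul_of_nonneg_left h2.le ?_
    have := ww_pos d hd ht'
    positivity
  have hsub : Set.Ioc t0 (2 * t0) ⊆ Set.Ioc 0 T := Set.Ioc_subset_Ioc ht0.le hT
  have hge : ∫ t in Set.Ioc t0 (2 * t0), s ^ 2 * cq d * t ^ (-2 : ℝ) ≤ ∫ t in Set.Ioc 0 T, F t := by
    refine le_trans (setIntegral_mono_on ?_ (hFi.mono_set hsub) measurableSet_Ioc hlow) ?_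
    · refine Integrable.const_mul ?_ _
      exact (integrableOn_Ioi_rpow_of_lt (a := -2) (by norm_num) ht0).mono_set Set.Ioc_subset_Ioi_self
    · refine setIntegral_mono_set hFi ?_ hsub.eventuallyLE
      filter_upwards [ae_restrict_mem measurableSet_Ioc] with t ht
      have := ww_pos d hd ht.1
      have : 0 ≤ ∫ z, (pg d (2 * t) ν z - pg d (2 * t) μ z) ^ 2 := integral_nonneg fun z => sq_nonneg _
      have := ht.1
      simp only [hF, Pi.zero_apply]
      positivity
  have hval : ∫ t in Set.Ioc t0 (2 * t0), s ^ 2 * cq d * t ^ (-2 : ℝ) = s ^ 2 * (cq d / (2 * t0)) := by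
    rw [integral_const_mul, ← intervalIntegral.integral_of_le (by linarith), integral_rpow]
    · norm_num
      rw [Real.rpow_neg_one, Real.rpow_neg_one]
      field_simp; norm_num
    · right
      refine ⟨by norm_num, ?_⟩
      rw [Set.uIcc_of_le (by linarith)]
      intro h; linarith [h.1]
  rw [hval, ← hDe] at hge
  linarith

/-- volume of the unit ball -/
def vB (d : ℕ) : ℝ := (volume (closedBall (0 : Euc d) 1)).toReal

lemma vB_pos (d : ℕ) : 0 < vB d :=
  ENNReal.toReal_pos (measure_closedBall_pos _ _ one_pos).ne' measure_closedBall_lt_top.ne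

lemma vB_ofReal (d : ℕ) : volume (closedBall (0 : Euc d) 1) = ENNReal.ofReal (vB d) :=
  (ENNReal.ofReal_toReal measure_closedBall_lt_top.ne).symm

lemma unif_integrable_iff (d : ℕ) (f : Euc d → ℝ) :
    Integrable f (uniformBall d 0) ↔ IntegrableOn f (closedBall (0 : Euc d) 1) := by
  unfold uniformBall
  rw [integrable_smul_measure (ENNReal.inv_ne_zero.2 measure_closedBall_lt_top.ne)
    (ENNReal.inv_ne_top.2 (measure_closedBall_pos _ _ one_pos).ne')]
  rfl

lemma unif_integral (d : ℕ) (f : Euc d → ℝ) :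
    ∫ y, f y ∂(uniformBall d 0) = (vB d)⁻¹ * ∫ y in closedBall (0 : Euc d) 1, f y := by
  unfold uniformBall
  rw [integral_smul_measure, ENNReal.toReal_inv]; rfl

lemma unif_lintegral (d : ℕ) (f : Euc d → ℝ≥0∞) :
    ∫⁻ y, f y ∂(uniformBall d 0) = ENNReal.ofReal (vB d)⁻¹ * ∫⁻ y in closedBall (0 : Euc d) 1, f y := by
  unfold uniformBall
  rw [lintegral_smul_measure, ENNReal.ofReal_inv_of_pos (vB_pos d), vB_ofReal]; rfl

/-- dominating kernel -/
def kk (d : ℕ) (z : Euc d) : ℝ := (‖z‖ ^ (d - 1))⁻¹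

lemma kk_nonneg (d : ℕ) (z : Euc d) : 0 ≤ kk d z := by unfold kk; positivity

lemma kk_meas (d : ℕ) : Measurable (kk d) := by unfold kk; fun_prop

lemma kk_neg (d : ℕ) (z : Euc d) : kk d (-z) = kk d z := by simp [kk]

lemma nontriv (d : ℕ) (hd : 2 ≤ d) : Nontrivial (Euc d) := by
  have : Nonempty (Fin d) := ⟨⟨0, by omega⟩⟩
  infer_instance

lemma kk_intOn (d : ℕ) (hd : 2 ≤ d) (R : ℝ) : IntegrableOn (kk d) (ball (0 : Euc d) R) := by
  have := nontriv d hd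
  have h := integrableOn_fun_norm_addHaar (E := Euc d) volume (f := fun r : ℝ => (r ^ (d - 1))⁻¹) (r := R)
  unfold kk
  rw [h]
  have h1 : IntegrableOn (fun _ : ℝ => (1:ℝ)) (Set.Ioo 0 R) := by simp
  refine h1.congr_fun (fun y hy => ?_) measurableSet_Ioo
  simp only [finrank_euclideanSpace, Fintype.card_fin, smul_eq_mul]
  rw [mul_inv_cancel₀ (pow_ne_zero _ hy.1.ne')]

lemma kk_locInt (d : ℕ) (hd : 2 ≤ d) (x : Euc d) (R : ℝ) :
    IntegrableOn (fun y => kk d (x - y)) (closedBall (0 : Euc d) R) := by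
  have h := kk_intOn d hd (R + ‖x‖ + 1)
  rw [← integrable_indicator_iff measurableSet_ball] at h
  have h2 := h.comp_sub_left x
  refine IntegrableOn.congr_fun h2.integrableOn (fun y hy => ?_) measurableSet_closedBall
  have hy : ‖y‖ ≤ R := by simpa using hy
  have : x - y ∈ ball (0 : Euc d) (R + ‖x‖ + 1) := by
    rw [mem_ball_zero_iff]
    linarith [norm_sub_le x y]
  simp [Set.indicator_of_mem this]

def C0 (d : ℕ) : ℝ := (vB d)⁻¹ * ((∫ z in ball (0 : Euc d) 1, kk d z) + vB d)

lemma C0_ge (d : ℕ) : 1 ≤ C0 d := by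
  unfold C0
  have h : 0 ≤ ∫ z in ball (0 : Euc d) 1, kk d z :=
    integral_nonneg fun z => kk_nonneg d z
  have := vB_pos d
  rw [mul_add, inv_mul_cancel₀ this.ne']
  have : 0 ≤ (vB d)⁻¹ * ∫ z in ball (0 : Euc d) 1, kk d z := by positivity
  linarith

lemma kk_unif (d : ℕ) (hd : 2 ≤ d) (x : Euc d) :
    Integrable (fun y => kk d (x - y)) (uniformBall d 0) ∧
    ∫ y, kk d (x - y) ∂(uniformBall d 0) ≤ C0 d := by
  have hi := kk_locInt d hd x 1
  refine ⟨(unif_integrable_iff d _).2 hi, ?_⟩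
  rw [unif_integral]
  unfold C0
  refine mul_le_mul_of_nonneg_left ?_ (inv_nonneg.2 (vB_pos d).le)
  have h := kk_intOn d hd 1
  rw [← integrable_indicator_iff measurableSet_ball] at h
  have h2 := h.comp_sub_left x
  have h3 : ∀ z, kk d z ≤ (ball (0 : Euc d) 1).indicator (kk d) z + 1 := by
    intro z
    by_cases hz : z ∈ ball (0 : Euc d) 1
    · rw [Set.indicator_of_mem hz]; linarith
    · rw [Set.indicator_of_notMem hz]
      have : 1 ≤ ‖z‖ := by simpa using hz
      unfold kk
      have := inv_le_one_of_one_le₀ (one_le_pow₀ this (n := d - 1))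
      linarith
  have hone : IntegrableOn (fun _ : Euc d => (1:ℝ)) (closedBall (0 : Euc d) 1) :=
    integrableOn_const measure_closedBall_lt_top.ne
  calc ∫ y in closedBall (0 : Euc d) 1, kk d (x - y)
      ≤ ∫ y in closedBall (0 : Euc d) 1, ((ball (0 : Euc d) 1).indicator (kk d) (x - y) + 1) :=
        integral_mono hi (h2.integrableOn.add hone) (fun y => h3 _)
    _ = (∫ y in closedBall (0 : Euc d) 1, (ball (0 : Euc d) 1).indicator (kk d) (x - y)) + vB d := by
        rw [integral_add h2.integrableOn hone]
        congr 1
        simp [vB, Measure.real]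
    _ ≤ _ := by
        refine add_le_add ?_ le_rfl
        refine (setIntegral_le_integral h2 (ae_of_all _ fun y =>
          Set.indicator_nonneg (fun z _ => kk_nonneg d z) _)).trans ?_
        rw [integral_sub_left_eq_self (fun z => (ball (0 : Euc d) 1).indicator (kk d) z) volume x,
          integral_indicator measurableSet_ball]

lemma g_abs (d : ℕ) (hd : 2 ≤ d) (z : Euc d) : |coulombKR d z| ≤ kk d z + ‖z‖ := by
  unfold coulombKR kk
  rcases eq_or_ne z 0 with hz | hz
  · subst hz
    split_ifs with h
    · subst h; simp
    · have : d - 2 ≠ 0 := by omega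
      have h2 : d - 1 ≠ 0 := by omega
      simp [this, h2]
  have hr : 0 < ‖z‖ := norm_pos_iff.2 hz
  split_ifs with h
  · subst h
    rw [one_div, Real.log_inv, abs_neg]
    have h1 := Real.log_le_self hr.le
    have h2 := Real.log_le_self (inv_nonneg.2 hr.le)
    rw [Real.log_inv] at h2
    simp only [Nat.add_one_sub_one, pow_one]
    rw [abs_le]
    constructor
    · linarith
    · have : 0 < ‖z‖⁻¹ := by positivity
      linarith
  · have hd3 : (1:ℝ) ≤ (d:ℝ) - 2 := by
      have : (3:ℝ) ≤ d := by
        have : 3 ≤ d := by omega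
        exact_mod_cast this
      linarith
    rw [abs_of_nonneg (by positivity)]
    have h1 : 1 / (((d:ℝ) - 2) * ‖z‖ ^ (d - 2)) ≤ (‖z‖ ^ (d - 2))⁻¹ := by
      rw [one_div]
      refine inv_anti₀ (by positivity) (le_mul_of_one_le_left (by positivity) hd3)
    refine h1.trans ?_
    have hdd : d - 1 = (d - 2) + 1 := by omega
    rcases le_total ‖z‖ 1 with h2 | h2
    · have : (‖z‖ ^ (d - 2))⁻¹ ≤ (‖z‖ ^ (d - 1))⁻¹ := by
        refine inv_anti₀ (by positivity) ?_
        rw [hdd, pow_succ]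
        exact mul_le_of_le_one_right (by positivity) h2
      linarith
    · have := inv_le_one_of_one_le₀ (one_le_pow₀ h2 (n := d - 2))
      have : 0 ≤ (‖z‖ ^ (d - 1))⁻¹ := by positivity
      linarith

lemma g_meas (d : ℕ) : Measurable (coulombKR d) := by
  unfold coulombKR
  split_ifs
  · exact (measurable_const.div measurable_norm).log
  · fun_prop

lemma g_neg (d : ℕ) (z : Euc d) : coulombKR d (-z) = coulombKR d z := by simp [coulombKR]

/-- lower bound on the kernel -/
lemma g_lower (d : ℕ) (hd : 2 ≤ d) (z : Euc d) : -‖z‖ ≤ coulombKR d z := by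
  unfold coulombKR
  split_ifs with h
  · rw [one_div, Real.log_inv]
    linarith [Real.log_le_self (norm_nonneg z)]
  · have hd3 : (0:ℝ) ≤ (d:ℝ) - 2 := by
      have : (2:ℝ) ≤ d := by exact_mod_cast hd
      linarith
    have : 0 ≤ 1 / (((d:ℝ) - 2) * ‖z‖ ^ (d - 2)) := by positivity
    linarith [norm_nonneg z]

lemma g_unif_integrable (d : ℕ) (hd : 2 ≤ d) (x : Euc d) :
    Integrable (fun y => coulombKR d (x - y)) (uniformBall d 0) := by
  have := uniformBall_prob d
  have h1 := (kk_unif d hd x).1.add (integrable_const (‖x‖ + 1))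
  refine Integrable.mono' h1 ((g_meas d).comp (measurable_const.sub measurable_id)).aestronglyMeasurable ?_
  filter_upwards [uniformBall_ae d] with y hy
  refine (g_abs d hd _).trans ?_
  have := norm_sub_le x y
  simp only [Pi.add_apply]
  linarith

/-- potential of the ball -/
def UU (d : ℕ) (x : Euc d) : ℝ := ∫ y, coulombKR d (x - y) ∂(uniformBall d 0)

lemma UU_lower (d : ℕ) (hd : 2 ≤ d) (x : Euc d) : -(‖x‖ + 1) ≤ UU d x := by
  have := uniformBall_prob d
  unfold UU
  have h : ∫ y, (-(‖x‖ + 1)) ∂(uniformBall d 0) = -(‖x‖ + 1) := by simp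
  rw [← h]
  refine integral_mono_ae (integrable_const _) (g_unif_integrable d hd x) ?_
  filter_upwards [uniformBall_ae d] with y hy
  have := g_lower d hd (x - y)
  have := norm_sub_le x y
  linarith

lemma UU_meas (d : ℕ) : StronglyMeasurable (UU d) := by
  have := uniformBall_prob d
  unfold UU
  refine StronglyMeasurable.integral_prod_right (f := fun (x y : Euc d) => coulombKR d (x - y)) ?_
  exact ((g_meas d).comp (measurable_fst.sub measurable_snd)).stronglyMeasurable

/-- joint integrability of the kernel -/
lemma g_unif_prod (d : ℕ) (hd : 2 ≤ d) :
    Integrable (fun q : Euc d × Euc d => coulombKR d (q.1 - q.2))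
      ((uniformBall d 0).prod (uniformBall d 0)) := by
  have := uniformBall_prob d
  have hm : AEStronglyMeasurable (fun q : Euc d × Euc d => coulombKR d (q.1 - q.2))
      ((uniformBall d 0).prod (uniformBall d 0)) :=
    ((g_meas d).comp (measurable_fst.sub measurable_snd)).aestronglyMeasurable
  rw [integrable_prod_iff hm]
  refine ⟨ae_of_all _ fun x => g_unif_integrable d hd x, ?_⟩
  refine Integrable.of_bound (C := C0 d + 2) hm.norm.integral_prod_right' ?_
  filter_upwards [uniformBall_ae d] with x hx
  rw [Real.norm_of_nonneg (integral_nonneg fun y => norm_nonneg _)]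
  have h1 := (kk_unif d hd x).1.add (integrable_const (2 : ℝ))
  calc ∫ y, ‖coulombKR d (x - y)‖ ∂(uniformBall d 0)
      ≤ ∫ y, (kk d (x - y) + 2) ∂(uniformBall d 0) := by
        refine integral_mono_ae (g_unif_integrable d hd x).norm h1 ?_
        filter_upwards [uniformBall_ae d] with y hy
        have := norm_sub_le x y
        have := g_abs d hd (x - y)
        simp only [Real.norm_eq_abs]
        linarith
    _ ≤ _ := by
        rw [integral_add (kk_unif d hd x).1 (integrable_const _)]
        simp only [integral_const, probReal_univ, one_smul]
        linarith [(kk_unif d hd x).2]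

lemma polar_lintegral (d : ℕ) (F : Euc d → ℝ≥0∞) (hF : Measurable F) (hd : 2 ≤ d) :
    ∫⁻ z, F z = ∫⁻ ω : sphere (0 : Euc d) 1, ∫⁻ r in Set.Ioi (0:ℝ),
      ENNReal.ofReal (r ^ (d - 1)) * F (r • (ω : Euc d)) ∂volume ∂((volume : Measure (Euc d)).toSphere) := by
  have := nontriv d hd
  have h0 : ∫⁻ z, F z = ∫⁻ z in ({0}ᶜ : Set (Euc d)), F z := by
    rw [restrict_compl_singleton (μ := (volume : Measure (Euc d))) 0]
  have hmp := (volume : Measure (Euc d)).measurePreserving_homeomorphUnitSphereProd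
  have h1 : ∫⁻ z in ({0}ᶜ : Set (Euc d)), F z =
      ∫⁻ z : ({0}ᶜ : Set (Euc d)), F z ∂(Measure.comap Subtype.val volume) := by
    rw [lintegral_subtype_comap (measurableSet_singleton 0).compl]
  have h2 : ∫⁻ z : ({0}ᶜ : Set (Euc d)), F z ∂(Measure.comap Subtype.val volume) =
      ∫⁻ p : sphere (0 : Euc d) 1 × Set.Ioi (0:ℝ), F ((p.2 : ℝ) • (p.1 : Euc d))
        ∂((volume : Measure (Euc d)).toSphere.prod (Measure.volumeIoiPow (Module.finrank ℝ (Euc d) - 1))) := by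
    rw [← hmp.map_eq, (homeomorphUnitSphereProd (Euc d)).measurableEmbedding.lintegral_map]
    refine lintegral_congr fun z => ?_
    have := congrArg Subtype.val ((homeomorphUnitSphereProd (Euc d)).symm_apply_apply z)
    rw [homeomorphUnitSphereProd_symm_apply_coe] at this
    rw [this]
  have hms : Measurable fun p : sphere (0 : Euc d) 1 × Set.Ioi (0:ℝ) => F ((p.2 : ℝ) • (p.1 : Euc d)) := by
    refine hF.comp ?_
    fun_prop
  rw [h0, h1, h2, lintegral_prod _ hms.aemeasurable]
  refine lintegral_congr fun ω => ?_
  unfold Measure.volumeIoiPow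
  rw [lintegral_withDensity_eq_lintegral_mul]
  · simp only [Pi.mul_apply, finrank_euclideanSpace, Fintype.card_fin]
    rw [lintegral_subtype_comap measurableSet_Ioi
      (fun r : ℝ => ENNReal.ofReal (r ^ (d - 1)) * F (r • (ω : Euc d)))]
  · fun_prop
  · refine hF.comp ?_
    fun_prop

/-- `Fs σ`: half-space restricted force density. -/
def Fs (d : ℕ) (a x z : Euc d) : ℝ :=
  if 0 < ⟪x, z⟫ ∧ ‖a + z‖ ≤ 1 then ⟪x, z⟫ * (‖z‖ ^ d)⁻¹ else 0
def Fn (d : ℕ) (a x z : Euc d) : ℝ :=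
  if 0 < ⟪x, z⟫ ∧ ‖a - z‖ ≤ 1 then ⟪x, z⟫ * (‖z‖ ^ d)⁻¹ else 0
def Wf (d : ℕ) (x z : Euc d) : ℝ :=
  if 0 < ⟪x, z⟫ ∧ ‖z‖ ≤ 1 then ⟪x, z⟫ ^ 2 / ‖z‖ ^ 2 else 0

lemma Fs_meas (d : ℕ) (a x : Euc d) : Measurable (Fs d a x) := by
  unfold Fs
  refine Measurable.ite ?_ (by fun_prop) measurable_const
  have h1 : Measurable fun z : Euc d => ⟪x, z⟫ := by fun_prop
  have h2 : Measurable fun z : Euc d => ‖a + z‖ := by fun_prop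
  exact (measurableSet_lt measurable_const h1).inter (measurableSet_le h2 measurable_const)
lemma Fn_meas (d : ℕ) (a x : Euc d) : Measurable (Fn d a x) := by
  unfold Fn
  refine Measurable.ite ?_ (by fun_prop) measurable_const
  have h1 : Measurable fun z : Euc d => ⟪x, z⟫ := by fun_prop
  have h2 : Measurable fun z : Euc d => ‖a - z‖ := by fun_prop
  exact (measurableSet_lt measurable_const h1).inter (measurableSet_le h2 measurable_const)
lemma Wf_meas (d : ℕ) (x : Euc d) : Measurable (Wf d x) := by
  unfold Wf
  refine Measurable.ite ?_ (by fun_prop) measurable_const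
  have h1 : Measurable fun z : Euc d => ⟪x, z⟫ := by fun_prop
  have h2 : Measurable fun z : Euc d => ‖z‖ := by fun_prop
  exact (measurableSet_lt measurable_const h1).inter (measurableSet_le h2 measurable_const)

lemma ray_s (d : ℕ) (hd : 2 ≤ d) (a x ω : Euc d) (hω : ‖ω‖ = 1) :
    ∫⁻ r in Set.Ioi (0:ℝ), ENNReal.ofReal (r ^ (d - 1)) * ENNReal.ofReal (Fs d a x (r • ω)) =
      ENNReal.ofReal ⟪x, ω⟫ * volume {r : ℝ | 0 < r ∧ ‖a + r • ω‖ ≤ 1} := by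
  set S := {r : ℝ | 0 < r ∧ ‖a + r • ω‖ ≤ 1} with hS
  have hS2 : Measurable fun r : ℝ => ‖a + r • ω‖ := by fun_prop
  have hSm : MeasurableSet S := (measurableSet_lt measurable_const measurable_id).inter
    (measurableSet_le hS2 measurable_const)
  have h : ∀ r ∈ Set.Ioi (0:ℝ), ENNReal.ofReal (r ^ (d - 1)) * ENNReal.ofReal (Fs d a x (r • ω)) =
      S.indicator (fun _ => ENNReal.ofReal ⟪x, ω⟫) r := by
    intro r hr
    have hr : 0 < r := hr
    rw [← ENNReal.ofReal_mul (by positivity)]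
    unfold Fs
    rw [real_inner_smul_right, norm_smul, hω, Real.norm_of_nonneg hr.le, mul_one]
    by_cases hu : 0 < ⟪x, ω⟫
    · have : 0 < r * ⟪x, ω⟫ := by positivity
      by_cases hb : ‖a + r • ω‖ ≤ 1
      · rw [Set.indicator_of_mem (show r ∈ S from ⟨hr, hb⟩), if_pos ⟨this, hb⟩]
        congr 1
        have hdd : r ^ d = r ^ (d - 1) * r := by rw [← pow_succ]; congr 1; omega
        rw [hdd]
        field_simp
      · rw [Set.indicator_of_notMem (fun h => hb h.2), if_neg (fun h => hb h.2)]; simp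
    · have h1 : ¬ (0 < r * ⟪x, ω⟫) := by
        intro h; exact hu (pos_of_mul_pos_right h hr.le)
      rw [if_neg (fun h => h1 h.1), mul_zero, ENNReal.ofReal_zero,
        ENNReal.ofReal_of_nonpos (not_lt.1 hu)]
      simp [Set.indicator]
  rw [setLIntegral_congr_fun measurableSet_Ioi h, lintegral_indicator hSm, lintegral_const,
    Measure.restrict_restrict hSm, Measure.restrict_apply_univ]
  congr 2
  ext r; simp [hS]; tauto

lemma Fn_eq (d : ℕ) (a x z : Euc d) : Fn d a x z = Fs d (-a) x z := by
  unfold Fn Fs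
  have : ‖a - z‖ = ‖-a + z‖ := by rw [← norm_neg]; congr 1; abel
  rw [this]

lemma ray_W (d : ℕ) (hd : 2 ≤ d) (x ω : Euc d) (hω : ‖ω‖ = 1) (hu : 0 < ⟪x, ω⟫) :
    ∫⁻ r in Set.Ioi (0:ℝ), ENNReal.ofReal (r ^ (d - 1)) * ENNReal.ofReal (Wf d x (r • ω)) =
      ENNReal.ofReal (⟪x, ω⟫ ^ 2 * (d : ℝ)⁻¹) := by
  have h : ∀ r ∈ Set.Ioi (0:ℝ), ENNReal.ofReal (r ^ (d - 1)) * ENNReal.ofReal (Wf d x (r • ω)) =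
      (Set.Ioc 0 1).indicator (fun r => ENNReal.ofReal (⟪x, ω⟫ ^ 2 * r ^ (d - 1))) r := by
    intro r hr
    have hr : 0 < r := hr
    rw [← ENNReal.ofReal_mul (by positivity)]
    unfold Wf
    rw [real_inner_smul_right, norm_smul, hω, Real.norm_of_nonneg hr.le, mul_one]
    have : 0 < r * ⟪x, ω⟫ := by positivity
    by_cases hb : r ≤ 1
    · rw [Set.indicator_of_mem (show r ∈ Set.Ioc 0 1 from ⟨hr, hb⟩), if_pos ⟨this, hb⟩]
      congr 1
      field_simp
    · rw [Set.indicator_of_notMem (fun h => hb h.2), if_neg (fun h => hb h.2)]; simp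
  rw [setLIntegral_congr_fun measurableSet_Ioi h, lintegral_indicator measurableSet_Ioc,
    Measure.restrict_restrict measurableSet_Ioc,
    Set.inter_eq_left.2 (fun r hr => hr.1)]
  rw [← ofReal_integral_eq_lintegral_ofReal]
  · congr 1
    rw [integral_const_mul, ← intervalIntegral.integral_of_le zero_le_one, integral_pow]
    have : d - 1 + 1 = d := by omega
    have h2 : ((d - 1 : ℕ) : ℝ) + 1 = d := by exact_mod_cast this
    rw [this, h2]
    have : d ≠ 0 := by omega
    simp [this]
  · exact (Continuous.integrableOn_Icc (by fun_prop)).mono_set Set.Ioc_subset_Icc_self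
  · filter_upwards [ae_restrict_mem measurableSet_Ioc] with r hr
    have := hr.1
    simp only [Pi.zero_apply]; positivity

lemma ray_W0 (d : ℕ) (x ω : Euc d) (hu : ¬ 0 < ⟪x, ω⟫) :
    ∫⁻ r in Set.Ioi (0:ℝ), ENNReal.ofReal (r ^ (d - 1)) * ENNReal.ofReal (Wf d x (r • ω)) = 0 := by
  have h : ∀ r ∈ Set.Ioi (0:ℝ), ENNReal.ofReal (r ^ (d - 1)) * ENNReal.ofReal (Wf d x (r • ω)) = 0 := by
    intro r hr
    have hr : 0 < r := hr
    unfold Wf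
    have h1 : ¬ (0 < ⟪x, r • ω⟫) := by
      rw [real_inner_smul_right]
      intro h; exact hu (pos_of_mul_pos_right h hr.le)
    rw [if_neg (fun h => h1 h.1)]; simp
  rw [setLIntegral_congr_fun measurableSet_Ioi h]; simp

lemma nsq_ray (d : ℕ) (x ω : Euc d) (hω : ‖ω‖ = 1) (τ r : ℝ) :
    ‖τ • x + r • ω‖ ^ 2 = τ ^ 2 * ‖x‖ ^ 2 + 2 * τ * r * ⟪x, ω⟫ + r ^ 2 := by
  rw [@norm_add_sq_real, norm_smul, norm_smul, hω, real_inner_smul_left, real_inner_smul_right,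
    mul_pow, mul_one, Real.norm_eq_abs, Real.norm_eq_abs, sq_abs, sq_abs]
  ring

lemma ray_cmp (d : ℕ) (x ω : Euc d) (hω : ‖ω‖ = 1) {τ : ℝ} (hτ : 0 ≤ τ) (hu : 0 < ⟪x, ω⟫) :
    volume {r : ℝ | 0 < r ∧ ‖-(τ • x) + r • ω‖ ≤ 1} ≤
      ENNReal.ofReal (2 * τ * ⟪x, ω⟫) + volume {r : ℝ | 0 < r ∧ ‖τ • x + r • ω‖ ≤ 1} ∧
    (‖τ • x‖ ≤ 1 → volume {r : ℝ | 0 < r ∧ ‖-(τ • x) + r • ω‖ ≤ 1} =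
      ENNReal.ofReal (2 * τ * ⟪x, ω⟫) + volume {r : ℝ | 0 < r ∧ ‖τ • x + r • ω‖ ≤ 1}) := by
  set u := ⟪x, ω⟫ with hudef
  set Sm := {r : ℝ | 0 < r ∧ ‖-(τ • x) + r • ω‖ ≤ 1} with hSm
  set Sp := {r : ℝ | 0 < r ∧ ‖τ • x + r • ω‖ ≤ 1} with hSp
  have hm : ∀ r, r ∈ Sm ↔ 0 < r ∧ τ ^ 2 * ‖x‖ ^ 2 - 2 * τ * r * u + r ^ 2 ≤ 1 := by
    intro r
    have e : -(τ • x) + r • ω = (-τ) • x + r • ω := by rw [neg_smul]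
    simp only [hSm, Set.mem_setOf_eq, e]
    rw [← sq_le_one_iff₀ (norm_nonneg _), nsq_ray d x ω hω]
    refine and_congr_right fun _ => ?_
    rw [show (-τ) ^ 2 * ‖x‖ ^ 2 + 2 * -τ * r * ⟪x, ω⟫ + r ^ 2 = τ ^ 2 * ‖x‖ ^ 2 - 2 * τ * r * u + r ^ 2 by
      rw [hudef]; ring]
  have hp : ∀ r, r ∈ Sp ↔ 0 < r ∧ τ ^ 2 * ‖x‖ ^ 2 + 2 * τ * r * u + r ^ 2 ≤ 1 := by
    intro r
    simp only [hSp, Set.mem_setOf_eq]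
    rw [← sq_le_one_iff₀ (norm_nonneg _), nsq_ray d x ω hω]
  have hS2 : Measurable fun r : ℝ => ‖τ • x + r • ω‖ := by fun_prop
  have hSpm : MeasurableSet Sp := (measurableSet_lt measurable_const measurable_id).inter
    (measurableSet_le hS2 measurable_const)
  set Sh := (fun r => r - 2 * τ * u) ⁻¹' Sp with hSh
  have hShv : volume Sh = volume Sp := by
    have := measure_preimage_add_right (volume : Measure ℝ) (-(2 * τ * u)) Sp
    simpa only [hSh, sub_eq_add_neg] using this
  have hI : volume (Set.Ioc 0 (2 * τ * u)) = ENNReal.ofReal (2 * τ * u) := by simp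
  have hsub : Sm ⊆ Set.Ioc 0 (2 * τ * u) ∪ Sh := by
    intro r hr
    rw [hm] at hr
    by_cases h : r ≤ 2 * τ * u
    · left; exact ⟨hr.1, h⟩
    · right
      rw [hSh, Set.mem_preimage, hp]
      refine ⟨by linarith, ?_⟩
      nlinarith [hr.2]
  constructor
  · rw [← hI, ← hShv]
    exact (measure_mono hsub).trans (measure_union_le _ _)
  · intro ha
    have ha2 : τ ^ 2 * ‖x‖ ^ 2 ≤ 1 := by
      rw [← sq_le_one_iff₀ (norm_nonneg _), norm_smul, mul_pow, Real.norm_eq_abs, sq_abs] at ha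
      exact ha
    have heq : Sm = Set.Ioc 0 (2 * τ * u) ∪ Sh := by
      refine Set.Subset.antisymm hsub ?_
      rintro r (hr | hr)
      · rw [hm]
        refine ⟨hr.1, ?_⟩
        nlinarith [hr.1, hr.2]
      · rw [hSh, Set.mem_preimage, hp] at hr
        rw [hm]
        have : 0 ≤ 2 * τ * u := by positivity
        refine ⟨by linarith [hr.1], ?_⟩
        nlinarith [hr.2]
    rw [heq, measure_union _ (hSpm.preimage (by fun_prop)), hI, hShv]
    rw [Set.disjoint_left]
    intro r hr hr'
    rw [Set.mem_preimage, hp] at hr'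
    linarith [hr.2, hr'.1]

lemma force_cmp (d : ℕ) (hd : 2 ≤ d) (x : Euc d) {τ : ℝ} (hτ : 0 ≤ τ) :
    ∫⁻ z, ENNReal.ofReal (Fn d (τ • x) x z) ≤ (∫⁻ z, ENNReal.ofReal (Fs d (τ • x) x z)) +
      ENNReal.ofReal (2 * τ * d) * ∫⁻ z, ENNReal.ofReal (Wf d x z) ∧
    (‖τ • x‖ ≤ 1 → ∫⁻ z, ENNReal.ofReal (Fn d (τ • x) x z) =
      (∫⁻ z, ENNReal.ofReal (Fs d (τ • x) x z)) +
        ENNReal.ofReal (2 * τ * d) * ∫⁻ z, ENNReal.ofReal (Wf d x z)) := by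
  have hd0 : (0:ℝ) < d := by exact_mod_cast (by omega : 0 < d)
  have hn := (Fn_meas d (τ • x) x).ennreal_ofReal
  have hs := (Fs_meas d (τ • x) x).ennreal_ofReal
  have hw := (Wf_meas d x).ennreal_ofReal
  have hsum : (∫⁻ z, ENNReal.ofReal (Fs d (τ • x) x z)) +
      ENNReal.ofReal (2 * τ * d) * ∫⁻ z, ENNReal.ofReal (Wf d x z) =
      ∫⁻ z, (ENNReal.ofReal (Fs d (τ • x) x z) + ENNReal.ofReal (2 * τ * d) * ENNReal.ofReal (Wf d x z)) := by
    rw [lintegral_add_left hs, lintegral_const_mul _ hw]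
  rw [hsum, polar_lintegral d _ hn hd, polar_lintegral d
    (fun z => ENNReal.ofReal (Fs d (τ • x) x z) + ENNReal.ofReal (2 * τ * d) * ENNReal.ofReal (Wf d x z))
    (hs.add (hw.const_mul _)) hd]
  have key : ∀ ω : sphere (0 : Euc d) 1,
      (∫⁻ r in Set.Ioi (0:ℝ), ENNReal.ofReal (r ^ (d - 1)) * ENNReal.ofReal (Fn d (τ • x) x (r • (ω : Euc d))) =
        ENNReal.ofReal ⟪x, (ω : Euc d)⟫ * volume {r : ℝ | 0 < r ∧ ‖-(τ • x) + r • (ω : Euc d)‖ ≤ 1}) ∧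
      (∫⁻ r in Set.Ioi (0:ℝ), ENNReal.ofReal (r ^ (d - 1)) * (ENNReal.ofReal (Fs d (τ • x) x (r • (ω : Euc d)))
          + ENNReal.ofReal (2 * τ * d) * ENNReal.ofReal (Wf d x (r • (ω : Euc d)))) =
        ENNReal.ofReal ⟪x, (ω : Euc d)⟫ * (ENNReal.ofReal (2 * τ * ⟪x, (ω : Euc d)⟫) +
          volume {r : ℝ | 0 < r ∧ ‖τ • x + r • (ω : Euc d)‖ ≤ 1})) := by
    intro ω
    have hω : ‖(ω : Euc d)‖ = 1 := by simpa using ω.2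
    constructor
    · simp_rw [Fn_eq]
      exact ray_s d hd _ x ω hω
    · have hsm : Measurable fun r : ℝ => ENNReal.ofReal (r ^ (d - 1)) *
          ENNReal.ofReal (Fs d (τ • x) x (r • (ω : Euc d))) :=
        Measurable.mul (by fun_prop) (hs.comp (by fun_prop))
      have e : ∀ r : ℝ, ENNReal.ofReal (r ^ (d - 1)) * (ENNReal.ofReal (Fs d (τ • x) x (r • (ω : Euc d)))
          + ENNReal.ofReal (2 * τ * d) * ENNReal.ofReal (Wf d x (r • (ω : Euc d)))) =
          ENNReal.ofReal (r ^ (d - 1)) * ENNReal.ofReal (Fs d (τ • x) x (r • (ω : Euc d))) +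
          ENNReal.ofReal (2 * τ * d) * (ENNReal.ofReal (r ^ (d - 1)) * ENNReal.ofReal (Wf d x (r • (ω : Euc d)))) :=
        fun r => by ring
      simp_rw [e]
      rw [lintegral_add_left hsm, lintegral_const_mul' _ _ ENNReal.ofReal_ne_top, ray_s d hd _ x ω hω]
      by_cases hu : 0 < ⟪x, (ω : Euc d)⟫
      · rw [ray_W d hd x ω hω hu, mul_add, add_comm, ← ENNReal.ofReal_mul (by positivity),
          ← ENNReal.ofReal_mul (by positivity)]
        congr 2
        field_simp
      · rw [ray_W0 d x ω hu, ENNReal.ofReal_of_nonpos (not_lt.1 hu)]; simp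
  simp_rw [fun ω => (key ω).1, fun ω => (key ω).2]
  constructor
  · refine lintegral_mono fun ω => ?_
    have hω : ‖(ω : Euc d)‖ = 1 := by simpa using ω.2
    by_cases hu : 0 < ⟪x, (ω : Euc d)⟫
    · exact mul_le_mul_right (ray_cmp d x ω hω hτ hu).1 _
    · rw [ENNReal.ofReal_of_nonpos (not_lt.1 hu)]; simp
  · intro ha
    refine lintegral_congr fun ω => ?_
    have hω : ‖(ω : Euc d)‖ = 1 := by simpa using ω.2
    by_cases hu : 0 < ⟪x, (ω : Euc d)⟫
    · rw [(ray_cmp d x ω hω hτ hu).2 ha]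
    · rw [ENNReal.ofReal_of_nonpos (not_lt.1 hu)]; simp

def Qf (d : ℕ) (x z : Euc d) : ℝ := ⟪x, z⟫ ^ 2 / ‖z‖ ^ 2
def QQ (d : ℕ) (x : Euc d) : ℝ := ∫ z in closedBall (0 : Euc d) 1, Qf d x z

lemma Qf_meas (d : ℕ) (x : Euc d) : Measurable (Qf d x) := by
  unfold Qf; fun_prop

lemma Qf_bound (d : ℕ) (x z : Euc d) : |Qf d x z| ≤ ‖x‖ ^ 2 := by
  unfold Qf
  rw [abs_of_nonneg (by positivity)]
  rcases eq_or_ne z 0 with h | h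
  · subst h; simp
  · have := norm_pos_iff.2 h
    rw [div_le_iff₀ (by positivity), ← mul_pow]
    have := abs_real_inner_le_norm x z
    rw [← sq_abs]
    gcongr

lemma Qf_int (d : ℕ) (x : Euc d) : IntegrableOn (Qf d x) (closedBall (0 : Euc d) 1) := by
  refine Measure.integrableOn_of_bounded (M := ‖x‖ ^ 2) measure_closedBall_lt_top.ne
    (Qf_meas d x).aestronglyMeasurable ?_
  exact ae_of_all _ fun z => by simpa using Qf_bound d x z

lemma QQ_smul (d : ℕ) (c : ℝ) (x : Euc d) : QQ d (c • x) = c ^ 2 * QQ d x := by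
  unfold QQ
  rw [← integral_const_mul]
  congr 1; ext z
  unfold Qf
  rw [real_inner_smul_left]; ring

lemma QQ_iso (d : ℕ) (L : Euc d ≃ₗᵢ[ℝ] Euc d) (x : Euc d) : QQ d (L x) = QQ d x := by
  unfold QQ
  have h := L.measurePreserving.setIntegral_preimage_emb L.toHomeomorph.measurableEmbedding
    (Qf d (L x)) (closedBall 0 1)
  rw [← h]
  have e : (L ⁻¹' closedBall (0 : Euc d) 1) = closedBall 0 1 := by
    ext z; simp
  rw [e]
  congr 1; ext z
  unfold Qf
  rw [L.inner_map_map, L.norm_map]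

lemma QQ_norm (d : ℕ) (x y : Euc d) (h : ‖x‖ = ‖y‖) : QQ d x = QQ d y := by
  have := Submodule.reflection_sub h
  rw [← this, QQ_iso]

lemma QQ_eq (d : ℕ) (hd : 2 ≤ d) (x : Euc d) : QQ d x = ‖x‖ ^ 2 * vB d / d := by
  have hn := nontriv d hd
  have hd0 : (0:ℝ) < d := by exact_mod_cast (by omega : 0 < d)
  have hsum : ∑ i : Fin d, QQ d (EuclideanSpace.single i (1:ℝ)) = vB d := by
    unfold QQ
    rw [← integral_finset_sum _ (fun i _ => Qf_int d _)]
    have : ∀ᵐ z ∂(volume.restrict (closedBall (0 : Euc d) 1)),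
        ∑ i : Fin d, Qf d (EuclideanSpace.single i (1:ℝ)) z = 1 := by
      have h0 : ∀ᵐ z ∂(volume.restrict (closedBall (0 : Euc d) 1)), z ≠ 0 :=
        ae_restrict_of_ae (by simp [ae_iff, measure_singleton])
      filter_upwards [h0] with z hz
      have := norm_pos_iff.2 hz
      unfold Qf
      rw [← Finset.sum_div, div_eq_one_iff_eq (by positivity), EuclideanSpace.norm_sq_eq]
      simp [EuclideanSpace.inner_single_left]
    rw [integral_congr_ae this]
    simp [vB, Measure.real]
  have hx : ∀ i : Fin d, QQ d x = ‖x‖ ^ 2 * QQ d (EuclideanSpace.single i (1:ℝ)) := by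
    intro i
    rw [← QQ_smul]
    apply QQ_norm
    rw [norm_smul]; simp
  have h2 : (d:ℝ) * QQ d x = ‖x‖ ^ 2 * vB d := by
    rw [← hsum, Finset.mul_sum, ← Finset.sum_congr rfl (fun i _ => hx i)]
    simp
  rw [← h2]; field_simp

lemma Wf_lintegral (d : ℕ) (hd : 2 ≤ d) (x : Euc d) :
    ∫⁻ z, ENNReal.ofReal (Wf d x z) = ENNReal.ofReal (‖x‖ ^ 2 * vB d / (2 * d)) := by
  have hd0 : (0:ℝ) < d := by exact_mod_cast (by omega : 0 < d)
  have hnn : ∀ z, 0 ≤ Wf d x z := by intro z; unfold Wf; split_ifs <;> positivity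
  have hb : IntegrableOn (Wf d x) (closedBall (0 : Euc d) 1) := by
    refine (Qf_int d x).mono' (Wf_meas d x).aestronglyMeasurable (ae_of_all _ fun z => ?_)
    rw [Real.norm_of_nonneg (hnn z)]
    unfold Wf Qf; split_ifs
    · exact le_rfl
    · positivity
  have hi : Integrable (Wf d x) := by
    rw [← integrableOn_iff_integrable_of_support_subset (s := closedBall (0 : Euc d) 1)]
    · exact hb
    · intro z hz
      by_contra h
      apply hz
      unfold Wf
      rw [if_neg]
      intro h2; exact h (by simpa using h2.2)
  rw [← ofReal_integral_eq_lintegral_ofReal hi (ae_of_all _ hnn)]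
  congr 1
  have e : QQ d x = (∫ z, Wf d x z) + ∫ z, Wf d x (-z) := by
    rw [← integral_add hi hi.comp_neg]
    unfold QQ
    rw [← integral_indicator measurableSet_closedBall]
    congr 1; ext z
    unfold Wf Qf
    by_cases hz : ‖z‖ ≤ 1
    · rw [Set.indicator_of_mem (by simpa using hz)]
      simp only [inner_neg_right, norm_neg, hz, and_true]
      rcases lt_trichotomy 0 ⟪x, z⟫ with h | h | h
      · rw [if_pos h, if_neg (by linarith)]; simp
      · rw [← h]; simp
      · rw [if_neg (by linarith), if_pos (by linarith)]; simp
    · rw [Set.indicator_of_notMem (by simpa using hz)]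
      simp [hz]
  rw [integral_neg_eq_self (fun z => Wf d x z), QQ_eq d hd] at e
  have : ∫ z, Wf d x z = (‖x‖ ^ 2 * vB d / d) / 2 := by linarith
  rw [this]; field_simp

/-- the force integrand -/
def ff (d : ℕ) (x z : Euc d) : ℝ := ⟪x, z⟫ * (‖z‖ ^ d)⁻¹

lemma ff_meas (d : ℕ) (x : Euc d) : Measurable (ff d x) := by unfold ff; fun_prop

lemma ff_bound (d : ℕ) (hd : 2 ≤ d) (x z : Euc d) : |ff d x z| ≤ ‖x‖ * kk d z := by
  unfold ff kk
  rcases eq_or_ne z 0 with h | h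
  · subst h; simp; positivity
  · have := norm_pos_iff.2 h
    rw [abs_mul, abs_of_pos (a := (‖z‖ ^ d)⁻¹) (by positivity)]
    calc |⟪x, z⟫| * (‖z‖ ^ d)⁻¹ ≤ (‖x‖ * ‖z‖) * (‖z‖ ^ d)⁻¹ := by
          gcongr; exact abs_real_inner_le_norm x z
      _ = ‖x‖ * (‖z‖ ^ (d - 1))⁻¹ := by
          have hdd : ‖z‖ ^ d = ‖z‖ ^ (d - 1) * ‖z‖ := by rw [← pow_succ]; congr 1; omega
          rw [hdd]; field_simp

lemma Fn_int (d : ℕ) (hd : 2 ≤ d) (a x : Euc d) : Integrable (Fn d a x) := by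
  have h := ((kk_intOn d hd (‖a‖ + 2)).const_mul ‖x‖)
  have hnn : ∀ z, 0 ≤ Fn d a x z := by
    intro z; unfold Fn; split_ifs with h
    · have := h.1; positivity
    · exact le_rfl
  rw [← integrableOn_iff_integrable_of_support_subset (s := ball (0 : Euc d) (‖a‖ + 2))]
  · refine h.mono' (Fn_meas d a x).aestronglyMeasurable (ae_of_all _ fun z => ?_)
    unfold Fn
    split_ifs
    · exact ff_bound d hd x z
    · simp; exact mul_nonneg (norm_nonneg _) (kk_nonneg _ _)
  · intro z hz
    by_contra h
    apply hz
    unfold Fn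
    rw [if_neg]
    intro h2
    apply h
    rw [mem_ball_zero_iff]
    have : ‖z‖ ≤ ‖a‖ + ‖a - z‖ := by
      calc ‖z‖ = ‖a - (a - z)‖ := by congr 1; abel
        _ ≤ _ := norm_sub_le _ _
    linarith [h2.2]

lemma force_le (d : ℕ) (hd : 2 ≤ d) (x : Euc d) {τ : ℝ} (hτ : 0 ≤ τ) :
    ∫ y, ff d x (τ • x - y) ∂(uniformBall d 0) ≤ τ * ‖x‖ ^ 2 ∧
    (‖τ • x‖ ≤ 1 → ∫ y, ff d x (τ • x - y) ∂(uniformBall d 0) = τ * ‖x‖ ^ 2) := by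
  have hd0 : (0:ℝ) < d := by exact_mod_cast (by omega : 0 < d)
  have hv := vB_pos d
  have hFn := Fn_int d hd (τ • x) x
  have hFs : Integrable (Fs d (τ • x) x) := by
    have := Fn_int d hd (-(τ • x)) x
    have e : Fn d (-(τ • x)) x = Fs d (τ • x) x := by
      ext z; rw [Fn_eq, neg_neg]
    rwa [e] at this
  have hn0 : ∀ z, 0 ≤ Fn d (τ • x) x z := by
    intro z; unfold Fn; split_ifs with h
    · have := h.1; positivity
    · exact le_rfl
  have hs0 : ∀ z, 0 ≤ Fs d (τ • x) x z := by
    intro z; unfold Fs; split_ifs with h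
    · have := h.1; positivity
    · exact le_rfl
  have e1 : ∫ y in closedBall (0 : Euc d) 1, ff d x (τ • x - y) =
      (∫ z, Fn d (τ • x) x z) - ∫ z, Fs d (τ • x) x z := by
    rw [← integral_indicator measurableSet_closedBall,
      ← integral_sub_left_eq_self _ volume (τ • x), ← integral_neg_eq_self (Fs d (τ • x) x),
      ← integral_sub hFn hFs.comp_neg]
    congr 1; ext z
    unfold Fn Fs ff
    by_cases hz : ‖τ • x - z‖ ≤ 1
    · rw [Set.indicator_of_mem (by simpa using hz)]
      have hz' : ‖τ • x + -z‖ ≤ 1 := by rwa [← sub_eq_add_neg]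
      simp only [hz, hz', and_true, inner_neg_right, norm_neg, sub_sub_cancel]
      rcases lt_trichotomy 0 ⟪x, z⟫ with h | h | h
      · rw [if_pos h, if_neg (by linarith)]; simp
      · rw [← h]; simp
      · rw [if_neg (by linarith), if_pos (by linarith)]; simp
    · rw [Set.indicator_of_notMem (by simpa using hz)]
      have hz' : ¬ ‖τ • x + -z‖ ≤ 1 := by rwa [← sub_eq_add_neg]
      simp [hz, hz']
  have hc := force_cmp d hd x hτ
  rw [Wf_lintegral d hd, ← ofReal_integral_eq_lintegral_ofReal hFn (ae_of_all _ hn0),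
    ← ofReal_integral_eq_lintegral_ofReal hFs (ae_of_all _ hs0), ← ENNReal.ofReal_mul (by positivity),
    ← ENNReal.ofReal_add (integral_nonneg hs0) (by positivity)] at hc
  have e2 : 2 * τ * d * (‖x‖ ^ 2 * vB d / (2 * d)) = vB d * (τ * ‖x‖ ^ 2) := by field_simp
  rw [e2] at hc
  have hR : 0 ≤ (∫ z, Fs d (τ • x) x z) + vB d * (τ * ‖x‖ ^ 2) :=
    add_nonneg (integral_nonneg hs0) (by positivity)
  rw [unif_integral, e1]
  constructor
  · have := (ENNReal.ofReal_le_ofReal_iff hR).1 hc.1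
    rw [inv_mul_le_iff₀ hv]; linarith
  · intro ha
    have := (ENNReal.ofReal_eq_ofReal_iff (integral_nonneg hn0) hR).1 (hc.2 ha)
    rw [inv_mul_eq_iff_eq_mul₀ hv.ne']; linarith

lemma g_hasDeriv (d : ℕ) (hd : 2 ≤ d) (x y : Euc d) (τ : ℝ) (h : τ • x - y ≠ 0) :
    HasDerivAt (fun t : ℝ => coulombKR d (t • x - y)) (-ff d x (τ • x - y)) τ := by
  have hpos := norm_pos_iff.2 h
  have h1 : HasDerivAt (fun t : ℝ => t • x - y) x τ := by
    simpa using ((hasDerivAt_id τ).smul_const x).sub_const y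
  have h2 := h1.norm_sq
  have h3 := h2.sqrt (by positivity)
  have h4 : HasDerivAt (fun t : ℝ => ‖t • x - y‖) (⟪x, τ • x - y⟫ / ‖τ • x - y‖) τ := by
    have e : (fun t : ℝ => √(‖t • x - y‖ ^ 2)) = fun t : ℝ => ‖t • x - y‖ := by
      ext t; exact Real.sqrt_sq (norm_nonneg _)
    rw [e] at h3
    refine h3.congr_deriv ?_
    rw [Real.sqrt_sq (norm_nonneg _), real_inner_comm]
    field_simp
  unfold coulombKR ff
  by_cases hd2 : d = 2
  · simp only [hd2, if_true]
    subst hd2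
    have h5 := (h4.log hpos.ne').neg
    have e : (fun t : ℝ => Real.log (1 / ‖t • x - y‖)) = -fun t : ℝ => Real.log ‖t • x - y‖ := by
      ext t; simp [Real.log_inv]
    rw [e]
    refine h5.congr_deriv ?_
    field_simp
  · simp only [hd2, if_false]
    obtain ⟨m, rfl⟩ : ∃ m, d = m + 3 := ⟨d - 3, by omega⟩
    have hm : ((m + 3 : ℕ) : ℝ) - 2 = m + 1 := by push_cast; ring
    have hm0 : (0:ℝ) < m + 1 := by positivity
    have e : m + 3 - 2 = m + 1 := by omega
    rw [hm, e]
    have h5 := ((h4.pow (m + 1)).const_mul ((m:ℝ) + 1)).inv (by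
      have : 0 < ‖τ • x - y‖ ^ (m + 1) := by positivity
      exact (mul_pos hm0 this).ne')
    have e2 : (fun t : ℝ => 1 / (((m:ℝ) + 1) * ‖t • x - y‖ ^ (m + 1))) =
      (fun t : ℝ => ((m:ℝ) + 1) * ((fun t : ℝ => ‖t • x - y‖) ^ (m + 1)) t)⁻¹ := by
      ext t; simp
    rw [e2]
    refine h5.congr_deriv ?_
    simp only [Nat.add_sub_cancel, Pi.pow_apply]
    push_cast
    generalize ⟪x, τ • x - y⟫ = w
    field_simp
    ring_nf

lemma g_ftc (d : ℕ) (hd : 2 ≤ d) (x y : Euc d) (h : ∀ τ : ℝ, τ • x - y ≠ 0) :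
    coulombKR d (x - y) - coulombKR d (0 - y) = - ∫ τ in Set.Ioc (0:ℝ) 1, ff d x (τ • x - y) := by
  rw [← intervalIntegral.integral_of_le zero_le_one, ← intervalIntegral.integral_neg]
  have := intervalIntegral.integral_eq_sub_of_hasDerivAt (a := 0) (b := 1)
    (f := fun t : ℝ => coulombKR d (t • x - y)) (f' := fun τ => -ff d x (τ • x - y))
    (fun τ _ => g_hasDeriv d hd x y τ (h τ)) ?_
  · rw [this]; simp
  · apply Continuous.intervalIntegrable
    unfold ff
    refine (Continuous.mul (by fun_prop) (Continuous.inv₀ (by fun_prop) ?_)).neg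
    intro τ
    exact pow_ne_zero _ (norm_ne_zero_iff.2 (h τ))

lemma off_line (d : ℕ) (hd : 2 ≤ d) (x : Euc d) :
    ∀ᵐ y ∂(uniformBall d 0), ∀ τ : ℝ, τ • x - y ≠ 0 := by
  have h : ∀ᵐ y : Euc d, ∀ τ : ℝ, τ • x - y ≠ 0 := by
    rw [ae_iff]
    have hne : (ℝ ∙ x) ≠ (⊤ : Submodule ℝ (Euc d)) := by
      intro h
      have h1 : Module.finrank ℝ (ℝ ∙ x) ≤ 1 := by
        have := finrank_span_le_card (R := ℝ) ({x} : Set (Euc d)); simpa using this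
      rw [h, finrank_top, finrank_euclideanSpace, Fintype.card_fin] at h1
      omega
    refine measure_mono_null ?_ (Measure.addHaar_submodule volume (ℝ ∙ x) hne)
    intro y hy
    simp only [Set.mem_setOf_eq, not_forall, not_not] at hy
    obtain ⟨τ, hτ⟩ := hy
    exact Submodule.mem_span_singleton.2 ⟨τ, sub_eq_zero.1 hτ⟩
  unfold uniformBall
  exact Measure.ae_smul_measure (ae_restrict_of_ae h) _

lemma UU_diff (d : ℕ) (hd : 2 ≤ d) (x : Euc d) :
    UU d x - UU d 0 = - ∫ τ in Set.Ioc (0:ℝ) 1, ∫ y, ff d x (τ • x - y) ∂(uniformBall d 0) ∧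
    IntegrableOn (fun τ : ℝ => ∫ y, ff d x (τ • x - y) ∂(uniformBall d 0)) (Set.Ioc 0 1) := by
  have := uniformBall_prob d
  have hm : Measurable fun q : ℝ × Euc d => ff d x (q.1 • x - q.2) :=
    (ff_meas d x).comp (by fun_prop)
  have hki : ∀ τ : ℝ, Integrable (fun y => ff d x (τ • x - y)) (uniformBall d 0) := by
    intro τ
    refine ((kk_unif d hd (τ • x)).1.const_mul ‖x‖).mono' ?_ (ae_of_all _ fun y => ?_)
    · exact ((ff_meas d x).comp (by fun_prop)).aestronglyMeasurable
    · exact ff_bound d hd x _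
  have hI : Integrable (fun q : ℝ × Euc d => ff d x (q.1 • x - q.2))
      ((volume.restrict (Set.Ioc (0:ℝ) 1)).prod (uniformBall d 0)) := by
    rw [integrable_prod_iff hm.aestronglyMeasurable]
    refine ⟨ae_of_all _ hki, ?_⟩
    refine Measure.integrableOn_of_bounded (s := Set.Ioc (0:ℝ) 1) (M := ‖x‖ * C0 d) (by simp) ?_ ?_
    · exact hm.norm.aestronglyMeasurable.integral_prod_right'
    · refine ae_of_all _ fun τ => ?_
      rw [Real.norm_of_nonneg (integral_nonneg fun y => norm_nonneg _)]
      calc ∫ y, ‖ff d x (τ • x - y)‖ ∂(uniformBall d 0) ≤ ∫ y, ‖x‖ * kk d (τ • x - y) ∂(uniformBall d 0) := by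
            refine integral_mono (hki τ).norm ((kk_unif d hd (τ • x)).1.const_mul ‖x‖) fun y => ?_
            exact ff_bound d hd x _
        _ ≤ ‖x‖ * C0 d := by
            rw [integral_const_mul]
            exact mul_le_mul_of_nonneg_left (kk_unif d hd _).2 (norm_nonneg _)
  constructor
  · rw [integral_integral_swap (f := fun (τ : ℝ) (y : Euc d) => ff d x (τ • x - y)) hI]
    unfold UU
    rw [← integral_sub (g_unif_integrable d hd x) (g_unif_integrable d hd 0), ← integral_neg]
    refine integral_congr_ae ?_
    filter_upwards [off_line d hd x] with y hy
    exact g_ftc d hd x y hy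
  · exact hI.integral_prod_left

/-- effective potential -/
def zet (d : ℕ) (x : Euc d) : ℝ := ‖x‖ ^ 2 + 2 * UU d x - 2 * UU d 0

lemma tau_int (c : ℝ) : ∫ τ in Set.Ioc (0:ℝ) 1, τ * c = c / 2 := by
  rw [integral_mul_const, ← intervalIntegral.integral_of_le zero_le_one, integral_id]; ring

lemma zet_nonneg (d : ℕ) (hd : 2 ≤ d) (x : Euc d) : 0 ≤ zet d x := by
  have h := UU_diff d hd x
  have : ∫ τ in Set.Ioc (0:ℝ) 1, ∫ y, ff d x (τ • x - y) ∂(uniformBall d 0) ≤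
      ∫ τ in Set.Ioc (0:ℝ) 1, τ * ‖x‖ ^ 2 := by
    refine setIntegral_mono_on h.2 ?_ measurableSet_Ioc ?_
    · exact (Continuous.integrableOn_Icc (by fun_prop)).mono_set Set.Ioc_subset_Icc_self
    · intro τ hτ
      exact (force_le d hd x hτ.1.le).1
  rw [tau_int] at this
  unfold zet; linarith

lemma zet_ball (d : ℕ) (hd : 2 ≤ d) (x : Euc d) (hx : ‖x‖ ≤ 1) : zet d x = 0 := by
  have h := UU_diff d hd x
  have : ∫ τ in Set.Ioc (0:ℝ) 1, ∫ y, ff d x (τ • x - y) ∂(uniformBall d 0) =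
      ∫ τ in Set.Ioc (0:ℝ) 1, τ * ‖x‖ ^ 2 := by
    refine setIntegral_congr_fun measurableSet_Ioc ?_
    intro τ hτ
    refine (force_le d hd x hτ.1.le).2 ?_
    rw [norm_smul, Real.norm_of_nonneg hτ.1.le]
    exact mul_le_one₀ hτ.2 (norm_nonneg _) hx
  rw [tau_int] at this
  unfold zet; linarith

def C1 (d : ℕ) : ℝ := 4 + 2 * |UU d 0|

lemma zet_growth (d : ℕ) (hd : 2 ≤ d) (x : Euc d) : ‖x‖ ^ 2 / 2 - C1 d ≤ zet d x := by
  unfold zet C1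
  have := UU_lower d hd x
  have := le_abs_self (UU d 0)
  nlinarith [sq_nonneg (‖x‖ - 2)]

def JJ (d : ℕ) : ℝ := ∫ q : Euc d × Euc d, coulombKR d (q.1 - q.2) ∂((uniformBall d 0).prod (uniformBall d 0))
def Est (d : ℕ) : ℝ := 2 * UU d 0 - JJ d

lemma JJ_eq (d : ℕ) (hd : 2 ≤ d) : JJ d = ∫ x, UU d x ∂(uniformBall d 0) := by
  have := uniformBall_prob d
  unfold JJ UU
  exact integral_prod _ (g_unif_prod d hd)

lemma UU_int (d : ℕ) (hd : 2 ≤ d) : Integrable (UU d) (uniformBall d 0) := by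
  have := uniformBall_prob d
  exact (g_unif_prod d hd).integral_prod_left

lemma nsq_int (d : ℕ) : Integrable (fun x : Euc d => ‖x‖ ^ 2) (uniformBall d 0) := by
  rw [unif_integrable_iff]
  exact (by fun_prop : Continuous fun x : Euc d => ‖x‖ ^ 2).continuousOn.integrableOn_compact
    (isCompact_closedBall _ _)

lemma Est_eq (d : ℕ) (hd : 2 ≤ d) : ∫ x, ‖x‖ ^ 2 ∂(uniformBall d 0) + JJ d = Est d := by
  have := uniformBall_prob d
  have h : ∫ x, zet d x ∂(uniformBall d 0) = 0 := by
    refine integral_eq_zero_of_ae ?_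
    filter_upwards [uniformBall_ae d] with x hx using zet_ball d hd x hx
  unfold zet at h
  rw [integral_sub (f := fun x => ‖x‖ ^ 2 + 2 * UU d x) ((nsq_int d).add ((UU_int d hd).const_mul 2)) (integrable_const _),
    integral_add (nsq_int d) ((UU_int d hd).const_mul 2), integral_const_mul, ← JJ_eq d hd] at h
  simp at h
  unfold Est; linarith

lemma unif_ne (d : ℕ) (hd : 2 ≤ d) (x : Euc d) : ∀ᵐ y ∂(uniformBall d 0), x - y ≠ 0 := by
  have := nontriv d hd
  have h : ∀ᵐ y : Euc d, x - y ≠ 0 := by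
    simp only [sub_ne_zero]
    rw [ae_iff]
    have : {y : Euc d | ¬ x ≠ y} = {x} := by ext y; simp [eq_comm]
    rw [this, measure_singleton]
  unfold uniformBall
  exact Measure.ae_smul_measure (ae_restrict_of_ae h) _

lemma qT_unif (d : ℕ) (hd : 2 ≤ d) {T : ℝ} (hT : 0 < T) (x : Euc d) :
    Integrable (fun y => qT d T (x - y)) (uniformBall d 0) ∧
    ∫ y, qT d T (x - y) ∂(uniformBall d 0) ≤ cq d / (T * vB d) := by
  have hv := vB_pos d
  have hc := cq_pos d hd
  have hm : StronglyMeasurable fun y => qT d T (x - y) :=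
    (qT_meas d T).comp_measurable (measurable_const.sub measurable_id)
  have hnn : ∀ y, 0 ≤ qT d T (x - y) := fun y => qT_nonneg d hd hT _
  have h1 : ∫⁻ y, ENNReal.ofReal (qT d T (x - y)) ∂(uniformBall d 0) ≤ ENNReal.ofReal (cq d / (T * vB d)) := by
    rw [unif_lintegral]
    calc _ ≤ ENNReal.ofReal (vB d)⁻¹ * ∫⁻ y, ENNReal.ofReal (qT d T (x - y)) := by
          exact mul_le_mul_right (setLIntegral_le_lintegral _ _) _
      _ = ENNReal.ofReal (vB d)⁻¹ * ∫⁻ y, ENNReal.ofReal (qT d T y) := by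
          rw [lintegral_sub_left_eq_self (fun y => ENNReal.ofReal (qT d T y)) x]
      _ ≤ ENNReal.ofReal (vB d)⁻¹ * ENNReal.ofReal (cq d / T) := mul_le_mul_right (qT_lintegral d hd hT) _
      _ = _ := by
          rw [← ENNReal.ofReal_mul (by positivity)]; congr 1; field_simp
  have hi : Integrable (fun y => qT d T (x - y)) (uniformBall d 0) := by
    refine ⟨hm.aestronglyMeasurable, ?_⟩
    rw [hasFiniteIntegral_iff_ofReal (ae_of_all _ hnn)]
    exact h1.trans_lt ENNReal.ofReal_lt_top
  refine ⟨hi, ?_⟩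
  rw [← ofReal_integral_eq_lintegral_ofReal hi (ae_of_all _ hnn)] at h1
  exact (ENNReal.ofReal_le_ofReal_iff (by positivity)).1 h1

lemma KT_unif (d : ℕ) (hd : 2 ≤ d) {T : ℝ} (hT : 0 < T) (x : Euc d) :
    Integrable (fun y => KT d T (x - y)) (uniformBall d 0) ∧
    UU d x - cq d / (T * vB d) ≤ ∫ y, KT d T (x - y) ∂(uniformBall d 0) ∧
    ∫ y, KT d T (x - y) ∂(uniformBall d 0) ≤ UU d x := by
  have e : (fun y => coulombKR d (x - y) - qT d T (x - y)) =ᵐ[uniformBall d 0] fun y => KT d T (x - y) := by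
    filter_upwards [unif_ne d hd x] with y hy
    rw [coulomb_split d hd hT _ hy]; ring
  have hq := qT_unif d hd hT x
  have hg := g_unif_integrable d hd x
  refine ⟨(hg.sub hq.1).congr e, ?_⟩
  rw [← integral_congr_ae e, integral_sub hg hq.1]
  have : 0 ≤ ∫ y, qT d T (x - y) ∂(uniformBall d 0) := integral_nonneg fun y => qT_nonneg d hd hT _
  unfold UU
  constructor <;> linarith [hq.2]

lemma emp_prob (d n : ℕ) (hn : 1 ≤ n) (x : Fin n → Euc d) : IsProbabilityMeasure (empMeas d n x) := by
  constructor
  unfold empMeas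
  have : (n : ℝ≥0∞) ≠ 0 := by exact_mod_cast (by omega : n ≠ 0)
  simp [ENNReal.inv_mul_cancel this (ENNReal.natCast_ne_top n)]

lemma emp_integral (d n : ℕ) (x : Fin n → Euc d) (f : Euc d → ℝ) :
    ∫ y, f y ∂(empMeas d n x) = (1 / (n:ℝ)) * ∑ i, f (x i) := by
  unfold empMeas
  rw [integral_smul_measure, integral_finsetSum_measure]
  · simp
  · intro i _
    exact integrable_dirac (by simp)

lemma emp_ae (d n : ℕ) (x : Fin n → Euc d) (P : Euc d → Prop) (h : ∀ i, P (x i)) :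
    ∀ᵐ y ∂(empMeas d n x), P y := by
  unfold empMeas
  refine Measure.ae_smul_measure ?_ _
  rw [← Measure.sum_fintype, Measure.ae_sum_iff]
  intro i
  rw [ae_dirac_eq]
  exact h i

lemma energy_lower (d n : ℕ) (hd : 2 ≤ d) (hn : 1 ≤ n) {T : ℝ} (hT : 0 < T)
    (x : Fin n → Euc d) (hx : ∀ i j, i ≠ j → x i - x j ≠ 0) :
    DT d T (empMeas d n x) (uniformBall d 0) + (1 / (n:ℝ)) * ∑ i, zet d (x i) + Est d
      - 2 * (cq d / (T * vB d)) - KT d T 0 / n ≤ hamiltonian d n (fun y => ‖y‖ ^ 2) x := by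
  have hp := emp_prob d n hn x
  have hu := uniformBall_prob d
  have hn0 : (0:ℝ) < n := by exact_mod_cast hn
  set r : ℝ := 1 + ∑ i, ‖x i‖ with hr
  have hr0 : 0 ≤ ∑ i, ‖x i‖ := Finset.sum_nonneg fun i _ => norm_nonneg _
  have hν : ∀ᵐ y ∂(empMeas d n x), ‖y‖ ≤ r := by
    refine emp_ae d n x (fun y => ‖y‖ ≤ r) fun i => ?_
    have := Finset.single_le_sum (f := fun i => ‖x i‖) (fun i _ => norm_nonneg _) (Finset.mem_univ i)
    linarith
  have hμ : ∀ᵐ y ∂(uniformBall d 0), ‖y‖ ≤ r := by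
    filter_upwards [uniformBall_ae d] with y hy; linarith
  have e1 : IT d T (empMeas d n x) (empMeas d n x) = (1 / (n:ℝ)) * ∑ i, ((1 / (n:ℝ)) * ∑ j, KT d T (x i - x j)) := by
    unfold IT
    rw [integral_prod _ (KT_int d hd hT _ _ r hν hν), emp_integral]
    simp_rw [emp_integral]
  have e2 : IT d T (empMeas d n x) (uniformBall d 0) =
      (1 / (n:ℝ)) * ∑ i, ∫ y, KT d T (x i - y) ∂(uniformBall d 0) := by
    unfold IT
    rw [integral_prod _ (KT_int d hd hT _ _ r hν hμ), emp_integral]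
  have e3 : IT d T (uniformBall d 0) (uniformBall d 0) ≤ JJ d := by
    have hI := KT_int d hd hT _ _ r hμ hμ
    unfold IT
    rw [integral_prod _ hI, JJ_eq d hd]
    exact integral_mono hI.integral_prod_left (UU_int d hd) fun y => (KT_unif d hd hT y).2.2
  have e4 : (1 / (n:ℝ)) * ∑ i, (UU d (x i) - cq d / (T * vB d)) ≤ IT d T (empMeas d n x) (uniformBall d 0) := by
    rw [e2]
    gcongr with i _
    exact (KT_unif d hd hT (x i)).2.1
  have e5 : (1 / (n:ℝ) ^ 2) * ∑ q ∈ Finset.univ.filter (fun q : Fin n × Fin n => q.1 ≠ q.2), KT d T (x q.1 - x q.2)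
      = IT d T (empMeas d n x) (empMeas d n x) - KT d T 0 / n := by
    have h1 : ∑ q : Fin n × Fin n, KT d T (x q.1 - x q.2) = ∑ i, ∑ j, KT d T (x i - x j) :=
      Fintype.sum_prod_type _
    have h2 := Finset.sum_filter_add_sum_filter_not (Finset.univ : Finset (Fin n × Fin n))
      (fun q => q.1 ≠ q.2) (fun q => KT d T (x q.1 - x q.2))
    have h3 : ∑ q ∈ Finset.univ.filter (fun q : Fin n × Fin n => ¬ q.1 ≠ q.2), KT d T (x q.1 - x q.2) = n * KT d T 0 := by
      have : ∀ q ∈ Finset.univ.filter (fun q : Fin n × Fin n => ¬ q.1 ≠ q.2),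
          KT d T (x q.1 - x q.2) = KT d T 0 := by
        intro q hq
        have : q.1 = q.2 := by simpa using hq
        rw [this, sub_self]
      rw [Finset.sum_congr rfl this, Finset.sum_const, nsmul_eq_mul]
      congr 2
      have : Finset.univ.filter (fun q : Fin n × Fin n => ¬ q.1 ≠ q.2) =
          Finset.univ.image (fun i : Fin n => (i, i)) := by
        ext ⟨a, b⟩; simp [eq_comm]
      rw [this, Finset.card_image_of_injective _ (fun a b h => by simpa using h)]
      simp
    rw [e1, ← Finset.mul_sum, ← h1, ← h2, h3]
    field_simp
    ring
  have e6 : (1 / (n:ℝ) ^ 2) * ∑ q ∈ Finset.univ.filter (fun q : Fin n × Fin n => q.1 ≠ q.2), KT d T (x q.1 - x q.2)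
      ≤ (1 / (n:ℝ) ^ 2) * ∑ q ∈ Finset.univ.filter (fun q : Fin n × Fin n => q.1 ≠ q.2), coulombKR d (x q.1 - x q.2) := by
    gcongr with q hq
    have hq : q.1 ≠ q.2 := by simpa using hq
    rw [coulomb_split d hd hT _ (hx _ _ hq)]
    linarith [qT_nonneg d hd hT (x q.1 - x q.2)]
  have e7 : (1 / (n:ℝ)) * ∑ i, zet d (x i) = (1 / (n:ℝ)) * ∑ i, ‖x i‖ ^ 2
      + 2 * ((1 / (n:ℝ)) * ∑ i, UU d (x i)) - 2 * UU d 0 := by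
    unfold zet
    rw [Finset.sum_sub_distrib, Finset.sum_add_distrib, ← Finset.mul_sum]
    simp
    field_simp
  have e8 : (1 / (n:ℝ)) * ∑ i, (UU d (x i) - cq d / (T * vB d)) =
      (1 / (n:ℝ)) * ∑ i, UU d (x i) - cq d / (T * vB d) := by
    rw [Finset.sum_sub_distrib]
    simp
    field_simp
  unfold hamiltonian
  rw [e8] at e4
  rw [e7]
  unfold DT Est
  linarith

lemma jensen_exp {α : Type*} [MeasurableSpace α] (P : Measure α) [IsProbabilityMeasure P] (u : α → ℝ)
    (hu : Integrable u P) :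
    ENNReal.ofReal (Real.exp (∫ x, u x ∂P)) ≤ ∫⁻ x, ENNReal.ofReal (Real.exp (u x)) ∂P := by
  set m := ∫ x, u x ∂P with hm
  have hi : Integrable (fun x => Real.exp m * (1 + (u x - m))) P :=
    ((integrable_const (1:ℝ)).add (hu.sub (integrable_const m))).const_mul _
  have h1 : ∫ x, Real.exp m * (1 + (u x - m)) ∂P = Real.exp m := by
    rw [integral_const_mul, integral_add (g := fun x => u x - m) (integrable_const (1:ℝ)) (hu.sub (integrable_const m)),
      integral_sub hu (integrable_const m), ← hm]
    simp
  calc ENNReal.ofReal (Real.exp m) = ENNReal.ofReal (∫ x, Real.exp m * (1 + (u x - m)) ∂P) := by rw [h1]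
    _ ≤ ∫⁻ x, ENNReal.ofReal (Real.exp m * (1 + (u x - m))) ∂P := by
        rw [integral_eq_lintegral_pos_part_sub_lintegral_neg_part hi]
        refine (ENNReal.ofReal_le_ofReal (sub_le_self _ ENNReal.toReal_nonneg)).trans ?_
        exact ENNReal.ofReal_toReal_le
    _ ≤ ∫⁻ x, ENNReal.ofReal (Real.exp (u x)) ∂P := by
        refine lintegral_mono fun x => ENNReal.ofReal_le_ofReal ?_
        have := Real.add_one_le_exp (u x - m)
        calc Real.exp m * (1 + (u x - m)) ≤ Real.exp m * Real.exp (u x - m) := by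
              gcongr; linarith
          _ = Real.exp (u x) := by rw [← Real.exp_add]; congr 1; ring

abbrev HH (d n : ℕ) (x : Fin n → Euc d) : ℝ := hamiltonian d n (fun y => ‖y‖ ^ 2) x
abbrev vv (d n : ℕ) : Measure (Fin n → Euc d) := Measure.pi fun _ => volume
def EE (d n : ℕ) (b : ℝ) (x : Fin n → Euc d) : ℝ≥0∞ := ENNReal.ofReal (Real.exp (-b * HH d n x))
def ZZ (d n : ℕ) (b : ℝ) : ℝ≥0∞ := ∫⁻ x, EE d n b x ∂(vv d n)
abbrev mm (d n : ℕ) : Measure (Fin n → Euc d) := Measure.pi fun _ => uniformBall d 0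

lemma HH_meas (d n : ℕ) : Measurable (HH d n) := by
  unfold HH hamiltonian
  have := g_meas d
  refine Measurable.add (by fun_prop) (Measurable.const_mul ?_ _)
  exact Finset.measurable_sum _ fun q _ => this.comp (by fun_prop)

lemma EE_meas (d n : ℕ) (b : ℝ) : Measurable (EE d n b) := by
  unfold EE
  have := HH_meas d n
  fun_prop

lemma mm_le (d n : ℕ) : ENNReal.ofReal (vB d ^ n) • mm d n ≤ vv d n := by
  have hu := uniformBall_prob d
  have hv := vB_pos d
  have h : mm d n = ENNReal.ofReal ((vB d)⁻¹ ^ n) • (vv d n).restrict (Set.univ.pi fun _ => closedBall 0 1) := by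
    refine Measure.pi_eq fun s hs => ?_
    rw [Measure.restrict_pi_pi, Measure.smul_apply, Measure.pi_pi, ENNReal.ofReal_pow (by positivity),
      smul_eq_mul]
    have : ∀ i, uniformBall d 0 (s i) = ENNReal.ofReal (vB d)⁻¹ * (volume.restrict (closedBall (0 : Euc d) 1)) (s i) := by
      intro i
      unfold uniformBall
      rw [Measure.smul_apply, vB_ofReal, ENNReal.ofReal_inv_of_pos hv, smul_eq_mul]
    simp_rw [this]
    rw [Finset.prod_mul_distrib]
    simp
  rw [h, smul_smul, ← ENNReal.ofReal_mul (by positivity), ← mul_pow, mul_inv_cancel₀ hv.ne']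
  simp only [one_pow, ENNReal.ofReal_one, one_smul]
  exact Measure.restrict_le_self

lemma mm_pair (d n : ℕ) (i j : Fin n) (hij : i ≠ j) :
    MeasurePreserving (fun x : Fin n → Euc d => (x i, x j)) (mm d n) ((uniformBall d 0).prod (uniformBall d 0)) := by
  have hu := uniformBall_prob d
  refine ⟨by fun_prop, ?_⟩
  have h := ProbabilityTheory.iIndepFun_pi (μ := fun _ : Fin n => uniformBall d 0)
    (X := fun _ => (id : Euc d → Euc d)) (fun _ => aemeasurable_id)
  have h2 : ProbabilityTheory.IndepFun (fun x : Fin n → Euc d => x i) (fun x : Fin n → Euc d => x j) (mm d n) :=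
    h.indepFun hij
  rw [ProbabilityTheory.indepFun_iff_map_prod_eq_prod_map_map (measurable_pi_apply i).aemeasurable
    (measurable_pi_apply j).aemeasurable] at h2
  have e : ∀ k : Fin n, Measure.map (fun x : Fin n → Euc d => x k) (mm d n) = uniformBall d 0 :=
    fun k => (measurePreserving_eval (fun _ : Fin n => uniformBall d 0) k).map_eq
  rw [e, e] at h2
  exact h2

lemma HH_int (d n : ℕ) (hd : 2 ≤ d) (hn : 1 ≤ n) : Integrable (HH d n) (mm d n) ∧
    ∫ x, HH d n x ∂(mm d n) = Est d - JJ d / n := by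
  have hu := uniformBall_prob d
  have hn0 : (0:ℝ) < n := by exact_mod_cast hn
  have h1 : ∀ i : Fin n, Integrable (fun x : Fin n → Euc d => ‖x i‖ ^ 2) (mm d n) ∧
      ∫ x, ‖x i‖ ^ 2 ∂(mm d n) = ∫ y, ‖y‖ ^ 2 ∂(uniformBall d 0) := by
    intro i
    have hmp := measurePreserving_eval (fun _ : Fin n => uniformBall d 0) i
    constructor
    · exact hmp.integrable_comp_of_integrable (nsq_int d)
    · rw [← hmp.map_eq, integral_map hmp.aemeasurable (by fun_prop)]
  have h2 : ∀ i j : Fin n, i ≠ j → Integrable (fun x : Fin n → Euc d => coulombKR d (x i - x j)) (mm d n) ∧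
      ∫ x, coulombKR d (x i - x j) ∂(mm d n) = JJ d := by
    intro i j hij
    have hmp := mm_pair d n i j hij
    constructor
    · exact hmp.integrable_comp_of_integrable (g_unif_prod d hd)
    · unfold JJ
      rw [← hmp.map_eq, integral_map hmp.aemeasurable]
      exact ((g_meas d).comp (measurable_fst.sub measurable_snd)).aestronglyMeasurable
  have i1 : Integrable (fun x : Fin n → Euc d => (1 / (n : ℝ)) * ∑ i, ‖x i‖ ^ 2) (mm d n) :=
    (integrable_finset_sum _ fun i _ => (h1 i).1).const_mul _
  have i2 : Integrable (fun x : Fin n → Euc d => (1 / (n : ℝ) ^ 2) *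
        ∑ q ∈ Finset.univ.filter (fun q : Fin n × Fin n => q.1 ≠ q.2), coulombKR d (x q.1 - x q.2)) (mm d n) :=
    (integrable_finset_sum _ fun q hq => (h2 q.1 q.2 (by simpa using hq)).1).const_mul _
  refine ⟨i1.add i2, ?_⟩
  unfold HH hamiltonian
  rw [integral_add i1 i2, integral_const_mul, integral_const_mul,
    integral_finset_sum _ (fun i _ => (h1 i).1),
    integral_finset_sum _ (fun q hq => (h2 q.1 q.2 (by simpa using hq)).1)]
  have s1 : ∑ i : Fin n, ∫ x, ‖x i‖ ^ 2 ∂(mm d n) = ∑ i : Fin n, ∫ y, ‖y‖ ^ 2 ∂(uniformBall d 0) :=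
    Finset.sum_congr rfl (fun i _ => (h1 i).2)
  have s2 : ∑ q ∈ Finset.univ.filter (fun q : Fin n × Fin n => q.1 ≠ q.2), ∫ x, coulombKR d (x q.1 - x q.2) ∂(mm d n)
      = ∑ q ∈ Finset.univ.filter (fun q : Fin n × Fin n => q.1 ≠ q.2), JJ d :=
    Finset.sum_congr rfl (fun q hq => (h2 q.1 q.2 (by simpa using hq)).2)
  rw [s1, s2]
  rw [Finset.sum_const, Finset.sum_const]
  have hc : ((Finset.univ.filter (fun q : Fin n × Fin n => q.1 ≠ q.2)).card : ℝ) = n ^ 2 - n := by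
    have := Finset.card_filter_add_card_filter_not (s := (Finset.univ : Finset (Fin n × Fin n))) (fun q => q.1 ≠ q.2)
    have h3 : Finset.univ.filter (fun q : Fin n × Fin n => ¬ q.1 ≠ q.2) =
          Finset.univ.image (fun i : Fin n => (i, i)) := by
        ext ⟨a, b⟩; simp [eq_comm]
    rw [h3, Finset.card_image_of_injective _ (fun a b h => by simpa using h)] at this
    have h4 : ((Finset.univ.filter (fun q : Fin n × Fin n => q.1 ≠ q.2)).card : ℝ) + n = n * n := by
      simp only [Finset.card_univ, Fintype.card_fin, Fintype.card_prod] at this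
      exact_mod_cast this
    linarith
  rw [nsmul_eq_mul, nsmul_eq_mul, hc, ← Est_eq d hd]
  simp only [Finset.card_univ, Fintype.card_fin]
  field_simp
  ring

lemma ZZ_lower (d n : ℕ) (hd : 2 ≤ d) (hn : 1 ≤ n) {b : ℝ} (hb : 0 ≤ b) :
    ENNReal.ofReal (vB d ^ n * Real.exp (-b * (Est d + |JJ d| / n))) ≤ ZZ d n b := by
  have hu := uniformBall_prob d
  have hv := vB_pos d
  have hH := HH_int d n hd hn
  have hn0 : (0:ℝ) < n := by exact_mod_cast hn
  have h1 := jensen_exp (mm d n) (fun x => -b * HH d n x) (hH.1.const_mul _)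
  rw [integral_const_mul, hH.2] at h1
  calc ENNReal.ofReal (vB d ^ n * Real.exp (-b * (Est d + |JJ d| / n)))
      ≤ ENNReal.ofReal (vB d ^ n) * ENNReal.ofReal (Real.exp (-b * (Est d - JJ d / n))) := by
        rw [← ENNReal.ofReal_mul (by positivity)]
        apply ENNReal.ofReal_le_ofReal
        gcongr ?_ * Real.exp ?_
        have : -(JJ d) / n ≤ |JJ d| / n := by gcongr; exact neg_le_abs _
        have h3 : Est d - JJ d / n ≤ Est d + |JJ d| / n := by rw [neg_div] at this; linarith
        nlinarith
    _ ≤ ENNReal.ofReal (vB d ^ n) * ∫⁻ x, EE d n b x ∂(mm d n) := mul_le_mul_right h1 _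
    _ = ∫⁻ x, EE d n b x ∂(ENNReal.ofReal (vB d ^ n) • mm d n) := by
        rw [lintegral_smul_measure]; rfl
    _ ≤ ZZ d n b := lintegral_mono' (mm_le d n) le_rfl

lemma gibbs_apply (d n : ℕ) (b : ℝ) (V : Euc d → ℝ) (hV : ∀ x, V x = ‖x‖ ^ 2) (S : Set (Fin n → Euc d)) :
    gibbs d n b V S = (ZZ d n b)⁻¹ * ∫⁻ x in S, EE d n b x ∂(vv d n) := by
  have : V = fun x => ‖x‖ ^ 2 := funext hV
  subst this
  unfold gibbs
  rw [Measure.smul_apply, withDensity_apply']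
  rfl

lemma gibbs_le_one (d n : ℕ) (b : ℝ) (V : Euc d → ℝ) (hV : ∀ x, V x = ‖x‖ ^ 2) (S : Set (Fin n → Euc d)) :
    gibbs d n b V S ≤ 1 := by
  rw [gibbs_apply d n b V hV]
  refine (mul_le_mul_right (setLIntegral_le_lintegral S _) _).trans ?_
  exact ENNReal.inv_mul_le_one _

lemma distinct_ae (d n : ℕ) (hd : 2 ≤ d) : ∀ᵐ x ∂(vv d n), ∀ i j, i ≠ j → x i - x j ≠ 0 := by
  have := nontriv d hd
  rw [ae_all_iff]; intro i
  rw [ae_all_iff]; intro j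
  by_cases hij : i = j
  · simp [hij]
  simp only [ne_eq, hij, not_false_eq_true, forall_true_left]
  rw [ae_iff]
  let L : (Fin n → Euc d) →ₗ[ℝ] Euc d := LinearMap.proj (R := ℝ) (φ := fun _ : Fin n => Euc d) i - LinearMap.proj j
  have hne : LinearMap.ker L ≠ ⊤ := by
    intro h
    obtain ⟨v, hv⟩ := exists_ne (0 : Euc d)
    have : Pi.single i v ∈ LinearMap.ker L := by rw [h]; trivial
    rw [LinearMap.mem_ker] at this
    simp [L, Pi.single_eq_of_ne (Ne.symm hij)] at this
    exact hv this
  have h := Measure.addHaar_submodule (vv d n) (LinearMap.ker L) hne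
  refine measure_mono_null ?_ h
  intro x hx
  have hx : x i - x j = 0 := by simpa using hx
  exact LinearMap.mem_ker.2 hx

def G1 (d : ℕ) : ℝ := ∫ x : Euc d, Real.exp (-1 * ‖x‖ ^ 2)

lemma G1_nonneg (d : ℕ) : 0 ≤ G1 d := integral_nonneg fun x => Real.exp_nonneg _

lemma prod_gauss (d n : ℕ) :
    ∫⁻ x, ENNReal.ofReal (Real.exp (-∑ i, ‖x i‖ ^ 2)) ∂(vv d n) = ENNReal.ofReal (G1 d ^ n) := by
  have e : ∀ x : Fin n → Euc d, Real.exp (-∑ i, ‖x i‖ ^ 2) = ∏ i, Real.exp (-1 * ‖x i‖ ^ 2) := by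
    intro x
    rw [← Real.exp_sum, ← Finset.mul_sum]; simp
  simp_rw [e]
  rw [← ofReal_integral_eq_lintegral_ofReal]
  · rw [integral_fintype_prod_eq_pow (fun y : Euc d => Real.exp (-1 * ‖y‖ ^ 2))]
    simp [G1]
  · exact Integrable.fintype_prod (f := fun (_ : Fin n) (y : Euc d) => Real.exp (-1 * ‖y‖ ^ 2))
      fun i => gauss_integrable d one_pos
  · exact ae_of_all _ fun x => Finset.prod_nonneg fun i _ => Real.exp_nonneg _

lemma A_fixed (d n : ℕ) (hd : 2 ≤ d) (hn : 1 ≤ n) {b T η θ : ℝ} (hb : 0 < b) (hT : 0 < T)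
    (hθ : 0 ≤ θ) (hθ1 : θ ≤ 1) (hbθ : 1 ≤ b * θ / (2 * n)) (S : Set (Fin n → Euc d))
    (hS : ∀ x ∈ S, η ≤ DT d T (empMeas d n x) (uniformBall d 0)) :
    ∫⁻ x in S, EE d n b x ∂(vv d n) ≤
      ENNReal.ofReal (Real.exp (-b * (η + Est d - 2 * (cq d / (T * vB d)) - |KT d T 0| / n - θ * C1 d)) * G1 d ^ n) := by
  have hn0 : (0:ℝ) < n := by exact_mod_cast hn
  set A := -b * (η + Est d - 2 * (cq d / (T * vB d)) - |KT d T 0| / n - θ * C1 d) with hA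
  set S' := {x : Fin n → Euc d | EE d n b x ≤ ENNReal.ofReal (Real.exp A) * ENNReal.ofReal (Real.exp (-∑ i, ‖x i‖ ^ 2))} with hS'
  have hS'm : MeasurableSet S' := by
    have h : Measurable fun x : Fin n → Euc d => ENNReal.ofReal (Real.exp A) * ENNReal.ofReal (Real.exp (-∑ i, ‖x i‖ ^ 2)) := by
      fun_prop
    exact measurableSet_le (EE_meas d n b) h
  have hsub : ∀ᵐ x ∂(vv d n), x ∈ S → x ∈ S' := by
    filter_upwards [distinct_ae d n hd] with x hx hxS
    simp only [hS', Set.mem_setOf_eq]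
    rw [← ENNReal.ofReal_mul (Real.exp_nonneg _), ← Real.exp_add]
    unfold EE
    apply ENNReal.ofReal_le_ofReal
    apply Real.exp_le_exp.2
    have h1 := energy_lower d n hd hn hT x hx
    have h2 := hS x hxS
    have h3 : θ / (2 * n) * ∑ i, ‖x i‖ ^ 2 - θ * C1 d ≤ (1 / (n:ℝ)) * ∑ i, zet d (x i) := by
      have : ∑ i, (θ * (‖x i‖ ^ 2 / 2 - C1 d)) ≤ ∑ i, zet d (x i) := by
        refine Finset.sum_le_sum fun i _ => ?_
        have h4 := zet_growth d hd (x i)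
        have h5 := zet_nonneg d hd (x i)
        calc θ * (‖x i‖ ^ 2 / 2 - C1 d) ≤ θ * zet d (x i) := by gcongr
          _ ≤ zet d (x i) := by nlinarith
      calc θ / (2 * n) * ∑ i, ‖x i‖ ^ 2 - θ * C1 d = (1 / (n:ℝ)) * ∑ i, (θ * (‖x i‖ ^ 2 / 2 - C1 d)) := by
            rw [← Finset.mul_sum, Finset.sum_sub_distrib, ← Finset.sum_div]
            simp
            field_simp
        _ ≤ _ := by gcongr
    have h6 : KT d T 0 / n ≤ |KT d T 0| / n := by gcongr; exact le_abs_self _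
    have h7 : η + Est d - 2 * (cq d / (T * vB d)) - |KT d T 0| / n - θ * C1 d + θ / (2 * n) * ∑ i, ‖x i‖ ^ 2
        ≤ HH d n x := by
      unfold HH; linarith
    have h8 : ∑ i, ‖x i‖ ^ 2 ≤ b * (θ / (2 * n) * ∑ i, ‖x i‖ ^ 2) := by
      have : 0 ≤ ∑ i, ‖x i‖ ^ 2 := Finset.sum_nonneg fun i _ => by positivity
      calc ∑ i, ‖x i‖ ^ 2 ≤ (b * θ / (2 * n)) * ∑ i, ‖x i‖ ^ 2 := le_mul_of_one_le_left this hbθ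
        _ = _ := by ring
    have h9 := mul_le_mul_of_nonneg_left h7 hb.le
    rw [hA]
    linarith
  calc ∫⁻ x in S, EE d n b x ∂(vv d n)
      ≤ ∫⁻ x in S', EE d n b x ∂(vv d n) := lintegral_mono_set' hsub
    _ ≤ ∫⁻ x in S', ENNReal.ofReal (Real.exp A) * ENNReal.ofReal (Real.exp (-∑ i, ‖x i‖ ^ 2)) ∂(vv d n) :=
        setLIntegral_mono' hS'm fun x hx => hx
    _ ≤ ENNReal.ofReal (Real.exp A) * ∫⁻ x, ENNReal.ofReal (Real.exp (-∑ i, ‖x i‖ ^ 2)) ∂(vv d n) := by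
        rw [lintegral_const_mul' _ _ ENNReal.ofReal_ne_top]
        exact mul_le_mul_right (setLIntegral_le_lintegral _ _) _
    _ = _ := by rw [prod_gauss, ← ENNReal.ofReal_mul (Real.exp_nonneg _)]

lemma A_event (d : ℕ) (hd : 2 ≤ d) (V : Euc d → ℝ) (hV : ∀ x, V x = ‖x‖ ^ 2)
    (β : ℕ → ℝ) (hβpos : ∀ n, 0 < β n) (hβ : Tendsto (fun n => β n / n) atTop atTop)
    {η T : ℝ} (hη : 0 < η) (hT : 0 < T) (hTη : 2 * (cq d / (T * vB d)) ≤ η / 8) :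
    ∀ᶠ n in atTop, ∀ S : Set (Fin n → Euc d), (∀ x ∈ S, η ≤ DT d T (empMeas d n x) (uniformBall d 0)) →
      gibbs d n (β n) V S ≤ ENNReal.ofReal (Real.exp (-n)) := by
  have hv := vB_pos d
  have hC1 : 0 < C1 d := by unfold C1; positivity
  set θ := min 1 (η / (8 * C1 d)) with hθ
  have hθ0 : 0 < θ := lt_min one_pos (by positivity)
  have hθ1 : θ ≤ 1 := min_le_left _ _
  have hθC : θ * C1 d ≤ η / 8 := by
    have : θ ≤ η / (8 * C1 d) := min_le_right _ _
    calc θ * C1 d ≤ η / (8 * C1 d) * C1 d := by gcongr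
      _ = η / 8 := by field_simp
  set K := G1 d / vB d with hK
  have hK0 : 0 ≤ K := div_nonneg (G1_nonneg d) hv.le
  have hlim : Tendsto (fun n : ℕ => (|KT d T 0| + |JJ d|) / (n:ℝ)) atTop (𝓝 0) :=
    tendsto_const_div_atTop_nhds_zero_nat _
  filter_upwards [eventually_ge_atTop 1, hβ.eventually_ge_atTop (2 / θ),
    hβ.eventually_ge_atTop ((1 + K) / (5 * η / 8)),
    hlim.eventually (gt_mem_nhds (show (0:ℝ) < η / 8 by positivity))] with n hn h1 h2 h3 S hS
  have hn0 : (0:ℝ) < n := by exact_mod_cast hn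
  have hb := hβpos n
  set b := β n
  have hbθ : 1 ≤ b * θ / (2 * n) := by
    rw [le_div_iff₀ (by positivity)]
    rw [div_le_div_iff₀ hθ0 hn0] at h1
    linarith
  have hb2 : (1 + K) * n ≤ b * (5 * η / 8) := by
    rw [div_le_div_iff₀ (by positivity) hn0] at h2
    linarith
  have hA := A_fixed d n hd hn hb hT hθ0.le hθ1 hbθ S hS
  have hZ := ZZ_lower d n hd hn hb.le
  rw [gibbs_apply d n b V hV]
  set L := vB d ^ n * Real.exp (-b * (Est d + |JJ d| / n)) with hL
  have hL0 : 0 < L := by positivity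
  calc _ ≤ (ENNReal.ofReal L)⁻¹ * ENNReal.ofReal (Real.exp (-b * (η + Est d - 2 * (cq d / (T * vB d)) - |KT d T 0| / n - θ * C1 d)) * G1 d ^ n) :=
        mul_le_mul' (ENNReal.inv_le_inv.2 hZ) hA
    _ = ENNReal.ofReal (L⁻¹ * (Real.exp (-b * (η + Est d - 2 * (cq d / (T * vB d)) - |KT d T 0| / n - θ * C1 d)) * G1 d ^ n)) := by
        rw [← ENNReal.ofReal_inv_of_pos hL0, ← ENNReal.ofReal_mul (by positivity)]
    _ ≤ _ := by
        apply ENNReal.ofReal_le_ofReal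
        have e : L⁻¹ * (Real.exp (-b * (η + Est d - 2 * (cq d / (T * vB d)) - |KT d T 0| / n - θ * C1 d)) * G1 d ^ n)
            = Real.exp (-b * (η + Est d - 2 * (cq d / (T * vB d)) - |KT d T 0| / n - θ * C1 d)
              - -b * (Est d + |JJ d| / n)) * K ^ n := by
          rw [hL, hK, Real.exp_sub, div_pow]
          field_simp
        rw [e]
        have hKn : K ^ n ≤ Real.exp (n * K) := by
          rw [Real.exp_nat_mul]
          gcongr
          linarith [Real.add_one_le_exp K]
        calc _ ≤ Real.exp (-b * (5 * η / 8)) * Real.exp (n * K) := by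
              gcongr
              rw [add_div] at h3
              have : 5 * η / 8 ≤ η - 2 * (cq d / (T * vB d)) - |KT d T 0| / n - |JJ d| / n - θ * C1 d := by linarith
              nlinarith
          _ = Real.exp (-b * (5 * η / 8) + n * K) := by rw [Real.exp_add]
          _ ≤ Real.exp (-n) := by
              apply Real.exp_le_exp.2; nlinarith

lemma g_diff (d : ℕ) (hd : 2 ≤ d) (x y y' : Euc d) (hy' : ‖y'‖ ≤ 1) :
    -(‖x‖ + 1 + kk d (y' - y)) ≤ coulombKR d (x - y) - coulombKR d (y' - y) := by
  have hk := kk_nonneg d (y' - y)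
  rcases eq_or_ne y' y with h | h
  · subst h
    have h1 := g_lower d hd (x - y')
    have h2 := norm_sub_le x y'
    have h3 : coulombKR d (y' - y') = 0 := by
      rw [sub_self]; unfold coulombKR
      split_ifs with h
      · simp
      · have : d - 2 ≠ 0 := by omega
        simp [this]
    linarith
  have hr : 0 < ‖y' - y‖ := norm_pos_iff.2 (sub_ne_zero.2 h)
  rcases eq_or_ne x y with hxy | hxy
  · subst hxy
    have h1 := g_lower d hd (x - x)
    rw [sub_self, norm_zero] at h1
    have h2 := (abs_le.1 (g_abs d hd (y' - x))).2
    have h3 := norm_sub_le y' x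
    rw [sub_self]; linarith
  have hxr : 0 < ‖x - y‖ := norm_pos_iff.2 (sub_ne_zero.2 hxy)
  have hx0 := norm_nonneg x
  by_cases hd2 : d = 2
  · subst hd2
    unfold coulombKR
    simp only [if_true, one_div, Real.log_inv]
    have hkk : kk 2 (y' - y) = ‖y' - y‖⁻¹ := by simp [kk]
    have h1 : ‖x - y‖ ≤ (1 + (‖x‖ + 1)) * (‖y' - y‖ * Real.exp (kk 2 (y' - y))) := by
      have h2 : ‖x - y‖ ≤ ‖x‖ + 1 + ‖y' - y‖ := by
        have : x - y = (x - y') + (y' - y) := by abel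
        rw [this]
        have := norm_add_le (x - y') (y' - y)
        have := norm_sub_le x y'
        linarith
      have h3 : ‖y' - y‖ ≤ ‖y' - y‖ * Real.exp (kk 2 (y' - y)) :=
        le_mul_of_one_le_right hr.le (Real.one_le_exp hk)
      have h4 : 1 ≤ ‖y' - y‖ * Real.exp (kk 2 (y' - y)) := by
        have := Real.add_one_le_exp (kk 2 (y' - y))
        calc 1 = ‖y' - y‖ * kk 2 (y' - y) := by rw [hkk]; field_simp
          _ ≤ _ := by gcongr; linarith
      nlinarith
    have h5 := Real.log_le_log hxr h1
    rw [Real.log_mul (by positivity) (by positivity), Real.log_mul hr.ne' (by positivity), Real.log_exp] at h5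
    have h6 := Real.log_le_sub_one_of_pos (show 0 < 1 + (‖x‖ + 1) by positivity)
    linarith
  · have hd3 : 3 ≤ d := by omega
    have hdr : (1:ℝ) ≤ (d:ℝ) - 2 := by
      have : (3:ℝ) ≤ d := by exact_mod_cast hd3
      linarith
    unfold coulombKR
    simp only [hd2, if_false]
    have h1 : 0 ≤ 1 / (((d:ℝ) - 2) * ‖x - y‖ ^ (d - 2)) := by positivity
    have h2 : 1 / (((d:ℝ) - 2) * ‖y' - y‖ ^ (d - 2)) ≤ 1 + kk d (y' - y) := by
      calc 1 / (((d:ℝ) - 2) * ‖y' - y‖ ^ (d - 2)) ≤ 1 / (1 * ‖y' - y‖ ^ (d - 2)) := by gcongr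
        _ = (‖y' - y‖ ^ (d - 2))⁻¹ := by simp
        _ ≤ 1 + kk d (y' - y) := by
          rcases le_total 1 ‖y' - y‖ with h | h
          · have : (‖y' - y‖ ^ (d - 2))⁻¹ ≤ 1 := inv_le_one_of_one_le₀ (one_le_pow₀ h)
            linarith
          · have : (‖y' - y‖ ^ (d - 2))⁻¹ ≤ kk d (y' - y) := by
              unfold kk
              gcongr ?_⁻¹
              exact pow_le_pow_of_le_one hr.le h (by omega)
            linarith
    linarith

lemma HH_diff (d n : ℕ) (hd : 2 ≤ d) (hn : 1 ≤ n) (x : Fin n → Euc d) (i : Fin n) (u u' : Euc d) (hu' : ‖u'‖ ≤ 1) :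
    (1 / (n:ℝ)) * (‖u‖ ^ 2 - 2 * ‖u‖ - 3) - (2 / (n:ℝ) ^ 2) * ∑ j, kk d (u' - x j) ≤
      HH d n (Function.update x i u) - HH d n (Function.update x i u') := by
  have hn0 : (0:ℝ) < n := by exact_mod_cast hn
  unfold HH hamiltonian
  set c : Fin n → ℝ := fun j => ‖u‖ + 1 + kk d (u' - x j) with hc
  have hc0 : ∀ j, 0 ≤ c j := fun j => by have := kk_nonneg d (u' - x j); positivity
  have h1 : ∑ j, ‖Function.update x i u j‖ ^ 2 - ∑ j, ‖Function.update x i u' j‖ ^ 2 = ‖u‖ ^ 2 - ‖u'‖ ^ 2 := by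
    rw [← Finset.sum_sub_distrib, Finset.sum_eq_single i]
    · simp
    · intro j _ hj; simp [Function.update_of_ne hj]
    · simp
  set P := Finset.univ.filter (fun q : Fin n × Fin n => q.1 ≠ q.2) with hP
  have h2 : -(2 * ∑ j, c j) ≤ ∑ q ∈ P, coulombKR d (Function.update x i u q.1 - Function.update x i u q.2)
      - ∑ q ∈ P, coulombKR d (Function.update x i u' q.1 - Function.update x i u' q.2) := by
    rw [← Finset.sum_sub_distrib]
    set e : Fin n × Fin n → ℝ := fun q => (if q.1 = i then c q.2 else 0) + (if q.2 = i then c q.1 else 0) with he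
    have he0 : ∀ q, 0 ≤ e q := by
      intro q; simp only [he]
      have := hc0 q.1; have := hc0 q.2
      split_ifs <;> linarith
    have h3 : ∑ q ∈ P, e q ≤ 2 * ∑ j, c j := by
      calc ∑ q ∈ P, e q ≤ ∑ q : Fin n × Fin n, e q :=
            Finset.sum_le_sum_of_subset_of_nonneg (Finset.subset_univ _) fun q _ _ => he0 q
        _ = 2 * ∑ j, c j := by
            simp only [he]
            rw [Finset.sum_add_distrib, Fintype.sum_prod_type, Fintype.sum_prod_type]
            simp only [Finset.sum_ite_eq', Finset.mem_univ, if_true]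
            rw [Finset.sum_comm]
            simp [two_mul]
    have h4 : ∑ q ∈ P, -(e q) ≤ ∑ q ∈ P, (coulombKR d (Function.update x i u q.1 - Function.update x i u q.2)
      - coulombKR d (Function.update x i u' q.1 - Function.update x i u' q.2)) := by
      refine Finset.sum_le_sum fun q hq => ?_
      have hq : q.1 ≠ q.2 := by simpa [hP] using hq
      simp only [he]
      by_cases a1 : q.1 = i
      · have a2 : q.2 ≠ i := fun h => hq (a1.trans h.symm)
        rw [if_pos a1, if_neg a2, a1, Function.update_self, Function.update_self,
          Function.update_of_ne a2, Function.update_of_ne a2, add_zero]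
        exact g_diff d hd u (x q.2) u' hu'
      · by_cases a2 : q.2 = i
        · rw [if_neg a1, if_pos a2, a2, Function.update_self, Function.update_self,
            Function.update_of_ne a1, Function.update_of_ne a1, zero_add,
            ← g_neg, neg_sub, ← g_neg d (x q.1 - u'), neg_sub]
          exact g_diff d hd u (x q.1) u' hu'
        · rw [if_neg a1, if_neg a2, Function.update_of_ne a1, Function.update_of_ne a1,
            Function.update_of_ne a2, Function.update_of_ne a2]
          simp
    rw [Finset.sum_neg_distrib] at h4
    linarith
  have h5 : ∑ j, c j = n * (‖u‖ + 1) + ∑ j, kk d (u' - x j) := by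
    simp only [hc]
    rw [Finset.sum_add_distrib]; simp; ring
  have h6 : ‖u'‖ ^ 2 ≤ 1 := by nlinarith [norm_nonneg u']
  have h7 : (1 / (n:ℝ) ^ 2) * (-(2 * ∑ j, c j)) ≤ (1 / (n:ℝ) ^ 2) * (∑ q ∈ P, coulombKR d (Function.update x i u q.1 - Function.update x i u q.2)
      - ∑ q ∈ P, coulombKR d (Function.update x i u' q.1 - Function.update x i u' q.2)) := by gcongr
  have h8 : (1 / (n:ℝ)) * (‖u‖ ^ 2 - 1) ≤ (1 / (n:ℝ)) * (∑ j, ‖Function.update x i u j‖ ^ 2 - ∑ j, ‖Function.update x i u' j‖ ^ 2) := by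
    rw [h1]; gcongr
  have h9 : (1 / (n:ℝ)) * (‖u‖ ^ 2 - 2 * ‖u‖ - 3) - (2 / (n:ℝ) ^ 2) * ∑ j, kk d (u' - x j)
     = (1 / (n:ℝ)) * (‖u‖ ^ 2 - 1) + (1 / (n:ℝ) ^ 2) * (-(2 * ∑ j, c j)) := by
    rw [h5]; field_simp; ring
  rw [h9]
  linarith

def R0 (d : ℕ) : ℝ := 6 + 2 * C0 d

lemma one_particle (d n : ℕ) (hd : 2 ≤ d) (hn : 1 ≤ n) {b : ℝ} (hb : 0 ≤ b) (x : Fin n → Euc d) (i : Fin n)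
    (u : Euc d) (hu : R0 d ≤ ‖u‖) :
    EE d n b (Function.update x i u) ≤ ENNReal.ofReal ((vB d)⁻¹ * Real.exp (-(b / (2 * n)) * ‖u‖ ^ 2)) *
      ∫⁻ u', EE d n b (Function.update x i u') := by
  have hn0 : (0:ℝ) < n := by exact_mod_cast hn
  have hv := vB_pos d
  have hpm := uniformBall_prob d
  have hC0 := C0_ge d
  set h : Euc d → ℝ := fun u' => (b / n) * (‖u‖ ^ 2 - 2 * ‖u‖ - 3) - (2 * b / (n:ℝ) ^ 2) * ∑ j, kk d (u' - x j) with hh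
  have hki : ∀ j, Integrable (fun u' => kk d (u' - x j)) (uniformBall d 0) ∧
      ∫ u', kk d (u' - x j) ∂(uniformBall d 0) ≤ C0 d := by
    intro j
    have := kk_unif d hd (x j)
    have e : (fun y => kk d (x j - y)) = fun y => kk d (y - x j) := by
      ext y; rw [← kk_neg, neg_sub]
    rwa [e] at this
  have hint : Integrable h (uniformBall d 0) :=
    (integrable_const _).sub ((integrable_finset_sum _ fun j _ => (hki j).1).const_mul _)
  have hval : (b / (2 * n)) * ‖u‖ ^ 2 ≤ ∫ u', h u' ∂(uniformBall d 0) := by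
    simp only [hh]
    rw [integral_sub (integrable_const _) ((integrable_finset_sum _ fun j _ => (hki j).1).const_mul _),
      integral_const_mul (2 * b / (n:ℝ) ^ 2), integral_finset_sum _ (fun j _ => (hki j).1)]
    have h1 : ∑ j, ∫ u', kk d (u' - x j) ∂(uniformBall d 0) ≤ n * C0 d := by
      calc _ ≤ ∑ j : Fin n, C0 d := Finset.sum_le_sum fun j _ => (hki j).2
        _ = n * C0 d := by simp
    have h2 : (2 * b / (n:ℝ) ^ 2) * ∑ j, ∫ u', kk d (u' - x j) ∂(uniformBall d 0) ≤ (b / n) * (2 * C0 d) := by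
      calc _ ≤ (2 * b / (n:ℝ) ^ 2) * (n * C0 d) := by gcongr
        _ = _ := by field_simp
    have h3 : (b / n) * (‖u‖ ^ 2 / 2) ≤ (b / n) * (‖u‖ ^ 2 - 2 * ‖u‖ - 3 - 2 * C0 d) := by
      gcongr
      unfold R0 at hu
      nlinarith
    have h4 : (b / (2 * n)) * ‖u‖ ^ 2 = (b / n) * (‖u‖ ^ 2 / 2) := by field_simp
    rw [h4]
    simp
    linarith
  have hJ := jensen_exp (uniformBall d 0) h hint
  set E0 := EE d n b (Function.update x i u) with hE0
  have key : E0 * ENNReal.ofReal (Real.exp ((b / (2 * n)) * ‖u‖ ^ 2)) ≤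
      ENNReal.ofReal (vB d)⁻¹ * ∫⁻ u', EE d n b (Function.update x i u') := by
    calc E0 * ENNReal.ofReal (Real.exp ((b / (2 * n)) * ‖u‖ ^ 2))
        ≤ E0 * ∫⁻ u', ENNReal.ofReal (Real.exp (h u')) ∂(uniformBall d 0) := by
          refine mul_le_mul_right (le_trans (ENNReal.ofReal_le_ofReal (Real.exp_le_exp.2 hval)) hJ) _
      _ = ∫⁻ u', E0 * ENNReal.ofReal (Real.exp (h u')) ∂(uniformBall d 0) := by
          exact (lintegral_const_mul' E0 _ (by rw [hE0]; unfold EE; exact ENNReal.ofReal_ne_top)).symm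
      _ ≤ ∫⁻ u', EE d n b (Function.update x i u') ∂(uniformBall d 0) := by
          refine lintegral_mono_ae ?_
          filter_upwards [uniformBall_ae d] with u' hu'
          rw [hE0]
          unfold EE
          rw [← ENNReal.ofReal_mul (Real.exp_nonneg _), ← Real.exp_add]
          apply ENNReal.ofReal_le_ofReal
          apply Real.exp_le_exp.2
          have := mul_le_mul_of_nonneg_left (HH_diff d n hd hn x i u u' hu') hb
          have e : b * ((1 / (n:ℝ)) * (‖u‖ ^ 2 - 2 * ‖u‖ - 3) - (2 / (n:ℝ) ^ 2) * ∑ j, kk d (u' - x j)) = h u' := by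
            simp only [hh]; field_simp
          rw [e] at this
          linarith
      _ ≤ _ := by
          rw [unif_lintegral]
          exact mul_le_mul_right (setLIntegral_le_lintegral _ _) _
  have e2 : ENNReal.ofReal (Real.exp ((b / (2 * n)) * ‖u‖ ^ 2)) * ENNReal.ofReal (Real.exp (-(b / (2 * n)) * ‖u‖ ^ 2)) = 1 := by
    rw [← ENNReal.ofReal_mul (Real.exp_nonneg _), ← Real.exp_add]
    simp
  calc E0 = (E0 * ENNReal.ofReal (Real.exp ((b / (2 * n)) * ‖u‖ ^ 2))) * ENNReal.ofReal (Real.exp (-(b / (2 * n)) * ‖u‖ ^ 2)) := by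
        rw [mul_assoc, e2, mul_one]
    _ ≤ _ := mul_le_mul_left key _
    _ = _ := by
        rw [ENNReal.ofReal_mul (by positivity)]; ring

def gd (d n : ℕ) (b : ℝ) (u : Euc d) : ℝ≥0∞ :=
  ENNReal.ofReal ((vB d)⁻¹ * Real.exp (-(b / (2 * n)) * ‖u‖ ^ 2))

lemma gd_meas (d n : ℕ) (b : ℝ) : Measurable (gd d n b) := by
  unfold gd
  fun_prop

lemma one_step (d n : ℕ) (hd : 2 ≤ d) (hn : 1 ≤ n) {b : ℝ} (hb : 0 ≤ b) (f : Euc d → ℝ≥0∞) (hf : Measurable f)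
    (hf0 : ∀ u, ‖u‖ < R0 d → f u = 0) (φ : (Fin n → Euc d) → ℝ≥0∞) (hφ : Measurable φ) (i : Fin n)
    (hφi : ∀ x u, φ (Function.update x i u) = φ x) :
    ∫⁻ x, f (x i) * φ x * EE d n b x ∂(vv d n) ≤ (∫⁻ u, f u * gd d n b u) * ∫⁻ x, φ x * EE d n b x ∂(vv d n) := by
  have hE := EE_meas d n b
  have hfi : Measurable fun x : Fin n → Euc d => f (x i) := hf.comp (measurable_pi_apply i)
  have hφE : Measurable fun x => φ x * EE d n b x := hφ.mul hE
  rw [← lintegral_const_mul _ hφE]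
  refine lintegral_le_of_lmarginal_le {i} ((hfi.mul hφ).mul hE) ((hφ.mul hE).const_mul _) ?_
  rw [lmarginal_singleton, lmarginal_singleton]
  intro x
  simp only [Function.update_self, hφi]
  have hm : Measurable fun u => EE d n b (Function.update x i u) := hE.comp (measurable_update x)
  set J := ∫⁻ u', EE d n b (Function.update x i u') with hJ
  calc ∫⁻ u, f u * φ x * EE d n b (Function.update x i u)
      ≤ ∫⁻ u, f u * gd d n b u * (φ x * J) := by
        refine lintegral_mono fun u => ?_
        by_cases hu : ‖u‖ < R0 d
        · simp [hf0 u hu]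
        · push Not at hu
          have := one_particle d n hd hn hb x i u hu
          calc f u * φ x * EE d n b (Function.update x i u) ≤ f u * φ x * (gd d n b u * J) := mul_le_mul_right this _
            _ = _ := by ring
    _ = (∫⁻ u, f u * gd d n b u) * (φ x * J) := lintegral_mul_const _ (hf.mul (gd_meas d n b))
    _ = ∫⁻ u, (∫⁻ u, f u * gd d n b u) * (φ x * EE d n b (Function.update x i u)) := by
        rw [lintegral_const_mul _ (hm.const_mul _), lintegral_const_mul _ hm]

lemma prod_step (d n : ℕ) (hd : 2 ≤ d) (hn : 1 ≤ n) {b : ℝ} (hb : 0 ≤ b) (f : Euc d → ℝ≥0∞) (hf : Measurable f)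
    (hf0 : ∀ u, ‖u‖ < R0 d → f u = 0) (s : Finset (Fin n)) :
    ∫⁻ x, (∏ i ∈ s, (1 + f (x i))) * EE d n b x ∂(vv d n) ≤ (1 + ∫⁻ u, f u * gd d n b u) ^ s.card * ZZ d n b := by
  have hE := EE_meas d n b
  have hfi : ∀ i, Measurable fun x : Fin n → Euc d => f (x i) := fun i => hf.comp (measurable_pi_apply i)
  induction s using Finset.induction_on with
  | empty => simp [ZZ]
  | insert i s his ih =>
    have hφ : Measurable fun x : Fin n → Euc d => ∏ j ∈ s, (1 + f (x j)) :=
      Finset.measurable_prod _ fun j _ => (hfi j).const_add 1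
    have h1 := one_step d n hd hn hb f hf hf0 (fun x => ∏ j ∈ s, (1 + f (x j))) hφ i (by
      intro x u
      refine Finset.prod_congr rfl fun j hj => ?_
      rw [Function.update_of_ne]
      rintro rfl; exact his hj)
    set δ := ∫⁻ u, f u * gd d n b u with hδ
    calc ∫⁻ x, (∏ j ∈ insert i s, (1 + f (x j))) * EE d n b x ∂(vv d n)
        = ∫⁻ x, ((∏ j ∈ s, (1 + f (x j))) * EE d n b x + f (x i) * (∏ j ∈ s, (1 + f (x j))) * EE d n b x) ∂(vv d n) := by
          refine lintegral_congr fun x => ?_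
          rw [Finset.prod_insert his]; ring
      _ = ∫⁻ x, (∏ j ∈ s, (1 + f (x j))) * EE d n b x ∂(vv d n) + ∫⁻ x, f (x i) * (∏ j ∈ s, (1 + f (x j))) * EE d n b x ∂(vv d n) :=
          lintegral_add_left (hφ.mul hE) _
      _ ≤ ∫⁻ x, (∏ j ∈ s, (1 + f (x j))) * EE d n b x ∂(vv d n) + δ * ∫⁻ x, (∏ j ∈ s, (1 + f (x j))) * EE d n b x ∂(vv d n) := by
          gcongr
      _ = (1 + δ) * ∫⁻ x, (∏ j ∈ s, (1 + f (x j))) * EE d n b x ∂(vv d n) := by ring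
      _ ≤ (1 + δ) * ((1 + δ) ^ s.card * ZZ d n b) := mul_le_mul_right ih _
      _ = _ := by rw [Finset.card_insert_of_notMem his, pow_succ]; ring

lemma inv_mul_bound (z c I : ℝ≥0∞) (h : I ≤ c * z) : z⁻¹ * I ≤ c := by
  calc z⁻¹ * I ≤ z⁻¹ * (c * z) := mul_le_mul_right h _
    _ = c * (z⁻¹ * z) := by ring
    _ ≤ c * 1 := mul_le_mul_right (ENNReal.inv_mul_le_one _) _
    _ = c := mul_one _

lemma chernoff (d n : ℕ) (hd : 2 ≤ d) (hn : 1 ≤ n) {b : ℝ} (hb : 0 ≤ b) (V : Euc d → ℝ) (hV : ∀ x, V x = ‖x‖ ^ 2)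
    (f : Euc d → ℝ≥0∞) (hf : Measurable f)
    (hf0 : ∀ u, ‖u‖ < R0 d → f u = 0) (c : ℝ≥0∞) (S : Set (Fin n → Euc d)) (hS : ∀ x ∈ S, 1 ≤ c * ∏ i, (1 + f (x i))) :
    gibbs d n b V S ≤ c * (1 + ∫⁻ u, f u * gd d n b u) ^ n := by
  have hE := EE_meas d n b
  have hfi : ∀ i, Measurable fun x : Fin n → Euc d => f (x i) := fun i => hf.comp (measurable_pi_apply i)
  have hφ : Measurable fun x : Fin n → Euc d => ∏ j, (1 + f (x j)) :=
      Finset.measurable_prod _ fun j _ => (hfi j).const_add 1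
  rw [gibbs_apply d n b V hV]
  apply inv_mul_bound
  set T : Set (Fin n → Euc d) := {x | 1 ≤ c * ∏ i, (1 + f (x i))} with hT
  have hTm : MeasurableSet T := measurableSet_le measurable_const (hφ.const_mul c)
  have h := prod_step d n hd hn hb f hf hf0 Finset.univ
  rw [Finset.card_univ, Fintype.card_fin] at h
  calc ∫⁻ x in S, EE d n b x ∂(vv d n) ≤ ∫⁻ x in T, EE d n b x ∂(vv d n) := lintegral_mono_set hS
    _ ≤ ∫⁻ x in T, c * ((∏ i, (1 + f (x i))) * EE d n b x) ∂(vv d n) := by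
        refine setLIntegral_mono' hTm fun x hx => ?_
        calc EE d n b x = 1 * EE d n b x := (one_mul _).symm
          _ ≤ (c * ∏ i, (1 + f (x i))) * EE d n b x := mul_le_mul_left hx _
          _ = _ := by ring
    _ ≤ ∫⁻ x, c * ((∏ i, (1 + f (x i))) * EE d n b x) ∂(vv d n) := setLIntegral_le_lintegral _ _
    _ = c * ∫⁻ x, ((∏ i, (1 + f (x i))) * EE d n b x) ∂(vv d n) := lintegral_const_mul _ (hφ.mul hE)
    _ ≤ c * ((1 + ∫⁻ u, f u * gd d n b u) ^ n * ZZ d n b) := mul_le_mul_right h _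
    _ = _ := by ring

lemma union_bd (d n : ℕ) (hd : 2 ≤ d) (hn : 1 ≤ n) {b : ℝ} (hb : 0 ≤ b) (V : Euc d → ℝ) (hV : ∀ x, V x = ‖x‖ ^ 2)
    (f : Euc d → ℝ≥0∞) (hf : Measurable f)
    (hf0 : ∀ u, ‖u‖ < R0 d → f u = 0) (S : Set (Fin n → Euc d)) (hS : ∀ x ∈ S, ∃ i, 1 ≤ f (x i)) :
    gibbs d n b V S ≤ n * ∫⁻ u, f u * gd d n b u := by
  have hE := EE_meas d n b
  have hfi : ∀ i, Measurable fun x : Fin n → Euc d => f (x i) := fun i => hf.comp (measurable_pi_apply i)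
  have hφ : Measurable fun x : Fin n → Euc d => ∑ j, f (x j) :=
      Finset.measurable_sum _ fun j _ => (hfi j)
  rw [gibbs_apply d n b V hV]
  apply inv_mul_bound
  set T : Set (Fin n → Euc d) := {x | 1 ≤ ∑ i, f (x i)} with hT
  have hTm : MeasurableSet T := measurableSet_le measurable_const hφ
  have hST : S ⊆ T := by
    intro x hx
    obtain ⟨i, hi⟩ := hS x hx
    exact hi.trans (Finset.single_le_sum (f := fun i => f (x i)) (fun _ _ => zero_le) (Finset.mem_univ i))
  calc ∫⁻ x in S, EE d n b x ∂(vv d n) ≤ ∫⁻ x in T, EE d n b x ∂(vv d n) := lintegral_mono_set hST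
    _ ≤ ∫⁻ x in T, ∑ i, f (x i) * 1 * EE d n b x ∂(vv d n) := by
        refine setLIntegral_mono' hTm fun x hx => ?_
        rw [← Finset.sum_mul, ← Finset.sum_mul, mul_one]
        calc EE d n b x = 1 * EE d n b x := (one_mul _).symm
          _ ≤ (∑ i, f (x i)) * EE d n b x := mul_le_mul_left hx _
    _ ≤ ∫⁻ x, ∑ i, f (x i) * 1 * EE d n b x ∂(vv d n) := setLIntegral_le_lintegral _ _
    _ = ∑ i, ∫⁻ x, f (x i) * 1 * EE d n b x ∂(vv d n) :=
        lintegral_finset_sum _ fun i _ => ((hfi i).mul_const 1).mul hE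
    _ ≤ ∑ i : Fin n, (∫⁻ u, f u * gd d n b u) * ZZ d n b := by
        refine Finset.sum_le_sum fun i _ => ?_
        have := one_step d n hd hn hb f hf hf0 (fun _ => 1) measurable_const i (fun _ _ => rfl)
        simpa [ZZ] using this
    _ = _ := by simp; ring

def Mq (d : ℕ) (q : ℝ) : ℝ := ∫ u : Euc d, ‖u‖ ^ q * Real.exp (-1 * ‖u‖ ^ 2)

lemma Mq_nonneg (d : ℕ) (q : ℝ) : 0 ≤ Mq d q := integral_nonneg fun u => by positivity

lemma del_bound (d n : ℕ) (hd : 2 ≤ d) {b c q : ℝ} (hB : 1 ≤ b / (2 * n)) (hc : 0 ≤ c) (hq : 0 ≤ q)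
    (f : Euc d → ℝ≥0∞) (hf0 : ∀ u, ‖u‖ < R0 d → f u = 0) (hf1 : ∀ u, f u ≤ ENNReal.ofReal (c * ‖u‖ ^ q)) :
    ∫⁻ u, f u * gd d n b u ≤ ENNReal.ofReal (c * (vB d)⁻¹ * Real.exp (-(b / (2 * n) - 1)) * Mq d q) := by
  have hv := vB_pos d
  have hC0 := C0_ge d
  have hi := gauss_moment_integrable d hd hq (show (0:ℝ) < 1 by norm_num)
  set B := b / (2 * n) with hBd
  have hk : 0 ≤ c * (vB d)⁻¹ * Real.exp (-(B - 1)) := by positivity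
  calc ∫⁻ u, f u * gd d n b u
      ≤ ∫⁻ u, ENNReal.ofReal (c * (vB d)⁻¹ * Real.exp (-(B - 1)) * (‖u‖ ^ q * Real.exp (-1 * ‖u‖ ^ 2))) := by
        refine lintegral_mono fun u => ?_
        by_cases hu : ‖u‖ < R0 d
        · simp [hf0 u hu]
        · push Not at hu
          unfold R0 at hu
          have h1 : 1 ≤ ‖u‖ := by linarith
          refine (mul_le_mul_left (hf1 u) _).trans ?_
          unfold gd
          rw [← ENNReal.ofReal_mul (by positivity)]
          apply ENNReal.ofReal_le_ofReal
          have h2 : Real.exp (-B * ‖u‖ ^ 2) ≤ Real.exp (-(B - 1)) * Real.exp (-1 * ‖u‖ ^ 2) := by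
            rw [← Real.exp_add]
            apply Real.exp_le_exp.2
            have : 1 ≤ ‖u‖ ^ 2 := by nlinarith
            nlinarith [mul_nonneg (sub_nonneg.2 hB) (sub_nonneg.2 this)]
          calc c * ‖u‖ ^ q * ((vB d)⁻¹ * Real.exp (-B * ‖u‖ ^ 2))
              ≤ c * ‖u‖ ^ q * ((vB d)⁻¹ * (Real.exp (-(B - 1)) * Real.exp (-1 * ‖u‖ ^ 2))) := by gcongr
            _ = _ := by ring
    _ = ENNReal.ofReal (∫ u : Euc d, c * (vB d)⁻¹ * Real.exp (-(B - 1)) * (‖u‖ ^ q * Real.exp (-1 * ‖u‖ ^ 2))) := by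
        rw [ofReal_integral_eq_lintegral_ofReal (hi.const_mul _)]
        exact Eventually.of_forall fun u => by positivity
    _ = _ := by rw [integral_const_mul]; rfl

lemma tail_event (d : ℕ) (hd : 2 ≤ d) (V : Euc d → ℝ) (hV : ∀ x, V x = ‖x‖ ^ 2)
    (β : ℕ → ℝ) (hβpos : ∀ n, 0 < β n) (hβ : Tendsto (fun n => β n / n) atTop atTop)
    {p R η : ℝ} (hp : 1 ≤ p) (hR : R0 d ≤ R) (hη : 0 < η) :
    ∃ C : ℝ, ∀ᶠ n : ℕ in atTop, ∀ S : Set (Fin n → Euc d),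
      (∀ x ∈ S, η * n ≤ ∑ i, if R < ‖x i‖ then ‖x i‖ ^ p else 0) →
      gibbs d n (β n) V S ≤ ENNReal.ofReal (C * ((n:ℝ) ^ 2)⁻¹) := by
  have hv := vB_pos d
  have hC0 := C0_ge d
  have hR0 : 1 ≤ R0 d := by unfold R0; linarith
  have hM6 := Mq_nonneg d (p * 6)
  have hMp := Mq_nonneg d p
  refine ⟨(vB d)⁻¹ * Mq d (p * 6) + 24 * (2 / η) ^ 4, ?_⟩
  have hβ2 : Tendsto (fun n : ℕ => β n / (2 * n)) atTop atTop := by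
    have : (fun n : ℕ => β n / (2 * n)) = fun n : ℕ => (β n / n) * (1 / 2) := by
      ext n; rw [mul_comm (2:ℝ), ← div_div]; ring
    rw [this]
    exact hβ.atTop_mul_const (by norm_num)
  have hlim : Tendsto (fun n : ℕ => 2 * (vB d)⁻¹ * Real.exp (-(β n / (2 * n) - 1)) * Mq d p) atTop (𝓝 0) := by
    have h1 : Tendsto (fun n : ℕ => Real.exp (-(β n / (2 * n) - 1))) atTop (𝓝 0) :=
      Real.tendsto_exp_neg_atTop_nhds_zero.comp (tendsto_atTop_add_const_right _ (-1) hβ2)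
    have := (h1.const_mul (2 * (vB d)⁻¹)).mul_const (Mq d p)
    simpa using this
  filter_upwards [hβ2.eventually_ge_atTop 1, hlim.eventually_le_const (show (0:ℝ) < η / 2 by positivity), eventually_ge_atTop 1]
    with n hB hsm hn S hS
  have hn0 : (0:ℝ) < n := by exact_mod_cast hn
  set q := √(n:ℝ) with hq
  have hq0 : 0 < q := Real.sqrt_pos.2 hn0
  have hqq : q * q = n := Real.mul_self_sqrt hn0.le
  have hb := (hβpos n).le
  -- first event
  set f1 : Euc d → ℝ≥0∞ := fun u => if R < ‖u‖ ∧ q < ‖u‖ ^ p then 1 else 0 with hf1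
  have mset : MeasurableSet {u : Euc d | R < ‖u‖} := measurableSet_lt measurable_const measurable_norm
  have mset2 : MeasurableSet {u : Euc d | q < ‖u‖ ^ p} := measurableSet_lt measurable_const (by fun_prop)
  have mset3 : MeasurableSet {u : Euc d | ‖u‖ ^ p ≤ q} := measurableSet_le (by fun_prop) measurable_const
  have hf1m : Measurable f1 := Measurable.ite (mset.inter mset2) measurable_const measurable_const
  have hf10 : ∀ u, ‖u‖ < R0 d → f1 u = 0 := by
    intro u hu
    simp only [hf1]
    rw [if_neg]
    rintro ⟨h, _⟩; linarith
  set S1 : Set (Fin n → Euc d) := {x | ∃ i, 1 ≤ f1 (x i)} with hS1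
  have b1 := union_bd d n hd hn hb V hV f1 hf1m hf10 S1 (fun x hx => hx)
  have b2 := del_bound d n hd (c := ((n:ℝ) ^ 3)⁻¹) (q := p * 6) hB (by positivity) (by positivity) f1 hf10 (by
    intro u
    simp only [hf1]
    split_ifs with h
    · rw [← ENNReal.ofReal_one]
      apply ENNReal.ofReal_le_ofReal
      rw [Real.rpow_mul (norm_nonneg _), ← hqq]
      have : q ^ 6 ≤ (‖u‖ ^ p) ^ 6 := by gcongr; exact h.2.le
      have e : (‖u‖ ^ p) ^ (6:ℝ) = (‖u‖ ^ p) ^ 6 := by exact_mod_cast Real.rpow_natCast _ 6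
      rw [e, le_inv_mul_iff₀ (by positivity)]
      calc (q * q) ^ 3 * 1 = q ^ 6 := by ring
        _ ≤ _ := this
    · exact zero_le)
  have c1 : gibbs d n (β n) V S1 ≤ ENNReal.ofReal ((vB d)⁻¹ * Mq d (p * 6) * ((n:ℝ) ^ 2)⁻¹) := by
    refine b1.trans ((mul_le_mul_right b2 _).trans ?_)
    rw [← ENNReal.ofReal_natCast, ← ENNReal.ofReal_mul hn0.le]
    apply ENNReal.ofReal_le_ofReal
    have : Real.exp (-(β n / (2 * n) - 1)) ≤ 1 := Real.exp_le_one_iff.2 (by linarith)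
    calc (n:ℝ) * (((n:ℝ) ^ 3)⁻¹ * (vB d)⁻¹ * Real.exp (-(β n / (2 * n) - 1)) * Mq d (p * 6))
        ≤ (n:ℝ) * (((n:ℝ) ^ 3)⁻¹ * (vB d)⁻¹ * 1 * Mq d (p * 6)) := by gcongr
      _ = _ := by field_simp
  -- second event
  set Y : Euc d → ℝ := fun u => if R < ‖u‖ ∧ ‖u‖ ^ p ≤ q then ‖u‖ ^ p else 0 with hY
  have hYm : Measurable Y := Measurable.ite (mset.inter mset3) (by fun_prop) measurable_const
  have hY0 : ∀ u, 0 ≤ Y u := by intro u; simp only [hY]; split_ifs <;> positivity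
  have hYq : ∀ u, Y u ≤ q := by intro u; simp only [hY]; split_ifs with h; exacts [h.2, hq0.le]
  have hYp : ∀ u, Y u ≤ ‖u‖ ^ p := by intro u; simp only [hY]; split_ifs with h; exacts [le_rfl, by positivity]
  set f2 : Euc d → ℝ≥0∞ := fun u => ENNReal.ofReal (Real.exp (q⁻¹ * Y u) - 1) with hf2
  have hf2m : Measurable f2 := by fun_prop
  have hf20 : ∀ u, ‖u‖ < R0 d → f2 u = 0 := by
    intro u hu
    simp only [hf2, hY]
    rw [if_neg]
    · simp
    rintro ⟨h, _⟩; linarith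
  have h1f : ∀ u, 1 + f2 u = ENNReal.ofReal (Real.exp (q⁻¹ * Y u)) := by
    intro u
    have : 0 ≤ q⁻¹ * Y u := mul_nonneg (by positivity) (hY0 u)
    have h1 : 1 ≤ Real.exp (q⁻¹ * Y u) := Real.one_le_exp this
    simp only [hf2]
    rw [← ENNReal.ofReal_one, ← ENNReal.ofReal_add zero_le_one (by linarith)]
    congr 1; ring
  have d1 := del_bound d n hd (c := 2 * q⁻¹) (q := p) hB (by positivity) (by positivity) f2 hf20 (by
    intro u
    apply ENNReal.ofReal_le_ofReal
    have h0 : 0 ≤ q⁻¹ * Y u := mul_nonneg (by positivity) (hY0 u)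
    have h1 : q⁻¹ * Y u ≤ 1 := by rw [inv_mul_le_iff₀ hq0]; simpa using hYq u
    have h2 := Real.abs_exp_sub_one_le (x := q⁻¹ * Y u) (by rw [abs_of_nonneg h0]; exact h1)
    rw [abs_of_nonneg h0] at h2
    calc Real.exp (q⁻¹ * Y u) - 1 ≤ 2 * (q⁻¹ * Y u) := (le_abs_self _).trans h2
      _ ≤ 2 * (q⁻¹ * ‖u‖ ^ p) := by gcongr; exact hYp u
      _ = _ := by ring)
  have d2 : ∫⁻ u, f2 u * gd d n (β n) u ≤ ENNReal.ofReal (q⁻¹ * (η / 2)) := by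
    refine d1.trans (ENNReal.ofReal_le_ofReal ?_)
    calc 2 * q⁻¹ * (vB d)⁻¹ * Real.exp (-(β n / (2 * n) - 1)) * Mq d p
        = q⁻¹ * (2 * (vB d)⁻¹ * Real.exp (-(β n / (2 * n) - 1)) * Mq d p) := by ring
      _ ≤ _ := by gcongr
  have d3 : (1 + ∫⁻ u, f2 u * gd d n (β n) u) ^ n ≤ ENNReal.ofReal (Real.exp (q * η / 2)) := by
    calc (1 + ∫⁻ u, f2 u * gd d n (β n) u) ^ n ≤ (ENNReal.ofReal (Real.exp (q⁻¹ * (η / 2)))) ^ n := by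
          gcongr
          refine (add_le_add le_rfl d2).trans ?_
          rw [← ENNReal.ofReal_one, ← ENNReal.ofReal_add zero_le_one (by positivity)]
          apply ENNReal.ofReal_le_ofReal
          have := Real.add_one_le_exp (q⁻¹ * (η / 2))
          linarith
      _ = _ := by
          rw [← ENNReal.ofReal_pow (Real.exp_nonneg _), ← Real.exp_nat_mul]
          congr 2
          rw [← hqq]; field_simp
  set S2 : Set (Fin n → Euc d) := {x | η * n ≤ ∑ i, Y (x i)} with hS2
  have e1 := chernoff d n hd hn hb V hV f2 hf2m hf20 (ENNReal.ofReal (Real.exp (-(q * η)))) S2 (by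
    intro x hx
    have : ∏ i, (1 + f2 (x i)) = ENNReal.ofReal (Real.exp (q⁻¹ * ∑ i, Y (x i))) := by
      rw [Finset.mul_sum, Real.exp_sum, ENNReal.ofReal_prod_of_nonneg (fun i _ => Real.exp_nonneg _)]
      exact Finset.prod_congr rfl fun i _ => h1f (x i)
    rw [this, ← ENNReal.ofReal_mul (Real.exp_nonneg _), ← Real.exp_add, ← ENNReal.ofReal_one]
    apply ENNReal.ofReal_le_ofReal
    apply Real.one_le_exp
    have hx : η * n ≤ ∑ i, Y (x i) := hx
    have : q⁻¹ * (η * n) ≤ q⁻¹ * ∑ i, Y (x i) := by gcongr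
    have e : q⁻¹ * (η * n) = q * η := by rw [← hqq]; field_simp
    linarith)
  have c2 : gibbs d n (β n) V S2 ≤ ENNReal.ofReal (24 * (2 / η) ^ 4 * ((n:ℝ) ^ 2)⁻¹) := by
    refine e1.trans ((mul_le_mul_right d3 _).trans ?_)
    rw [← ENNReal.ofReal_mul (Real.exp_nonneg _), ← Real.exp_add]
    apply ENNReal.ofReal_le_ofReal
    have h4 := Real.pow_div_factorial_le_exp (q * η / 2) (by positivity) 4
    have e : -(q * η) + q * η / 2 = -(q * η / 2) := by ring
    rw [e, Real.exp_neg]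
    have hpos : 0 < (q * η / 2) ^ 4 / (Nat.factorial 4 : ℕ) := by positivity
    calc (Real.exp (q * η / 2))⁻¹ ≤ ((q * η / 2) ^ 4 / (Nat.factorial 4 : ℕ))⁻¹ := by gcongr
      _ = _ := by
          rw [← hqq]
          have : ((Nat.factorial 4 : ℕ) : ℝ) = 24 := by norm_num [Nat.factorial]
          rw [this]; field_simp
  have hsub : S ⊆ S1 ∪ S2 := by
    intro x hx
    by_cases h : x ∈ S1
    · exact Or.inl h
    · right
      have h' : ∀ i, ¬ (R < ‖x i‖ ∧ q < ‖x i‖ ^ p) := by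
        intro i hi
        apply h
        refine ⟨i, ?_⟩
        simp only [hf1]; rw [if_pos hi]
      have e : ∑ i, (if R < ‖x i‖ then ‖x i‖ ^ p else 0) = ∑ i, Y (x i) := by
        refine Finset.sum_congr rfl fun i _ => ?_
        simp only [hY]
        by_cases hr : R < ‖x i‖
        · have : ‖x i‖ ^ p ≤ q := by
            by_contra hc
            exact h' i ⟨hr, not_le.1 hc⟩
          simp [hr, this]
        · simp [hr]
      have := hS x hx
      rw [e] at this
      exact this
  calc gibbs d n (β n) V S ≤ gibbs d n (β n) V S1 + gibbs d n (β n) V S2 :=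
        (measure_mono hsub).trans (measure_union_le _ _)
    _ ≤ _ := add_le_add c1 c2
    _ = _ := by
        rw [← ENNReal.ofReal_add (by positivity) (by positivity)]
        congr 1; ring

lemma sum_ne_top (f : ℕ → ℝ≥0∞) (h1 : ∀ n, f n ≤ 1) (C : ℝ) (hC : 0 ≤ C)
    (h2 : ∀ᶠ n : ℕ in atTop, f n ≤ ENNReal.ofReal (C * ((n:ℝ) ^ 2)⁻¹)) : ∑' n, f n ≠ ⊤ := by
  obtain ⟨N, hN⟩ := eventually_atTop.1 h2
  set g : ℕ → ℝ := fun n => (if n < N then 1 else 0) + C * ((n:ℝ) ^ 2)⁻¹ with hg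
  have hs : Summable g := by
    refine Summable.add ?_ ((Real.summable_nat_pow_inv.2 (by norm_num)).mul_left C)
    refine summable_of_ne_finset_zero (s := Finset.range N) fun n hn => ?_
    rw [if_neg]; simpa using hn
  have hle : ∀ n, f n ≤ ENNReal.ofReal (g n) := by
    intro n
    simp only [hg]
    by_cases h : n < N
    · rw [if_pos h]
      refine (h1 n).trans ?_
      rw [← ENNReal.ofReal_one]
      apply ENNReal.ofReal_le_ofReal
      have : 0 ≤ C * ((n:ℝ) ^ 2)⁻¹ := by positivity
      linarith
    · rw [if_neg h, zero_add]
      exact hN n (not_lt.1 h)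
  exact ne_top_of_le_ne_top hs.tsum_ofReal_ne_top (ENNReal.tsum_le_tsum hle)

lemma wass_mono (d : ℕ) {p q : ℝ} (hp : 1 ≤ p) (hpq : p ≤ q) (μ ν : Measure (Euc d)) [IsProbabilityMeasure μ] :
    wassDist d p μ ν ≤ wassDist d q μ ν := by
  have hp0 : 0 < p := by linarith
  have hq0 : 0 < q := by linarith
  have key : wassDist d p μ ν ^ q ≤ ⨅ π ∈ Couplings d μ ν, ∫⁻ z : Euc d × Euc d, ENNReal.ofReal (‖z.1 - z.2‖ ^ q) ∂π := by
    refine le_iInf₂ fun π hπ => ?_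
    have hprob : IsProbabilityMeasure π := by
      constructor
      have h := hπ.1
      have : (π.map Prod.fst) Set.univ = 1 := by rw [h]; exact measure_univ
      rwa [Measure.map_apply measurable_fst MeasurableSet.univ, Set.preimage_univ] at this
    have e : ∀ r : ℝ, 0 < r → eLpNorm' (fun z : Euc d × Euc d => z.1 - z.2) r π =
        (∫⁻ z : Euc d × Euc d, ENNReal.ofReal (‖z.1 - z.2‖ ^ r) ∂π) ^ (1 / r) := by
      intro r hr
      unfold eLpNorm'
      congr 1
      refine lintegral_congr fun z => ?_
      rw [← ENNReal.ofReal_rpow_of_nonneg (norm_nonneg _) hr.le, ofReal_norm]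
    have h := eLpNorm'_le_eLpNorm'_of_exponent_le (f := fun z : Euc d × Euc d => z.1 - z.2) hp0 hpq π
      (by fun_prop)
    rw [e p hp0, e q hq0] at h
    calc wassDist d p μ ν ^ q ≤ ((∫⁻ z : Euc d × Euc d, ENNReal.ofReal (‖z.1 - z.2‖ ^ p) ∂π) ^ (1 / p)) ^ q := by
          unfold wassDist
          gcongr
          exact iInf₂_le π hπ
      _ ≤ ((∫⁻ z : Euc d × Euc d, ENNReal.ofReal (‖z.1 - z.2‖ ^ q) ∂π) ^ (1 / q)) ^ q := by gcongr
      _ = _ := by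
          rw [← ENNReal.rpow_mul, one_div_mul_cancel hq0.ne', ENNReal.rpow_one]
  calc wassDist d p μ ν = (wassDist d p μ ν ^ q) ^ (1 / q) := by
        rw [← ENNReal.rpow_mul, mul_one_div_cancel hq0.ne', ENNReal.rpow_one]
    _ ≤ _ := by
        conv_rhs => unfold wassDist
        gcongr

lemma emp_tail (d n : ℕ) (hn : 1 ≤ n) (x : Fin n → Euc d) (R p η : ℝ)
    (h : ∑ i, (if R < ‖x i‖ then ‖x i‖ ^ p else 0) < η * n) :
    ∫⁻ y in {y | R < ‖y‖}, ENNReal.ofReal (‖y‖ ^ p) ∂(empMeas d n x) ≤ ENNReal.ofReal η := by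
  have hn0 : (0:ℝ) < n := by exact_mod_cast hn
  have mset : MeasurableSet {u : Euc d | R < ‖u‖} := measurableSet_lt measurable_const measurable_norm
  rw [← lintegral_indicator mset]
  unfold empMeas
  rw [lintegral_smul_measure, lintegral_finset_sum_measure]
  have : ∑ i, ∫⁻ a, {y : Euc d | R < ‖y‖}.indicator (fun y => ENNReal.ofReal (‖y‖ ^ p)) a ∂(Measure.dirac (x i))
      = ENNReal.ofReal (∑ i, (if R < ‖x i‖ then ‖x i‖ ^ p else 0)) := by
    rw [ENNReal.ofReal_sum_of_nonneg]
    · refine Finset.sum_congr rfl fun i _ => ?_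
      rw [lintegral_dirac]
      by_cases hr : R < ‖x i‖
      · simp [hr]
      · simp [hr]
    · intro i _; split_ifs <;> positivity
  rw [this, smul_eq_mul]
  apply inv_mul_bound
  rw [← ENNReal.ofReal_natCast, ← ENNReal.ofReal_mul' hn0.le]
  exact ENNReal.ofReal_le_ofReal h.le

lemma complete_conv (d : ℕ) (hd : 2 ≤ d) (V : Euc d → ℝ) (hV : ∀ x, V x = ‖x‖ ^ 2)
    (β : ℕ → ℝ) (hβpos : ∀ n, 0 < β n)
    (hβ : Tendsto (fun n => β n / n) atTop atTop) (p : ℝ) (hp : 1 ≤ p) (ε : ℝ) (hε : 0 < ε) :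
      ∑' n : ℕ, gibbs d n (β n) V
        {x | ENNReal.ofReal ε ≤ wassDist d p (empMeas d n x) (uniformBall d 0)} ≠ ⊤ := by
  have hv := vB_pos d
  have hC0 := C0_ge d
  have hcq := cq_pos d hd
  have hR0 : 1 ≤ R0 d := by unfold R0; linarith
  obtain ⟨a0, ha0, s, hs, η, hη, H⟩ := wass_of_smooth d hd hp (R0 d) (by linarith) hε
  set t0 := a0 / 2 with ht0d
  have ht0 : 0 < t0 := by positivity
  set η' := s ^ 2 * (cq d / (2 * t0)) with hη'd
  have hη' : 0 < η' := by positivity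
  set T := max (2 * t0) (16 * cq d / (vB d * η')) with hTd
  have hT1 : 2 * t0 ≤ T := le_max_left _ _
  have hT2 : 16 * cq d / (vB d * η') ≤ T := le_max_right _ _
  have hT0 : 0 < T := by linarith
  have hTη : 2 * (cq d / (T * vB d)) ≤ η' / 8 := by
    rw [div_le_iff₀ (by positivity)] at hT2
    rw [← mul_div_assoc, div_le_div_iff₀ (by positivity) (by norm_num)]
    nlinarith
  obtain ⟨C, hC⟩ := tail_event d hd V hV β hβpos hβ hp (le_refl (R0 d)) hη
  refine sum_ne_top _ (fun n => gibbs_le_one d n (β n) V hV _) (2 + |C|) (by positivity) ?_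
  filter_upwards [hC, A_event d hd V hV β hβpos hβ hη' hT0 hTη, eventually_ge_atTop 1] with n hCn hAn hn
  have hn0 : (0:ℝ) < n := by exact_mod_cast hn
  set S1 : Set (Fin n → Euc d) := {x | η' ≤ DT d T (empMeas d n x) (uniformBall d 0)} with hS1
  set S2 : Set (Fin n → Euc d) := {x | η * n ≤ ∑ i, if R0 d < ‖x i‖ then ‖x i‖ ^ p else 0} with hS2
  have hsub : {x | ENNReal.ofReal ε ≤ wassDist d p (empMeas d n x) (uniformBall d 0)} ⊆ S1 ∪ S2 := by
    intro x hx
    by_contra hcon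
    rw [Set.mem_union, not_or] at hcon
    obtain ⟨k1, k2⟩ := hcon
    have k1 : DT d T (empMeas d n x) (uniformBall d 0) < η' := not_le.1 k1
    have k2 : ∑ i, (if R0 d < ‖x i‖ then ‖x i‖ ^ p else 0) < η * n := not_le.1 k2
    have hx : ENNReal.ofReal ε ≤ wassDist d p (empMeas d n x) (uniformBall d 0) := hx
    have i1 := emp_prob d n hn x
    have i2 := uniformBall_prob d
    have hsum : 0 ≤ ∑ i, ‖x i‖ := Finset.sum_nonneg fun _ _ => norm_nonneg _
    obtain ⟨t, ht, hle⟩ := DT_small d hd (s := s) ht0 hT1 (empMeas d n x) (uniformBall d 0) (1 + ∑ i, ‖x i‖)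
      (emp_ae d n x _ fun i => by
        have : ‖x i‖ ≤ ∑ i, ‖x i‖ := Finset.single_le_sum (f := fun i => ‖x i‖) (fun _ _ => norm_nonneg _) (Finset.mem_univ i)
        linarith)
      (by filter_upwards [uniformBall_ae d] with y hy; linarith) k1
    have := H (2 * t) (by rw [ge_iff_le]; rw [ht0d] at ht; linarith) (empMeas d n x) i1 hle (emp_tail d n hn x _ p η k2)
    exact absurd hx (not_le.2 this)
  calc _ ≤ gibbs d n (β n) V S1 + gibbs d n (β n) V S2 := (measure_mono hsub).trans (measure_union_le _ _)
    _ ≤ ENNReal.ofReal (Real.exp (-n)) + ENNReal.ofReal (C * ((n:ℝ) ^ 2)⁻¹) :=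
        add_le_add (hAn S1 fun x hx => hx) (hCn S2 fun x hx => hx)
    _ ≤ ENNReal.ofReal (2 * ((n:ℝ) ^ 2)⁻¹) + ENNReal.ofReal (|C| * ((n:ℝ) ^ 2)⁻¹) := by
        gcongr
        · have h4 := Real.pow_div_factorial_le_exp (n:ℝ) hn0.le 2
          rw [Real.exp_neg]
          calc (Real.exp n)⁻¹ ≤ ((n:ℝ) ^ 2 / (Nat.factorial 2 : ℕ))⁻¹ := by gcongr
            _ = _ := by norm_num [Nat.factorial]; field_simp
        · exact le_abs_self C
    _ = _ := by
        rw [← ENNReal.ofReal_add (by positivity) (by positivity)]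
        congr 1; ring

lemma as_conv (d : ℕ) (V : Euc d → ℝ) (β : ℕ → ℝ)
    (H : ∀ p : ℝ, 1 ≤ p → ∀ ε : ℝ, 0 < ε →
      ∑' n : ℕ, gibbs d n (β n) V
        {x | ENNReal.ofReal ε ≤ wassDist d p (empMeas d n x) (uniformBall d 0)} ≠ ⊤)
    {Ω : Type} [MeasurableSpace Ω] (P : Measure Ω) (X : (n : ℕ) → Ω → (Fin n → Euc d))
    (hX : ∀ n, Measurable (X n)) (hmap : ∀ n, 2 ≤ n → Measure.map (X n) P = gibbs d n (β n) V) :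
    ∀ᵐ ω ∂P, ∀ p : ℝ, 1 ≤ p →
          Tendsto (fun n => wassDist d p (empMeas d n (X n ω)) (uniformBall d 0))
            atTop (𝓝 0) := by
  have main : ∀ k m : ℕ, ∀ᵐ ω ∂P, ∀ᶠ n in atTop,
      ω ∉ {ω | 2 ≤ n ∧ ENNReal.ofReal (1 / ((m:ℝ) + 1)) ≤ wassDist d ((k:ℝ) + 1) (empMeas d n (X n ω)) (uniformBall d 0)} := by
    intro k m
    apply ae_eventually_notMem
    have h := H ((k:ℝ) + 1) (by have : (0:ℝ) ≤ k := k.cast_nonneg; linarith) (1 / ((m:ℝ) + 1)) (by positivity)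
    refine ne_top_of_le_ne_top h (ENNReal.tsum_le_tsum fun n => ?_)
    by_cases hn : 2 ≤ n
    · rw [← hmap n hn]
      refine le_trans (measure_mono ?_) (Measure.le_map_apply (hX n).aemeasurable _)
      intro ω hω
      exact hω.2
    · simp [hn]
  have main2 : ∀ᵐ ω ∂P, ∀ k m : ℕ, ∀ᶠ n in atTop,
      ω ∉ {ω | 2 ≤ n ∧ ENNReal.ofReal (1 / ((m:ℝ) + 1)) ≤ wassDist d ((k:ℝ) + 1) (empMeas d n (X n ω)) (uniformBall d 0)} := by
    rw [ae_all_iff]; intro k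
    rw [ae_all_iff]; intro m
    exact main k m
  filter_upwards [main2] with ω hω p hp
  rw [ENNReal.tendsto_nhds_zero]
  intro ε hε
  obtain ⟨k, hk⟩ := exists_nat_ge p
  obtain ⟨m, hm⟩ := ENNReal.exists_inv_nat_lt hε.ne'
  have hme : ENNReal.ofReal (1 / ((m:ℝ) + 1)) ≤ ε := by
    refine le_trans ?_ hm.le
    rw [one_div, ENNReal.ofReal_inv_of_pos (by positivity)]
    apply ENNReal.inv_le_inv.2
    rw [← ENNReal.ofReal_natCast]
    apply ENNReal.ofReal_le_ofReal
    linarith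
  filter_upwards [hω k m, eventually_ge_atTop 2] with n h1 h2
  have i1 := emp_prob d n (by omega) (X n ω)
  have h3 : ¬ ENNReal.ofReal (1 / ((m:ℝ) + 1)) ≤ wassDist d ((k:ℝ) + 1) (empMeas d n (X n ω)) (uniformBall d 0) :=
    fun h => h1 ⟨h2, h⟩
  exact (wass_mono d hp (by linarith) _ _).trans ((not_le.1 h3).le.trans hme)

/-- for the quadratic confinement, the empirical measure of the Coulomb gas
converges completely (summable tail probabilities) and hence almost surely, in every
`p`-Wasserstein distance, towards the uniform measure on the closed unit ball. -/
theorem stmt2 (d : ℕ) (hd : 2 ≤ d) (V : Euc d → ℝ) (hV : ∀ x, V x = ‖x‖ ^ 2)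
    (β : ℕ → ℝ) (hβpos : ∀ n, 0 < β n)
    (hβ : Tendsto (fun n => β n / n) atTop atTop) :
    -- complete convergence: summability of the tail probabilities
    (∀ p : ℝ, 1 ≤ p → ∀ ε : ℝ, 0 < ε →
      ∑' n : ℕ, gibbs d n (β n) V
        {x | ENNReal.ofReal ε ≤ wassDist d p (empMeas d n x) (uniformBall d 0)} ≠ ⊤) ∧
    -- almost sure convergence, on any probability space carrying the gas
    (∀ (Ω : Type) (_ : MeasureSpace Ω), IsProbabilityMeasure (ℙ : Measure Ω) →
      ∀ X : (n : ℕ) → Ω → (Fin n → Euc d),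
        (∀ n, Measurable (X n)) →
        (∀ n, 2 ≤ n → Measure.map (X n) ℙ = gibbs d n (β n) V) →
        ∀ᵐ ω ∂(ℙ : Measure Ω), ∀ p : ℝ, 1 ≤ p →
          Tendsto (fun n => wassDist d p (empMeas d n (X n ω)) (uniformBall d 0))
            atTop (𝓝 0)) := by
  refine ⟨fun p hp ε hε => complete_conv d hd V hV β hβpos hβ p hp ε hε, ?_⟩
  intro Ω _ _ X hX hmap
  exact as_conv d V β (fun p hp ε hε => complete_conv d hd V hV β hβpos hβ p hp ε hε) ℙ X hX hmap

end
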